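/- For every convex body K ⊆ ℝ³ of unit volume, the limit inferior of n^{-3} · EH^K_{3,4}(n) as n → ∞ is at least 3, and the limit superior of n^{-3} · EH^K_{3,4}(n) as n → ∞ is at most 12π²/35. -/

import Mathlib

open MeasureTheory Filter

noncomputable section

abbrev Euc (d : ℕ) : Type := EuclideanSpace ℝ (Fin d)

/-- A convex body: compact convex set with nonempty interior. -/
def IsConvexBody {d : ℕ} (K : Set (Euc d)) : Prop :=
  Convex ℝ K ∧ IsCompact K ∧ (interior K).Nonempty

/-- A set of points is in convex position if no point lies in the convex
hull of the others. -/
def InConvexPosition {d : ℕ} (P : Set (Euc d)) : Prop :=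
  ∀ p ∈ P, p ∉ convexHull ℝ (P \ {p})

/-- `H` is a `k`-hole in `S`. -/
def IsHole {d : ℕ} (k : ℕ) (S H : Finset (Euc d)) : Prop :=
  H ⊆ S ∧ H.card = k ∧ InConvexPosition (H : Set (Euc d)) ∧
    ∀ p ∈ S, p ∉ interior (convexHull ℝ (H : Set (Euc d)))

open Classical in
/-- The number of `k`-holes in the point set given by `x`. -/
noncomputable def holeCount (d k n : ℕ) (x : Fin n → Euc d) : ℕ :=
  ((Finset.image x Finset.univ).powerset.filter
    (fun H => IsHole k (Finset.image x Finset.univ) H)).card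

/-- The uniform probability distribution on `K`. -/
noncomputable def unif {d : ℕ} (K : Set (Euc d)) : Measure (Euc d) :=
  (volume K)⁻¹ • volume.restrict K

/-- The expected number of `k`-holes among `n` points drawn uniformly and
independently at random from `K`. -/
noncomputable def EH (d k : ℕ) (K : Set (Euc d)) (n : ℕ) : ℝ :=
  ∫ x : Fin n → Euc d, (holeCount d k n x : ℝ) ∂(Measure.pi fun _ : Fin n => unif K)

/-- The probability that, for `d+2` points chosen uniformly and independently
at random from `K`, one of the points lies in the convex hull of the others. -/
noncomputable def pSimplex (d : ℕ) (K : Set (Euc d)) : ℝ :=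
  ((Measure.pi fun _ : Fin (d + 2) => unif K)
    {x : Fin (d + 2) → Euc d | ∃ i, x i ∈ convexHull ℝ (x '' {j | j ≠ i})}).toReal

/-- The maximum of `pSimplex d K` over all convex bodies `K ⊆ ℝ^d`. -/
noncomputable def pMax (d : ℕ) : ℝ :=
  sSup {p : ℝ | ∃ K : Set (Euc d), IsConvexBody K ∧ p = pSimplex d K}

end

open scoped ENNReal

/-- Twice the signed area of the triangle with vertices `p 0`, `p 1`, `p 2`. -/
def triDet (p : Fin 3 → ℝ × ℝ) : ℝ :=
  ((p 1).1 - (p 0).1) * ((p 2).2 - (p 0).2) - ((p 2).1 - (p 0).1) * ((p 1).2 - (p 0).2)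

/-- The integral over `D³` of twice the area of the triangle spanned by three points of `D`. -/
noncomputable def triInt (D : Set (ℝ × ℝ)) : ℝ≥0∞ :=
  ∫⁻ p in Set.univ.pi (fun _ : Fin 3 => D), ‖triDet p‖ₑ

/-- `triDet` as a linear form in the ordinates, for fixed abscissae. -/
def triLin (x y : Fin 3 → ℝ) : ℝ := triDet fun i => (x i, y i)

lemma triLin_eq (x y : Fin 3 → ℝ) :
    triLin x y = (x 1 - x 0) * (y 2 - y 0) - (x 2 - x 0) * (y 1 - y 0) := rfl

lemma triLin_add (x y z : Fin 3 → ℝ) : triLin x (y + z) = triLin x y + triLin x z := by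
  simp only [triLin_eq, Pi.add_apply]; ring

lemma triLin_neg (x y : Fin 3 → ℝ) : triLin x (-y) = -triLin x y := by
  simp only [triLin_eq, Pi.neg_apply]; ring

lemma continuous_triDet : Continuous triDet := by
  unfold triDet; fun_prop

lemma continuous_triLin : Continuous fun z : (Fin 3 → ℝ) × (Fin 3 → ℝ) => triLin z.1 z.2 := by
  unfold triLin triDet; fun_prop

lemma measurable_triDet : Measurable triDet := continuous_triDet.measurable

/-- Fubini for `triInt`: integrate the ordinates over the vertical sections first. -/
lemma triInt_eq_lintegral_sections {D : Set (ℝ × ℝ)} (hD : MeasurableSet D) :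
    triInt D = ∫⁻ x : Fin 3 → ℝ, ∫⁻ y in Set.univ.pi (fun i => Prod.mk (x i) ⁻¹' D),
      ‖triLin x y‖ₑ := by
  have hpi : MeasurableSet (Set.univ.pi (fun _ : Fin 3 => D)) :=
    MeasurableSet.univ_pi fun _ => hD
  have hmp := (volume_measurePreserving_arrowProdEquivProdArrow ℝ ℝ (Fin 3)).symm
  unfold triInt
  rw [← lintegral_indicator hpi, ← hmp.lintegral_comp
    ((measurable_triDet.enorm).indicator hpi), Measure.volume_eq_prod, lintegral_prod]
  · refine lintegral_congr fun x => ?_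
    rw [← lintegral_indicator]
    · refine lintegral_congr fun y => ?_
      simp only [Set.indicator, Set.mem_univ_pi, Set.mem_preimage]
      rfl
    · exact MeasurableSet.univ_pi fun i => measurable_prodMk_left hD
  · exact (((measurable_triDet.enorm).indicator hpi).comp hmp.measurable).aemeasurable

lemma two_mul_lintegral_box (x m r : Fin 3 → ℝ) :
    2 * ∫⁻ y in Set.univ.pi (fun i => Set.Icc (m i - r i) (m i + r i)), ‖triLin x y‖ₑ =
      ∫⁻ t in Set.univ.pi (fun i => Set.Icc (- r i) (r i)),
        ENNReal.ofReal (2 * max |triLin x m| |triLin x t|) := by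
  have hc : Continuous fun y : Fin 3 → ℝ => triLin x y :=
    continuous_triLin.comp (by fun_prop : Continuous fun y : Fin 3 → ℝ => (x, y))
  have hms : ∀ a b : Fin 3 → ℝ, MeasurableSet (Set.univ.pi fun i => Set.Icc (a i) (b i)) :=
    fun a b => MeasurableSet.univ_pi fun i => measurableSet_Icc
  have h1 : ∫⁻ y in Set.univ.pi (fun i => Set.Icc (m i - r i) (m i + r i)), ‖triLin x y‖ₑ =
      ∫⁻ t in Set.univ.pi (fun i => Set.Icc (- r i) (r i)), ‖triLin x m + triLin x t‖ₑ := by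
    rw [← lintegral_indicator (hms _ _), ← lintegral_indicator (hms _ _),
      ← lintegral_add_left_eq_self _ m]
    refine lintegral_congr fun t => ?_
    simp only [Set.indicator, Set.mem_univ_pi, Set.mem_Icc, Pi.add_apply, triLin_add]
    congr 1
    simp only [eq_iff_iff]
    refine forall_congr' fun i => ?_
    constructor <;> rintro ⟨h, h'⟩ <;> constructor <;> linarith
  have h2 : ∫⁻ t in Set.univ.pi (fun i => Set.Icc (- r i) (r i)), ‖triLin x m + triLin x t‖ₑ =
      ∫⁻ t in Set.univ.pi (fun i => Set.Icc (- r i) (r i)), ‖triLin x m - triLin x t‖ₑ := by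
    rw [← lintegral_indicator (hms _ _), ← lintegral_indicator (hms _ _),
      ← lintegral_neg_eq_self]
    refine lintegral_congr fun t => ?_
    simp only [Set.indicator, Set.mem_univ_pi, Set.mem_Icc, Pi.neg_apply, triLin_neg,
      ← sub_eq_add_neg]
    congr 1
    simp only [eq_iff_iff]
    refine forall_congr' fun i => ?_
    constructor <;> rintro ⟨h, h'⟩ <;> constructor <;> linarith
  rw [two_mul, h1]
  nth_rewrite 2 [h2]
  rw [← lintegral_add_left (by fun_prop)]
  refine lintegral_congr fun t => ?_
  rw [Real.enorm_eq_ofReal_abs, Real.enorm_eq_ofReal_abs,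
    ← ENNReal.ofReal_add (abs_nonneg _) (abs_nonneg _)]
  congr 1
  generalize triLin x m = a
  generalize triLin x t = b
  rcases max_cases |a| |b| with ⟨h, h'⟩ | ⟨h, h'⟩ <;> rw [h] <;>
  rcases abs_cases a with ⟨h1, h1'⟩ | ⟨h1, h1'⟩ <;>
  rcases abs_cases b with ⟨h2, h2'⟩ | ⟨h2, h2'⟩ <;>
  rcases abs_cases (a + b) with ⟨h3, h3'⟩ | ⟨h3, h3'⟩ <;>
  rcases abs_cases (a - b) with ⟨h4, h4'⟩ | ⟨h4, h4'⟩ <;> linarith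

/-- Moving the vertical chords of a planar set so that the chord midpoints become more
collinear decreases `triInt`. -/
lemma triInt_le_triInt_of_sections {D D' : Set (ℝ × ℝ)} (hD : MeasurableSet D)
    (hD' : MeasurableSet D') {m m' r : ℝ → ℝ}
    (h : ∀ x, Prod.mk x ⁻¹' D = Set.Icc (m x - r x) (m x + r x))
    (h' : ∀ x, Prod.mk x ⁻¹' D' = Set.Icc (m' x - r x) (m' x + r x))
    (hm : ∀ x : Fin 3 → ℝ, (∀ i, 0 ≤ r (x i)) →
      |triLin x fun i => m (x i)| ≤ |triLin x fun i => m' (x i)|) :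
    triInt D ≤ triInt D' := by
  rw [triInt_eq_lintegral_sections hD, triInt_eq_lintegral_sections hD']
  refine lintegral_mono fun x => ?_
  simp only [h, h']
  by_cases hr : ∀ i, 0 ≤ r (x i)
  · refine (ENNReal.mul_le_mul_iff_right (a := 2) two_ne_zero ENNReal.ofNat_ne_top).1 ?_
    rw [two_mul_lintegral_box x (fun i => m (x i)) (fun i => r (x i)),
      two_mul_lintegral_box x (fun i => m' (x i)) (fun i => r (x i))]
    refine lintegral_mono fun t => ENNReal.ofReal_le_ofReal ?_
    have := hm x hr
    gcongr
  · push Not at hr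
    obtain ⟨i, hi⟩ := hr
    have : Set.univ.pi (fun i => Set.Icc (m (x i) - r (x i)) (m (x i) + r (x i))) = ∅ := by
      refine Set.univ_pi_eq_empty (i := i) (Set.Icc_eq_empty ?_)
      linarith
    rw [this]; simp

/-- The vertical sections of a compact convex planar set are closed intervals. -/
lemma exists_sections {D : Set (ℝ × ℝ)} (hc : IsCompact D) (hconv : Convex ℝ D) :
    ∃ m r : ℝ → ℝ, ∀ x, Prod.mk x ⁻¹' D = Set.Icc (m x - r x) (m x + r x) := by
  have key : ∀ x, ∃ mr : ℝ × ℝ, Prod.mk x ⁻¹' D = Set.Icc (mr.1 - mr.2) (mr.1 + mr.2) := by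
    intro x
    rcases Set.eq_empty_or_nonempty (Prod.mk x ⁻¹' D) with he | hne
    · exact ⟨(0, -1), by rw [he, Set.Icc_eq_empty]; norm_num⟩
    · have hcv : Convex ℝ (Prod.mk x ⁻¹' D) := by
        intro y hy z hz a b ha hb hab
        have := hconv hy hz ha hb hab
        simpa [← add_mul, hab] using this
      have hcp : IsCompact (Prod.mk x ⁻¹' D) := by
        have : Prod.mk x ⁻¹' D = Prod.snd '' (D ∩ {p | p.1 = x}) := by
          ext y; simp
        rw [this]
        exact (hc.inter_right (isClosed_eq continuous_fst continuous_const)).image continuous_snd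
      have := eq_Icc_of_connected_compact ⟨hne, hcv.isPreconnected⟩ hcp
      refine ⟨((sInf (Prod.mk x ⁻¹' D) + sSup (Prod.mk x ⁻¹' D)) / 2,
        (sSup (Prod.mk x ⁻¹' D) - sInf (Prod.mk x ⁻¹' D)) / 2), ?_⟩
      refine this.trans ?_
      congr 1 <;> ring
  choose f hf using key
  exact ⟨fun x => (f x).1, fun x => (f x).2, hf⟩

lemma volume_eq_of_sections {D D' : Set (ℝ × ℝ)} (hD : MeasurableSet D)
    (hD' : MeasurableSet D') {m m' r : ℝ → ℝ}
    (h : ∀ x, Prod.mk x ⁻¹' D = Set.Icc (m x - r x) (m x + r x))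
    (h' : ∀ x, Prod.mk x ⁻¹' D' = Set.Icc (m' x - r x) (m' x + r x)) :
    volume D = volume D' := by
  rw [Measure.volume_eq_prod, Measure.prod_apply hD, Measure.prod_apply hD']
  refine lintegral_congr fun x => ?_
  rw [h, h', Real.volume_Icc, Real.volume_Icc]
  congr 1; ring

/-- Steiner symmetrization of a planar set with respect to the horizontal axis. -/
def steiner (D : Set (ℝ × ℝ)) : Set (ℝ × ℝ) :=
  (fun q : (ℝ × ℝ) × (ℝ × ℝ) => (q.1.1, (q.1.2 - q.2.2) / 2)) ''
    ((D ×ˢ D) ∩ {q | q.1.1 = q.2.1})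

/-- Blaschke shaking of a planar set against the horizontal axis. -/
def shake (D : Set (ℝ × ℝ)) : Set (ℝ × ℝ) :=
  (fun q : (ℝ × ℝ) × (ℝ × ℝ) => (q.1.1, q.1.2 - q.2.2)) ''
    ((D ×ˢ D) ∩ {q | q.1.1 = q.2.1 ∧ q.2.2 ≤ q.1.2})

lemma isCompact_steiner {D : Set (ℝ × ℝ)} (hc : IsCompact D) : IsCompact (steiner D) := by
  refine IsCompact.image ((hc.prod hc).inter_right ?_) (by fun_prop)
  exact isClosed_eq (by fun_prop) (by fun_prop)

lemma isCompact_shake {D : Set (ℝ × ℝ)} (hc : IsCompact D) : IsCompact (shake D) := by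
  refine IsCompact.image ((hc.prod hc).inter_right ?_) (by fun_prop)
  exact IsClosed.and (isClosed_eq (by fun_prop) (by fun_prop))
    (isClosed_le (by fun_prop) (by fun_prop))

lemma convex_steiner {D : Set (ℝ × ℝ)} (hc : Convex ℝ D) : Convex ℝ (steiner D) := by
  refine Convex.is_linear_image ((hc.prod hc).inter ?_) ?_
  · intro q hq q' hq' a b ha hb hab
    simp only [Set.mem_ofPred_eq] at *
    simp [hq, hq']
  · constructor
    · intro x y; ext <;> simp; ring
    · intro c x; ext <;> simp; ring

lemma convex_shake {D : Set (ℝ × ℝ)} (hc : Convex ℝ D) : Convex ℝ (shake D) := by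
  refine Convex.is_linear_image ((hc.prod hc).inter ?_) ?_
  · intro q hq q' hq' a b ha hb hab
    simp only [Set.mem_ofPred_eq] at *
    refine ⟨by simp [hq.1, hq'.1], ?_⟩
    simp only [Prod.fst_add, Prod.snd_add, Prod.smul_fst, Prod.smul_snd, smul_eq_mul]
    have := hq.2
    have := hq'.2
    gcongr
  · constructor
    · intro x y; ext <;> simp; ring
    · intro c x; ext <;> simp; ring

lemma section_steiner {D : Set (ℝ × ℝ)} {m r : ℝ → ℝ}
    (h : ∀ x, Prod.mk x ⁻¹' D = Set.Icc (m x - r x) (m x + r x)) (x : ℝ) :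
    Prod.mk x ⁻¹' steiner D = Set.Icc (0 - r x) (0 + r x) := by
  have hD : ∀ x y, (x, y) ∈ D ↔ m x - r x ≤ y ∧ y ≤ m x + r x := fun x y => by
    rw [← Set.mem_Icc, ← h]; rfl
  ext t
  simp only [steiner, Set.mem_preimage, Set.mem_image, Set.mem_inter_iff, Set.mem_prod,
    Set.mem_ofPred_eq, Prod.mk.injEq, Set.mem_Icc]
  constructor
  · rintro ⟨⟨⟨a, b⟩, ⟨a', b'⟩⟩, ⟨⟨h1, h2⟩, h3⟩, h4, h5⟩
    simp only at h3 h4 h5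
    subst h3 h4
    rw [hD] at h1 h2
    constructor <;> linarith [h1.1, h1.2, h2.1, h2.2]
  · rintro ⟨h1, h2⟩
    refine ⟨⟨(x, m x + t), (x, m x - t)⟩, ⟨⟨?_, ?_⟩, rfl⟩, rfl, ?_⟩
    · rw [hD]; constructor <;> linarith
    · rw [hD]; constructor <;> linarith
    · simp only; ring

lemma section_shake {D : Set (ℝ × ℝ)} {m r : ℝ → ℝ}
    (h : ∀ x, Prod.mk x ⁻¹' D = Set.Icc (m x - r x) (m x + r x)) (x : ℝ) :
    Prod.mk x ⁻¹' shake D = Set.Icc (r x - r x) (r x + r x) := by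
  have hD : ∀ x y, (x, y) ∈ D ↔ m x - r x ≤ y ∧ y ≤ m x + r x := fun x y => by
    rw [← Set.mem_Icc, ← h]; rfl
  ext t
  simp only [shake, Set.mem_preimage, Set.mem_image, Set.mem_inter_iff, Set.mem_prod,
    Set.mem_ofPred_eq, Prod.mk.injEq, Set.mem_Icc]
  constructor
  · rintro ⟨⟨⟨a, b⟩, ⟨a', b'⟩⟩, ⟨⟨h1, h2⟩, h3, h6⟩, h4, h5⟩
    simp only at h3 h4 h5 h6
    subst h3 h4
    rw [hD] at h1 h2
    constructor <;> linarith [h1.1, h1.2, h2.1, h2.2]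
  · rintro ⟨h1, h2⟩
    refine ⟨⟨(x, m x + t / 2), (x, m x - t / 2)⟩, ⟨⟨?_, ?_⟩, rfl, ?_⟩, rfl, ?_⟩
    · rw [hD]; constructor <;> linarith
    · rw [hD]; constructor <;> linarith
    · simp only; linarith
    · simp only; ring

lemma triInt_steiner_le {D : Set (ℝ × ℝ)} (hc : IsCompact D) (hconv : Convex ℝ D) :
    triInt (steiner D) ≤ triInt D := by
  obtain ⟨m, r, h⟩ := exists_sections hc hconv
  refine triInt_le_triInt_of_sections (isCompact_steiner hc).measurableSet hc.measurableSet
    (m := fun _ => 0) (section_steiner h) h fun x _ => ?_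
  simp [triLin_eq]

lemma volume_steiner {D : Set (ℝ × ℝ)} (hc : IsCompact D) (hconv : Convex ℝ D) :
    volume (steiner D) = volume D := by
  obtain ⟨m, r, h⟩ := exists_sections hc hconv
  exact volume_eq_of_sections (isCompact_steiner hc).measurableSet hc.measurableSet
    (m := fun _ => 0) (section_steiner h) h

lemma volume_shake {D : Set (ℝ × ℝ)} (hc : IsCompact D) (hconv : Convex ℝ D) :
    volume (shake D) = volume D := by
  obtain ⟨m, r, h⟩ := exists_sections hc hconv
  exact volume_eq_of_sections (isCompact_shake hc).measurableSet hc.measurableSet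
    (section_shake h) h

lemma triInt_le_shake {D : Set (ℝ × ℝ)} (hc : IsCompact D) (hconv : Convex ℝ D) :
    triInt D ≤ triInt (shake D) := by
  obtain ⟨m, r, h⟩ := exists_sections hc hconv
  refine triInt_le_triInt_of_sections hc.measurableSet (isCompact_shake hc).measurableSet
    h (section_shake h) fun x hr => ?_
  have hD : ∀ x y, (x, y) ∈ D ↔ m x - r x ≤ y ∧ y ≤ m x + r x := fun x y => by
    rw [← Set.mem_Icc, ← h]; rfl
  have key : ∀ u v w : ℝ, 0 ≤ r u → 0 ≤ r w → u ≤ v → v ≤ w →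
      (w - v) * (m u + r u) + (v - u) * (m w + r w) ≤ (w - u) * (m v + r v) ∧
      (w - u) * (m v - r v) ≤ (w - v) * (m u - r u) + (v - u) * (m w - r w) := by
    intro u v w hu hw huv hvw
    rcases huv.eq_or_lt with rfl | huv'
    · constructor <;> linarith
    have hpos : 0 < w - u := by linarith
    have ha : 0 ≤ (w - v) / (w - u) := div_nonneg (by linarith) hpos.le
    have hb : 0 ≤ (v - u) / (w - u) := div_nonneg (by linarith) hpos.le
    have hab : (w - v) / (w - u) + (v - u) / (w - u) = 1 := by field_simp; ring
    have hx : (w - v) / (w - u) * u + (v - u) / (w - u) * w = v := by field_simp; ring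
    have h1 := hconv ((hD u (m u + r u)).2 ⟨by linarith, le_rfl⟩)
      ((hD w (m w + r w)).2 ⟨by linarith, le_rfl⟩) ha hb hab
    have h2 := hconv ((hD u (m u - r u)).2 ⟨le_rfl, by linarith⟩)
      ((hD w (m w - r w)).2 ⟨le_rfl, by linarith⟩) ha hb hab
    simp only [Prod.smul_mk, Prod.mk_add_mk, smul_eq_mul, hx, hD] at h1 h2
    constructor
    · have := mul_le_mul_of_nonneg_left h1.2 hpos.le
      refine le_trans (le_of_eq ?_) this
      field_simp
    · have := mul_le_mul_of_nonneg_left h2.1 hpos.le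
      refine this.trans (le_of_eq ?_)
      field_simp
  have h0 := hr 0
  have h1 := hr 1
  have h2 := hr 2
  simp only [triLin_eq]
  generalize x 0 = u at *
  generalize x 1 = v at *
  generalize x 2 = w at *
  have hsign : ∀ A B : ℝ, (A ≤ B ∧ -A ≤ B) ∨ (A ≤ -B ∧ -A ≤ -B) → |A| ≤ |B| := by
    rintro A B (⟨h, h'⟩ | ⟨h, h'⟩)
    · exact (abs_le'.2 ⟨h, h'⟩).trans (le_abs_self B)
    · exact (abs_le'.2 ⟨h, h'⟩).trans (neg_le_abs B)
  apply hsign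
  rcases le_total u v with huv | huv <;> rcases le_total v w with hvw | hvw <;>
    rcases le_total u w with huw | huw
  · obtain ⟨k1, k2⟩ := key u v w h0 h2 huv hvw
    right; constructor <;> linarith
  · obtain ⟨k1, k2⟩ := key u v w h0 h2 huv hvw
    right; constructor <;> linarith
  · obtain ⟨k1, k2⟩ := key u w v h0 h1 huw hvw
    left; constructor <;> linarith
  · obtain ⟨k1, k2⟩ := key w u v h2 h1 huw huv
    right; constructor <;> linarith
  · obtain ⟨k1, k2⟩ := key v u w h1 h2 huv huw
    left; constructor <;> linarith
  · obtain ⟨k1, k2⟩ := key v w u h1 h0 hvw huw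
    right; constructor <;> linarith
  · obtain ⟨k1, k2⟩ := key w v u h2 h0 hvw huv
    left; constructor <;> linarith
  · obtain ⟨k1, k2⟩ := key w v u h2 h0 hvw huv
    left; constructor <;> linarith

/-- The planar linear map with matrix `!![a, b; c, d]`. -/
noncomputable def planarLin (a b c d : ℝ) : ℝ × ℝ →ₗ[ℝ] ℝ × ℝ :=
  Matrix.toLin (Module.Basis.finTwoProd ℝ) (Module.Basis.finTwoProd ℝ) !![a, b; c, d]

lemma planarLin_apply (a b c d : ℝ) (p : ℝ × ℝ) :
    planarLin a b c d p = (a * p.1 + b * p.2, c * p.1 + d * p.2) :=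
  Matrix.toLin_finTwoProd_apply a b c d p

lemma det_planarLin (a b c d : ℝ) : LinearMap.det (planarLin a b c d) = a * d - b * c := by
  rw [planarLin, LinearMap.det_toLin, Matrix.det_fin_two_of]

/-- The planar affine map `p ↦ !![a, b; c, d] p + v`. -/
noncomputable def planarAff (a b c d : ℝ) (v p : ℝ × ℝ) : ℝ × ℝ :=
  (a * p.1 + b * p.2 + v.1, c * p.1 + d * p.2 + v.2)

lemma planarAff_eq (a b c d : ℝ) (v p : ℝ × ℝ) :
    planarAff a b c d v p = planarLin a b c d p + v := by
  rw [planarLin_apply]; rfl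

lemma continuous_planarAff (a b c d : ℝ) (v : ℝ × ℝ) : Continuous (planarAff a b c d v) := by
  unfold planarAff; fun_prop

lemma volume_preimage_planarAff {a b c d : ℝ} (h : a * d - b * c ≠ 0) (v : ℝ × ℝ)
    (D : Set (ℝ × ℝ)) :
    volume D = ‖a * d - b * c‖ₑ * volume (planarAff a b c d v ⁻¹' D) := by
  have h1 : planarAff a b c d v ⁻¹' D = planarLin a b c d ⁻¹' ((· + v) ⁻¹' D) := by
    ext p; simp [planarAff_eq]
  rw [h1, Measure.addHaar_preimage_linearMap _ (by rwa [det_planarLin]), det_planarLin,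
    measure_preimage_add_right, ← mul_assoc, Real.enorm_eq_ofReal_abs,
    ← ENNReal.ofReal_mul (abs_nonneg _), ← abs_mul, mul_inv_cancel₀ h]
  simp

lemma triDet_planarAff (a b c d : ℝ) (v : ℝ × ℝ) (p : Fin 3 → ℝ × ℝ) :
    triDet (fun i => planarAff a b c d v (p i)) = (a * d - b * c) * triDet p := by
  simp only [triDet, planarAff]; ring

lemma triInt_preimage_planarAff {a b c d : ℝ} (h : a * d - b * c ≠ 0) (v : ℝ × ℝ)
    {D : Set (ℝ × ℝ)} (hD : MeasurableSet D) :
    triInt D = ‖a * d - b * c‖ₑ ^ 4 * triInt (planarAff a b c d v ⁻¹' D) := by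
  let f : (Fin 3 → ℝ × ℝ) →ₗ[ℝ] (Fin 3 → ℝ × ℝ) :=
    LinearMap.pi fun i => (planarLin a b c d).comp (LinearMap.proj i)
  have hdet : LinearMap.det f = (a * d - b * c) ^ 3 := by
    rw [LinearMap.det_pi]; simp [det_planarLin]
  have hf : LinearMap.det f ≠ 0 := by rw [hdet]; exact pow_ne_zero _ h
  let G : (Fin 3 → ℝ × ℝ) → ℝ≥0∞ :=
    (Set.univ.pi fun _ : Fin 3 => D).indicator fun p => ‖triDet p‖ₑ
  have hpi : MeasurableSet (Set.univ.pi fun _ : Fin 3 => D) :=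
    MeasurableSet.univ_pi fun _ => hD
  have hG : Measurable G := (measurable_triDet.enorm).indicator hpi
  have hpi' : MeasurableSet (Set.univ.pi fun _ : Fin 3 => planarAff a b c d v ⁻¹' D) :=
    MeasurableSet.univ_pi fun _ => (continuous_planarAff a b c d v).measurable hD
  have hfm : Measurable f := f.continuous_of_finiteDimensional.measurable
  have h1 : ∫⁻ p, G (f p + fun _ => v) =
      ‖a * d - b * c‖ₑ * triInt (planarAff a b c d v ⁻¹' D) := by
    rw [triInt, ← lintegral_indicator hpi', ← lintegral_const_mul]
    · refine lintegral_congr fun p => ?_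
      have : (f p + fun _ => v) = fun i => planarAff a b c d v (p i) := by
        ext i : 1; simp [planarAff_eq, f]
      rw [this]
      have hiff : (fun i => planarAff a b c d v (p i)) ∈ Set.univ.pi (fun _ : Fin 3 => D) ↔
          p ∈ Set.univ.pi (fun _ : Fin 3 => planarAff a b c d v ⁻¹' D) := by
        simp only [Set.mem_univ_pi, Set.mem_preimage]
      by_cases hp : p ∈ Set.univ.pi (fun _ : Fin 3 => planarAff a b c d v ⁻¹' D)
      · simp only [G, Set.indicator_of_mem hp, Set.indicator_of_mem (hiff.2 hp),
          triDet_planarAff, enorm_mul]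
      · simp only [G, Set.indicator_of_notMem hp, Set.indicator_of_notMem (mt hiff.1 hp),
          mul_zero]
    · exact (measurable_triDet.enorm).indicator hpi'
  have h2 : ∫⁻ p, G (f p + fun _ => v) = ‖(a * d - b * c)⁻¹‖ₑ ^ 3 * triInt D := by
    have := lintegral_map (μ := volume) (f := fun p => G (p + fun _ => v))
      (hG.comp (measurable_add_const _)) hfm
    rw [← this, Measure.map_linearMap_addHaar_eq_smul_addHaar _ hf, lintegral_smul_measure,
      lintegral_add_right_eq_self, hdet, lintegral_indicator hpi, triInt, ← inv_pow,
      ← Real.enorm_eq_ofReal_abs, enorm_pow, smul_eq_mul]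
  rw [pow_succ, mul_assoc, ← h1, h2, ← mul_assoc, ← mul_pow, ← enorm_mul, mul_inv_cancel₀ h]
  simp

lemma isCompact_preimage_planarAff {a b c d : ℝ} (h : a * d - b * c ≠ 0) (v : ℝ × ℝ)
    {D : Set (ℝ × ℝ)} (hD : IsCompact D) : IsCompact (planarAff a b c d v ⁻¹' D) := by
  set e := a * d - b * c with he
  let g : ℝ × ℝ → ℝ × ℝ := fun q =>
    ((d * (q.1 - v.1) - b * (q.2 - v.2)) / e, (a * (q.2 - v.2) - c * (q.1 - v.1)) / e)
  have h1 : Function.LeftInverse (planarAff a b c d v) g := by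
    intro q
    ext
    · simp only [planarAff, g]; field_simp; rw [he]; ring
    · simp only [planarAff, g]; field_simp; rw [he]; ring
  have h2 : Function.RightInverse (planarAff a b c d v) g := by
    intro q
    ext
    · simp only [planarAff, g]; field_simp; rw [he]; ring
    · simp only [planarAff, g]; field_simp; rw [he]; ring
  rw [← Set.image_eq_preimage_of_inverse h1 h2]
  exact hD.image (by fun_prop)

lemma convex_preimage_planarAff (a b c d : ℝ) (v : ℝ × ℝ)
    {D : Set (ℝ × ℝ)} (hD : Convex ℝ D) : Convex ℝ (planarAff a b c d v ⁻¹' D) := by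
  intro p hp q hq s t hs ht hst
  have := hD hp hq hs ht hst
  rw [Set.mem_preimage]
  convert this using 1
  obtain rfl : t = 1 - s := by linarith
  ext <;> simp [planarAff] <;> ring

lemma lintegral_fin_three {f : (Fin 3 → ℝ) → ℝ≥0∞} (hf : Measurable f) :
    ∫⁻ x, f x = ∫⁻ x₀, ∫⁻ x₂, ∫⁻ x₁, f ![x₀, x₁, x₂] := by
  have h1 := (volume_preserving_piFinSuccAbove (fun _ : Fin 3 => ℝ) 1).symm
  have h2 := (volume_preserving_finTwoArrow ℝ).symm
  let g : ℝ × (Fin 2 → ℝ) → ℝ≥0∞ := fun z =>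
    f ((MeasurableEquiv.piFinSuccAbove (fun _ : Fin 3 => ℝ) 1).symm z)
  have hg : Measurable g := hf.comp h1.measurable
  have h3 : Measurable fun y : Fin 2 → ℝ => ∫⁻ x : ℝ, g (x, y) := hg.lintegral_prod_left'
  have h4 : Measurable fun y : ℝ × ℝ => ∫⁻ x : ℝ, g (x, MeasurableEquiv.finTwoArrow.symm y) :=
    h3.comp h2.measurable
  have h5 : ∫⁻ x, f x = ∫⁻ z, g z := (h1.lintegral_comp hf).symm
  rw [h5, Measure.volume_eq_prod, lintegral_prod_symm _ hg.aemeasurable, ← h2.lintegral_comp h3,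
    Measure.volume_eq_prod, lintegral_prod _ h4.aemeasurable]
  refine lintegral_congr fun x₀ => lintegral_congr fun x₂ => lintegral_congr fun x₁ => ?_
  refine congrArg f ?_
  ext i
  fin_cases i <;> rfl

lemma lintegral_Icc_ofReal_eq {f F : ℝ → ℝ} {a b : ℝ} (hab : a ≤ b) (hf : Continuous f)
    (hF : ∀ t, HasDerivAt F (f t) t) (h0 : ∀ t ∈ Set.Icc a b, 0 ≤ f t) :
    ∫⁻ t in Set.Icc a b, ENNReal.ofReal (f t) = ENNReal.ofReal (F b - F a) := by
  rw [← intervalIntegral.integral_eq_sub_of_hasDerivAt (fun t _ => hF t)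
    (hf.intervalIntegrable a b), intervalIntegral.integral_of_le hab,
    ← integral_Icc_eq_integral_Ioc, ofReal_integral_eq_lintegral_ofReal]
  · exact hf.continuousOn.integrableOn_Icc
  · exact (ae_restrict_iff' measurableSet_Icc).2 (Eventually.of_forall h0)

lemma triDet_eq_det (p : Fin 3 → ℝ × ℝ) :
    triDet p = (Matrix.of fun i => ![1, (p i).1, (p i).2]).det := by
  simp [triDet, Matrix.det_fin_three]; ring

lemma enorm_triDet_perm (σ : Equiv.Perm (Fin 3)) (p : Fin 3 → ℝ × ℝ) :
    ‖triDet (p ∘ σ)‖ₑ = ‖triDet p‖ₑ := by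
  have : (Matrix.of fun i => ![1, ((p ∘ σ) i).1, ((p ∘ σ) i).2]) =
      (Matrix.of fun i => ![1, (p i).1, (p i).2]).submatrix σ id := by
    ext i j; simp
  rw [triDet_eq_det, triDet_eq_det, this, Matrix.det_permute, enorm_mul]
  rcases Int.units_eq_one_or (Equiv.Perm.sign σ) with h | h <;> simp [h]

lemma triInt_le_six_mul {D : Set (ℝ × ℝ)} (hD : MeasurableSet D) :
    triInt D ≤ 6 * ∫⁻ p in {p : Fin 3 → ℝ × ℝ | (∀ i, p i ∈ D) ∧ Monotone fun i => (p i).1},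
      ‖triDet p‖ₑ := by
  let A : Set (Fin 3 → ℝ × ℝ) := {p | (∀ i, p i ∈ D) ∧ Monotone fun i => (p i).1}
  have hpi : MeasurableSet (Set.univ.pi fun _ : Fin 3 => D) :=
    MeasurableSet.univ_pi fun _ => hD
  have hA : MeasurableSet A := by
    have : A = (Set.univ.pi fun _ : Fin 3 => D) ∩ {p | Monotone fun i => (p i).1} := by
      ext p; simp [A]
    rw [this]
    refine hpi.inter ?_
    have : {p : Fin 3 → ℝ × ℝ | Monotone fun i => (p i).1} =
        ⋂ i, ⋂ j, ⋂ (_ : i ≤ j), {p | (p i).1 ≤ (p j).1} := by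
      ext p; simp [Monotone]
    rw [this]
    exact MeasurableSet.iInter fun i => MeasurableSet.iInter fun j => MeasurableSet.iInter
      fun _ => measurableSet_le (by fun_prop) (by fun_prop)
  have hG : Measurable (A.indicator fun p => ‖triDet p‖ₑ) := measurable_triDet.enorm.indicator hA
  have hperm : ∀ σ : Equiv.Perm (Fin 3),
      ∫⁻ p, A.indicator (fun p => ‖triDet p‖ₑ) (p ∘ σ) = ∫⁻ p in A, ‖triDet p‖ₑ := by
    intro σ
    have h := volume_measurePreserving_piCongrLeft (fun _ : Fin 3 => ℝ × ℝ) σ.symm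
    rw [← lintegral_indicator hA, ← h.lintegral_comp hG]
    refine lintegral_congr fun p => ?_
    congr 1
    ext i : 1
    have := MeasurableEquiv.piCongrLeft_apply_apply (β := fun _ : Fin 3 => ℝ × ℝ)
      (e := σ.symm) p (σ i)
    simpa using this.symm
  calc triInt D = ∫⁻ p, (Set.univ.pi fun _ : Fin 3 => D).indicator (fun p => ‖triDet p‖ₑ) p := by
        rw [triInt, lintegral_indicator hpi]
    _ ≤ ∫⁻ p, ∑ σ : Equiv.Perm (Fin 3), A.indicator (fun p => ‖triDet p‖ₑ) (p ∘ σ) := by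
        refine lintegral_mono fun p => ?_
        by_cases hp : p ∈ Set.univ.pi fun _ : Fin 3 => D
        · rw [Set.indicator_of_mem hp]
          have hmem : p ∘ Tuple.sort (fun i => (p i).1) ∈ A :=
            ⟨fun i => hp _ trivial, Tuple.monotone_sort fun i => (p i).1⟩
          refine le_trans ?_ (Finset.single_le_sum (fun _ _ => zero_le)
            (Finset.mem_univ (Tuple.sort fun i => (p i).1)))
          rw [Set.indicator_of_mem hmem, enorm_triDet_perm]
        · rw [Set.indicator_of_notMem hp]; exact zero_le
    _ = ∑ σ : Equiv.Perm (Fin 3), ∫⁻ p in A, ‖triDet p‖ₑ := by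
        rw [lintegral_finsetSum]
        · exact Finset.sum_congr rfl fun σ _ => hperm σ
        · intro σ _
          exact hG.comp (by fun_prop)
    _ = 6 * ∫⁻ p in A, ‖triDet p‖ₑ := by
        rw [Finset.sum_const, Finset.card_univ, Fintype.card_perm, nsmul_eq_mul]
        norm_num [Nat.factorial]

/-- The standard triangle. -/
def stdTriangle : Set (ℝ × ℝ) := {p | 0 ≤ p.1 ∧ 0 ≤ p.2 ∧ p.1 + p.2 ≤ 1}

lemma lintegral_Icc_poly {f : ℝ → ℝ} {a b : ℝ} (hab : a ≤ b) (c₀ c₁ c₂ c₃ c₄ c₅ : ℝ)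
    (hf : ∀ t, f t = c₀ + c₁ * t + c₂ * t ^ 2 + c₃ * t ^ 3 + c₄ * t ^ 4 + c₅ * t ^ 5)
    (h0 : ∀ t ∈ Set.Icc a b, 0 ≤ f t) :
    ∫⁻ t in Set.Icc a b, ENNReal.ofReal (f t) = ENNReal.ofReal
      (c₀ * (b - a) + c₁ * (b ^ 2 - a ^ 2) / 2 + c₂ * (b ^ 3 - a ^ 3) / 3 +
        c₃ * (b ^ 4 - a ^ 4) / 4 + c₄ * (b ^ 5 - a ^ 5) / 5 + c₅ * (b ^ 6 - a ^ 6) / 6) := by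
  obtain rfl := funext hf
  have hd : ∀ (c : ℝ) (k : ℕ) (t : ℝ),
      HasDerivAt (fun t => c / (k + 1) * t ^ (k + 1)) (c * t ^ k) t := by
    intro c k t
    have := (hasDerivAt_pow (k + 1) t).const_mul (c / (k + 1))
    refine this.congr_deriv ?_
    rw [Nat.add_sub_cancel]
    push_cast
    have : (k : ℝ) + 1 ≠ 0 := by positivity
    field_simp
  rw [lintegral_Icc_ofReal_eq hab (by fun_prop) (fun t => by
    simpa only [pow_zero, mul_one, pow_one] using (((((hd c₀ 0 t).add (hd c₁ 1 t)).add
      (hd c₂ 2 t)).add (hd c₃ 3 t)).add (hd c₄ 4 t)).add (hd c₅ 5 t)) h0]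
  congr 1
  simp only [Pi.add_apply]
  push_cast
  ring

lemma measurableSet_stdTriangle : MeasurableSet stdTriangle := by
  have h1 : MeasurableSet {p : ℝ × ℝ | 0 ≤ p.1} := measurableSet_le (by fun_prop) (by fun_prop)
  have h2 : MeasurableSet {p : ℝ × ℝ | 0 ≤ p.2} := measurableSet_le (by fun_prop) (by fun_prop)
  have h3 : MeasurableSet {p : ℝ × ℝ | p.1 + p.2 ≤ 1} :=
    measurableSet_le (by fun_prop) (by fun_prop)
  exact h1.inter (h2.inter h3)

lemma lintegral_abs_sub_le {k l y : ℝ} (hk : 0 ≤ k) (hy : 0 ≤ y) (hyl : y ≤ l) :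
    ∫⁻ t in Set.Icc 0 l, ENNReal.ofReal (k * |t - y|) ≤
      ENNReal.ofReal (k * (y ^ 2 + (l - y) ^ 2) / 2) := by
  rw [← Set.Icc_union_Icc_eq_Icc hy hyl]
  refine (lintegral_union_le _ _ _).trans ?_
  have h1 : ∫⁻ t in Set.Icc 0 y, ENNReal.ofReal (k * |t - y|) =
      ENNReal.ofReal (k * y ^ 2 / 2) := by
    rw [setLIntegral_congr_fun (g := fun t => ENNReal.ofReal (k * (y - t))) measurableSet_Icc,
      lintegral_Icc_poly hy (k * y) (-k) 0 0 0 0]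
    · congr 1; ring
    · intro t; ring
    · intro t ht; exact mul_nonneg hk (by linarith [ht.2])
    · intro t ht
      simp only
      rw [abs_of_nonpos (by linarith [ht.2])]; congr 1; ring
  have h2 : ∫⁻ t in Set.Icc y l, ENNReal.ofReal (k * |t - y|) =
      ENNReal.ofReal (k * (l - y) ^ 2 / 2) := by
    rw [setLIntegral_congr_fun (g := fun t => ENNReal.ofReal (k * (t - y))) measurableSet_Icc,
      lintegral_Icc_poly hyl (- k * y) k 0 0 0 0]
    · congr 1; ring
    · intro t; ring
    · intro t ht; exact mul_nonneg hk (by linarith [ht.1])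
    · intro t ht
      simp only
      rw [abs_of_nonneg (by linarith [ht.1])]
  rw [h1, h2, ← ENNReal.ofReal_add (by positivity) (by positivity)]
  apply le_of_eq; congr 1; ring

/-- Integral of `triLin` over a product of three vertical chords of the standard triangle. -/
lemma lintegral_triLin_chords_le {a b c : ℝ} (hab : a ≤ b) (hbc : b ≤ c) (hac : a < c)
    (hc : c ≤ 1) :
    ∫⁻ y₀ in Set.Icc 0 (1 - a), ∫⁻ y₂ in Set.Icc 0 (1 - c), ∫⁻ y₁ in Set.Icc 0 (1 - b),
        ‖triLin ![a, b, c] ![y₀, y₁, y₂]‖ₑ ≤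
      ENNReal.ofReal (((c - b) ^ 2 * (1 - a) ^ 3 * (1 - c) / 3 +
        (c - b) * (b - a) * (1 - a) ^ 2 * (1 - c) ^ 2 / 2 +
        (b - a) ^ 2 * (1 - a) * (1 - c) ^ 3 / 3) / (c - a)) := by
  have hD : 0 < c - a := by linarith
  obtain ⟨u, hu⟩ : ∃ u, u = c - b := ⟨_, rfl⟩
  obtain ⟨v, hv⟩ : ∃ v, v = b - a := ⟨_, rfl⟩
  obtain ⟨k, hk⟩ : ∃ k, k = 1 - a := ⟨_, rfl⟩
  obtain ⟨l, hl⟩ : ∃ l, l = 1 - c := ⟨_, rfl⟩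
  have hu0 : 0 ≤ u := by linarith
  have hv0 : 0 ≤ v := by linarith
  have hk0 : 0 ≤ k := by linarith
  have hl0 : 0 ≤ l := by linarith
  have huv : 0 < u + v := by linarith
  have hb : 1 - b = (u * k + v * l) / (u + v) := by
    rw [eq_div_iff huv.ne', hu, hv, hk, hl]; ring
  have hL : ∀ y₀ y₁ y₂ : ℝ, ‖triLin ![a, b, c] ![y₀, y₁, y₂]‖ₑ =
      ENNReal.ofReal ((u + v) * |y₁ - (u * y₀ + v * y₂) / (u + v)|) := by
    intro y₀ y₁ y₂
    rw [Real.enorm_eq_ofReal_abs]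
    congr 1
    conv_rhs => rw [← abs_of_pos huv]
    rw [← abs_mul, abs_of_pos huv, mul_sub, mul_div_cancel₀ _ huv.ne', ← abs_neg]
    congr 1
    simp only [triLin_eq, Matrix.cons_val_zero, Matrix.cons_val_one, Matrix.cons_val]
    rw [hu, hv]; ring
  simp only [hL]
  rw [← hu, ← hv, ← hk, ← hl, hb, show c - a = u + v by rw [hu, hv]; ring]
  calc ∫⁻ y₀ in Set.Icc 0 k, ∫⁻ y₂ in Set.Icc 0 l,
        ∫⁻ y₁ in Set.Icc 0 ((u * k + v * l) / (u + v)),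
        ENNReal.ofReal ((u + v) * |y₁ - (u * y₀ + v * y₂) / (u + v)|)
      ≤ ∫⁻ y₀ in Set.Icc 0 k, ∫⁻ y₂ in Set.Icc 0 l,
        ENNReal.ofReal (((u * y₀ + v * y₂) ^ 2 +
          (u * (k - y₀) + v * (l - y₂)) ^ 2) / (2 * (u + v))) := by
        refine setLIntegral_mono' measurableSet_Icc fun y₀ h₀ =>
          setLIntegral_mono' measurableSet_Icc fun y₂ h₂ => ?_
        have h₀' := h₀.1
        have h₂' := h₂.1
        refine (lintegral_abs_sub_le huv.le (by positivity) ?_).trans (le_of_eq ?_)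
        · have := h₀.2
          have := h₂.2
          gcongr
        · congr 1; field_simp; ring
    _ = ∫⁻ y₀ in Set.Icc 0 k, ENNReal.ofReal ((u ^ 2 * l * (y₀ ^ 2 + (k - y₀) ^ 2) +
          u * v * l ^ 2 * k + 2 * v ^ 2 * l ^ 3 / 3) / (2 * (u + v))) := by
        refine lintegral_congr fun y₀ => ?_
        rw [lintegral_Icc_poly hl0
          (((u * y₀) ^ 2 + (u * (k - y₀) + v * l) ^ 2) / (2 * (u + v)))
          ((2 * u * v * y₀ - 2 * v * (u * (k - y₀) + v * l)) / (2 * (u + v)))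
          (2 * v ^ 2 / (2 * (u + v))) 0 0 0]
        · congr 1; field_simp; ring
        · intro t; field_simp; ring
        · intro t _; positivity
    _ = _ := by
        rw [lintegral_Icc_poly hk0
          ((u ^ 2 * l * k ^ 2 + u * v * l ^ 2 * k + 2 * v ^ 2 * l ^ 3 / 3) / (2 * (u + v)))
          (- 2 * u ^ 2 * l * k / (2 * (u + v))) (2 * u ^ 2 * l / (2 * (u + v))) 0 0 0]
        · congr 1; field_simp; ring
        · intro t; field_simp; ring
        · intro t _; positivity

lemma lintegral_le_setLIntegral {f g : ℝ → ℝ≥0∞} {s : Set ℝ} (hs : MeasurableSet s)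
    (h0 : ∀ t ∉ s, f t = 0) (h1 : ∀ t ∈ s, f t ≤ g t) : ∫⁻ t, f t ≤ ∫⁻ t in s, g t := by
  rw [← lintegral_indicator hs]
  refine lintegral_mono fun t => ?_
  by_cases ht : t ∈ s
  · rw [Set.indicator_of_mem ht]; exact h1 t ht
  · rw [h0 t ht]; exact zero_le

lemma lintegral_sorted_chords_le :
    ∫⁻ a in Set.Icc (0 : ℝ) 1, ∫⁻ c in Set.Icc a 1, ∫⁻ b in Set.Icc a c,
      ENNReal.ofReal (((c - b) ^ 2 * (1 - a) ^ 3 * (1 - c) / 3 +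
        (c - b) * (b - a) * (1 - a) ^ 2 * (1 - c) ^ 2 / 2 +
        (b - a) ^ 2 * (1 - a) * (1 - c) ^ 3 / 3) / (c - a)) ≤ ENNReal.ofReal (1 / 576) := by
  calc _ ≤ ∫⁻ a in Set.Icc (0 : ℝ) 1, ∫⁻ c in Set.Icc a 1,
        ENNReal.ofReal ((c - a) ^ 2 * ((1 - a) ^ 3 * (1 - c) / 9 +
          (1 - a) ^ 2 * (1 - c) ^ 2 / 12 + (1 - a) * (1 - c) ^ 3 / 9)) := by
        refine setLIntegral_mono' measurableSet_Icc fun a ha =>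
          setLIntegral_mono' measurableSet_Icc fun c hc => ?_
        rcases hc.1.eq_or_lt with rfl | hac
        · simp
        obtain ⟨D, hD⟩ : ∃ D, D = c - a := ⟨_, rfl⟩
        obtain ⟨k, hk⟩ : ∃ k, k = 1 - a := ⟨_, rfl⟩
        obtain ⟨l, hl⟩ : ∃ l, l = 1 - c := ⟨_, rfl⟩
        have hD0 : 0 < D := by linarith
        have hk0 : 0 ≤ k := by linarith [ha.2]
        have hl0 : 0 ≤ l := by linarith [hc.2]
        rw [← hD, ← hk, ← hl]
        obtain rfl : c = a + D := by linarith
        rw [lintegral_Icc_poly hac.le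
          (((a + D) ^ 2 * (k ^ 3 * l / 3) - (a + D) * a * (k ^ 2 * l ^ 2 / 2) +
            a ^ 2 * (k * l ^ 3 / 3)) / D)
          ((- 2 * (a + D) * (k ^ 3 * l / 3) + (2 * a + D) * (k ^ 2 * l ^ 2 / 2)
            - 2 * a * (k * l ^ 3 / 3)) / D)
          ((k ^ 3 * l / 3 - k ^ 2 * l ^ 2 / 2 + k * l ^ 3 / 3) / D) 0 0 0]
        · apply le_of_eq; congr 1; field_simp; ring
        · intro t; field_simp; ring
        · intro t ht
          have h1 : 0 ≤ a + D - t := by linarith [ht.2]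
          have h2 : 0 ≤ t - a := by linarith [ht.1]
          positivity
    _ = ∫⁻ a in Set.Icc (0 : ℝ) 1, ENNReal.ofReal ((1 - a) ^ 7 / 72) := by
        refine setLIntegral_congr_fun measurableSet_Icc fun a ha => ?_
        obtain ⟨k, hk⟩ : ∃ k, k = 1 - a := ⟨_, rfl⟩
        have hk0 : 0 ≤ k := by linarith [ha.2]
        simp only [← hk]
        obtain rfl : a = 1 - k := by linarith
        rw [lintegral_Icc_ofReal_eq ha.2 (F := fun c =>
          -(k ^ 2 * (k ^ 3 * (1 - c) ^ 2 / 18 + k ^ 2 * (1 - c) ^ 3 / 36 + k * (1 - c) ^ 4 / 36)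
          - 2 * k * (k ^ 3 * (1 - c) ^ 3 / 27 + k ^ 2 * (1 - c) ^ 4 / 48 + k * (1 - c) ^ 5 / 45)
          + (k ^ 3 * (1 - c) ^ 4 / 36 + k ^ 2 * (1 - c) ^ 5 / 60 + k * (1 - c) ^ 6 / 54)))
          (by fun_prop)]
        · congr 1; ring
        · intro t
          have h : HasDerivAt (fun t : ℝ => 1 - t) (-1) t := by
            simpa using (hasDerivAt_id t).const_sub 1
          have hp : ∀ (n : ℕ) (q r : ℝ), HasDerivAt (fun t : ℝ => q * (1 - t) ^ n / r)
              (q * (n * (1 - t) ^ (n - 1) * -1) / r) t := fun n q r =>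
            ((h.pow n).const_mul q).div_const r
          have := (((((hp 2 (k ^ 3) 18).add (hp 3 (k ^ 2) 36)).add (hp 4 k 36)).const_mul
            (k ^ 2)).sub ((((hp 3 (k ^ 3) 27).add (hp 4 (k ^ 2) 48)).add
            (hp 5 k 45)).const_mul (2 * k))).add
            (((hp 4 (k ^ 3) 36).add (hp 5 (k ^ 2) 60)).add (hp 6 k 54)) |>.neg
          refine this.congr_deriv ?_
          push_cast
          ring
        · intro t ht
          have h1 : 0 ≤ 1 - t := by linarith [ht.2]
          positivity
    _ = ENNReal.ofReal (1 / 576) := by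
        rw [lintegral_Icc_ofReal_eq zero_le_one (F := fun a => -((1 - a) ^ 8 / 576))
          (by fun_prop)]
        · norm_num
        · intro t
          have h : HasDerivAt (fun t : ℝ => 1 - t) (-1) t := by
            simpa using (hasDerivAt_id t).const_sub 1
          refine ((h.pow 8).div_const 576).neg.congr_deriv ?_
          push_cast
          ring
        · intro t ht
          have h1 : 0 ≤ 1 - t := by linarith [ht.2]
          positivity

lemma triInt_stdTriangle_le : triInt stdTriangle ≤ ENNReal.ofReal (1 / 96) := by
  let A : Set (Fin 3 → ℝ × ℝ) := {p | (∀ i, p i ∈ stdTriangle) ∧ Monotone fun i => (p i).1}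
  have hA : MeasurableSet A := by
    have h1 : MeasurableSet {p : Fin 3 → ℝ × ℝ | ∀ i, p i ∈ stdTriangle} := by
      have := MeasurableSet.univ_pi fun _ : Fin 3 => measurableSet_stdTriangle
      convert this using 1
      ext p; simp
    have h2 : ∀ i j, MeasurableSet {p : Fin 3 → ℝ × ℝ | i ≤ j → (p i).1 ≤ (p j).1} := by
      intro i j
      by_cases hij : i ≤ j
      · simpa [hij] using measurableSet_le (f := fun p : Fin 3 → ℝ × ℝ => (p i).1)
          (g := fun p => (p j).1) (by fun_prop) (by fun_prop)
      · simp [hij]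
    have : A = {p | ∀ i, p i ∈ stdTriangle} ∩
        ⋂ i, ⋂ j, {p : Fin 3 → ℝ × ℝ | i ≤ j → (p i).1 ≤ (p j).1} := by
      ext p; simp [A, Monotone]
    rw [this]
    exact h1.inter (MeasurableSet.iInter fun i => MeasurableSet.iInter fun j => h2 i j)
  let F : (Fin 3 → ℝ) × (Fin 3 → ℝ) → ℝ≥0∞ := fun z =>
    A.indicator (fun p => ‖triDet p‖ₑ) fun i => (z.1 i, z.2 i)
  have hG : Measurable (A.indicator fun p => ‖triDet p‖ₑ) := measurable_triDet.enorm.indicator hA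
  have hF : Measurable F := hG.comp (by fun_prop)
  have hmp := (volume_measurePreserving_arrowProdEquivProdArrow ℝ ℝ (Fin 3)).symm
  have hFmem : ∀ a b c y₀ y₁ y₂ : ℝ, F (![a, b, c], ![y₀, y₁, y₂]) ≠ 0 →
      (0 ≤ a ∧ a ≤ b ∧ b ≤ c ∧ c ≤ 1) ∧ (0 ≤ y₀ ∧ y₀ ≤ 1 - a) ∧ (0 ≤ y₁ ∧ y₁ ≤ 1 - b) ∧
        (0 ≤ y₂ ∧ y₂ ≤ 1 - c) := by
    intro a b c y₀ y₁ y₂ h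
    have hm := Set.mem_of_indicator_ne_zero h
    have h0 := hm.1 0
    have h1 := hm.1 1
    have h2 := hm.1 2
    have h3 := hm.2 (show (0 : Fin 3) ≤ 1 by decide)
    have h4 := hm.2 (show (1 : Fin 3) ≤ 2 by decide)
    simp [stdTriangle] at h0 h1 h2 h3 h4
    refine ⟨⟨?_, ?_, ?_, ?_⟩, ⟨?_, ?_⟩, ⟨?_, ?_⟩, ?_, ?_⟩ <;> linarith
  have hFle : ∀ x y, F (x, y) ≤ ‖triLin x y‖ₑ := fun x y => Set.indicator_le_self _ _ _
  have hkey : ∫⁻ p in A, ‖triDet p‖ₑ ≤ ENNReal.ofReal (1 / 576) := by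
    refine le_trans ?_ lintegral_sorted_chords_le
    rw [← lintegral_indicator hA, ← hmp.lintegral_comp hG, Measure.volume_eq_prod]
    change ∫⁻ z, F z ∂_ ≤ _
    rw [lintegral_prod _ hF.aemeasurable, lintegral_fin_three hF.lintegral_prod_right']
    have hy : ∀ a b c, ∫⁻ y, F (![a, b, c], y) =
        ∫⁻ y₀, ∫⁻ y₂, ∫⁻ y₁, F (![a, b, c], ![y₀, y₁, y₂]) := fun a b c =>
      lintegral_fin_three (hF.comp measurable_prodMk_left)
    simp only [hy]
    have hz : ∀ a b c, ¬ (0 ≤ a ∧ a ≤ b ∧ b ≤ c ∧ c ≤ 1) →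
        ∫⁻ y₀, ∫⁻ y₂, ∫⁻ y₁, F (![a, b, c], ![y₀, y₁, y₂]) = 0 := by
      intro a b c h
      have : ∀ y₀ y₁ y₂, F (![a, b, c], ![y₀, y₁, y₂]) = 0 := fun y₀ y₁ y₂ =>
        not_not.1 fun h' => h (hFmem _ _ _ _ _ _ h').1
      simp [this]
    refine lintegral_le_setLIntegral measurableSet_Icc (fun a ha => ?_) fun a ha =>
      lintegral_le_setLIntegral measurableSet_Icc (fun c hc => ?_) fun c hc => ?_
    · simp [fun b c => hz a b c fun h => ha ⟨h.1, by linarith [h.2.1, h.2.2.1, h.2.2.2]⟩]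
    · simp [fun b => hz a b c fun h => hc ⟨by linarith [h.2.1, h.2.2.1], h.2.2.2⟩]
    rcases hc.1.eq_or_lt with rfl | hac
    · refine (lintegral_le_setLIntegral (g := fun _ => ⊤) (measurableSet_singleton a)
        (fun b hb => ?_) fun _ _ => le_top).trans (by simp)
      exact hz _ _ _ fun h => hb (le_antisymm h.2.2.1 h.2.1)
    refine lintegral_le_setLIntegral measurableSet_Icc (fun b hb => ?_) fun b hb => ?_
    · exact hz _ _ _ fun h => hb ⟨h.2.1, h.2.2.1⟩
    refine le_trans ?_ (lintegral_triLin_chords_le hb.1 hb.2 hac hc.2)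
    have hz' : ∀ y₀ y₁ y₂, ¬ ((0 ≤ y₀ ∧ y₀ ≤ 1 - a) ∧ (0 ≤ y₁ ∧ y₁ ≤ 1 - b) ∧
        (0 ≤ y₂ ∧ y₂ ≤ 1 - c)) → F (![a, b, c], ![y₀, y₁, y₂]) = 0 := fun y₀ y₁ y₂ h =>
      not_not.1 fun h' => h (hFmem _ _ _ _ _ _ h').2
    refine lintegral_le_setLIntegral measurableSet_Icc (fun y₀ h₀ => ?_) fun y₀ h₀ =>
      lintegral_le_setLIntegral measurableSet_Icc (fun y₂ h₂ => ?_) fun y₂ h₂ =>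
      lintegral_le_setLIntegral measurableSet_Icc (fun y₁ h₁ => ?_) fun y₁ h₁ => hFle _ _
    · simp [fun y₁ y₂ => hz' y₀ y₁ y₂ fun h => h₀ h.1]
    · simp [fun y₁ => hz' y₀ y₁ y₂ fun h => h₂ h.2.2]
    · exact hz' _ _ _ fun h => h₁ h.2.1
  calc triInt stdTriangle ≤ 6 * ∫⁻ p in A, ‖triDet p‖ₑ :=
        triInt_le_six_mul measurableSet_stdTriangle
    _ ≤ 6 * ENNReal.ofReal (1 / 576) := by gcongr
    _ = ENNReal.ofReal (1 / 96) := by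
        rw [show (6 : ℝ≥0∞) = ENNReal.ofReal 6 by norm_num, ← ENNReal.ofReal_mul (by norm_num)]
        norm_num

lemma volume_stdTriangle : volume stdTriangle = ENNReal.ofReal (1 / 2) := by
  rw [Measure.volume_eq_prod, Measure.prod_apply measurableSet_stdTriangle]
  have h : ∀ x : ℝ, volume (Prod.mk x ⁻¹' stdTriangle) =
      (Set.Icc (0 : ℝ) 1).indicator (fun x => ENNReal.ofReal (1 - x)) x := by
    intro x
    by_cases hx : x ∈ Set.Icc (0 : ℝ) 1
    · have : Prod.mk x ⁻¹' stdTriangle = Set.Icc 0 (1 - x) := by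
        ext y
        simp only [stdTriangle, Set.mem_preimage, Set.mem_ofPred_eq, Set.mem_Icc]
        constructor
        · rintro ⟨-, h2, h3⟩; exact ⟨h2, by linarith⟩
        · rintro ⟨h2, h3⟩; exact ⟨hx.1, h2, by linarith⟩
      rw [Set.indicator_of_mem hx, this, Real.volume_Icc, sub_zero]
    · have : Prod.mk x ⁻¹' stdTriangle = ∅ := by
        ext y
        simp only [stdTriangle, Set.mem_preimage, Set.mem_ofPred_eq, Set.mem_empty_iff_false,
          iff_false]
        rintro ⟨h1, h2, h3⟩
        exact hx ⟨h1, by linarith⟩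
      rw [Set.indicator_of_notMem hx, this, measure_empty]
  rw [lintegral_congr h, lintegral_indicator measurableSet_Icc,
    lintegral_Icc_poly zero_le_one 1 (-1) 0 0 0 0 (fun t => by ring)
      fun t ht => by linarith [ht.2]]
  norm_num

/-- Compact convex sets in which the standard triangle is inscribed with maximal area. -/
structure TriangleNormalized (E : Set (ℝ × ℝ)) : Prop where
  isCompact : IsCompact E
  convex : Convex ℝ E
  subset : stdTriangle ⊆ E
  abs_triDet_le : ∀ p : Fin 3 → ℝ × ℝ, (∀ i, p i ∈ E) → |triDet p| ≤ 1

lemma triInt_lt_top {D : Set (ℝ × ℝ)} (hc : IsCompact D) : triInt D < ⊤ := by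
  have h : IsCompact (Set.univ.pi fun _ : Fin 3 => D) := isCompact_univ_pi fun _ => hc
  have := (continuous_triDet.continuousOn.integrableOn_compact (μ := volume) h)
  exact this.hasFiniteIntegral

lemma exists_triangleNormalized {E : Set (ℝ × ℝ)} (hc : IsCompact E) (hconv : Convex ℝ E)
    {p : Fin 3 → ℝ × ℝ} (hp : ∀ i, p i ∈ E) {t : ℝ} (ht : 0 < t) (htp : t ≤ |triDet p|) :
    ∃ E', TriangleNormalized E' ∧ ENNReal.ofReal t * volume E' ≤ volume E ∧
      triInt E * volume E' ^ 4 = triInt E' * volume E ^ 4 := by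
  have hcp : IsCompact (Set.univ.pi fun _ : Fin 3 => E) := isCompact_univ_pi fun _ => hc
  obtain ⟨q, hq, hmax⟩ := hcp.exists_isMaxOn ⟨p, fun i _ => hp i⟩
    (continuous_triDet.abs.continuousOn)
  have hqt : t ≤ |triDet q| := htp.trans (hmax fun i _ => hp i)
  have hq0 : triDet q ≠ 0 := abs_pos.1 (ht.trans_le hqt)
  obtain ⟨a, ha⟩ : ∃ a, a = (q 1).1 - (q 0).1 := ⟨_, rfl⟩
  obtain ⟨b, hb⟩ : ∃ b, b = (q 2).1 - (q 0).1 := ⟨_, rfl⟩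
  obtain ⟨c, hc'⟩ : ∃ c, c = (q 1).2 - (q 0).2 := ⟨_, rfl⟩
  obtain ⟨d, hd⟩ : ∃ d, d = (q 2).2 - (q 0).2 := ⟨_, rfl⟩
  have hdet : triDet q = a * d - b * c := by rw [triDet, ← ha, ← hb, ← hc', ← hd]
  have hne : a * d - b * c ≠ 0 := hdet ▸ hq0
  refine ⟨planarAff a b c d (q 0) ⁻¹' E, ⟨isCompact_preimage_planarAff hne _ hc,
    convex_preimage_planarAff _ _ _ _ _ hconv, ?_, ?_⟩, ?_, ?_⟩
  · rintro ⟨x, y⟩ ⟨hx, hy, hxy⟩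
    simp only at hx hy hxy
    have h3 := hconv.sum_mem (t := Finset.univ) (w := ![1 - x - y, x, y]) (z := q) (by
      intro i _; fin_cases i <;> simp <;> linarith) (by simp [Fin.sum_univ_three]; ring)
      fun i _ => hq i trivial
    rw [Set.mem_preimage]
    convert h3 using 1
    ext
    · simp [planarAff, Fin.sum_univ_three, ha, hb]; ring
    · simp [planarAff, Fin.sum_univ_three, hc', hd]; ring
  · intro r hr
    have h1 : |triDet fun i => planarAff a b c d (q 0) (r i)| ≤ |triDet q| :=
      hmax fun i _ => hr i
    rw [triDet_planarAff, abs_mul, ← hdet] at h1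
    have := abs_pos.2 hq0
    nlinarith
  · rw [volume_preimage_planarAff hne (q 0) E, ← hdet, Real.enorm_eq_ofReal_abs]
    gcongr
  · conv_lhs => rw [triInt_preimage_planarAff hne (q 0) hc.measurableSet]
    conv_rhs => rw [volume_preimage_planarAff hne (q 0) E]
    ring

lemma TriangleNormalized.preimage {E : Set (ℝ × ℝ)} (hE : TriangleNormalized E)
    {a b c d : ℝ} {v : ℝ × ℝ} (h : |a * d - b * c| = 1)
    (hS : ∀ p ∈ stdTriangle, planarAff a b c d v p ∈ stdTriangle) :
    TriangleNormalized (planarAff a b c d v ⁻¹' E) ∧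
      volume (planarAff a b c d v ⁻¹' E) = volume E ∧
      triInt (planarAff a b c d v ⁻¹' E) = triInt E ∧
      ∀ A, volume (planarAff a b c d v ⁻¹' A) = volume A := by
  have hne : a * d - b * c ≠ 0 := by intro h0; simp [h0] at h
  have hen : ‖a * d - b * c‖ₑ = 1 := by rw [Real.enorm_eq_ofReal_abs, h]; simp
  have hv : ∀ A, volume (planarAff a b c d v ⁻¹' A) = volume A := fun A => by
    rw [volume_preimage_planarAff hne v A, hen, one_mul]
  refine ⟨⟨isCompact_preimage_planarAff hne _ hE.isCompact,
    convex_preimage_planarAff _ _ _ _ _ hE.convex, fun p hp => hE.subset (hS p hp), ?_⟩,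
    hv E, ?_, hv⟩
  · intro p hp
    have := hE.abs_triDet_le _ hp
    rwa [triDet_planarAff, abs_mul, h, one_mul] at this
  · rw [triInt_preimage_planarAff hne v hE.isCompact.measurableSet, hen, one_pow, one_mul]

lemma TriangleNormalized.exists_cap {E : Set (ℝ × ℝ)} (hE : TriangleNormalized E)
    {η : ℝ≥0∞} (h : ENNReal.ofReal (1 / 2) + 3 * η < volume E) :
    ∃ E', TriangleNormalized E' ∧ volume E' = volume E ∧ triInt E' = triInt E ∧
      η < volume (E' ∩ {p | p.1 < 0}) := by
  have hsub : E ⊆ stdTriangle ∪ ((E ∩ {p | p.1 < 0}) ∪ (E ∩ {p | p.2 < 0}) ∪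
      (E ∩ {p | 1 < p.1 + p.2})) := by
    intro p hp
    by_cases hS : p ∈ stdTriangle
    · exact Or.inl hS
    · simp only [stdTriangle, Set.mem_ofPred_eq, not_and_or, not_le] at hS
      rcases hS with h | h | h
      · exact Or.inr (Or.inl (Or.inl ⟨hp, h⟩))
      · exact Or.inr (Or.inl (Or.inr ⟨hp, h⟩))
      · exact Or.inr (Or.inr ⟨hp, h⟩)
  by_cases h1 : η < volume (E ∩ {p | p.1 < 0})
  · exact ⟨E, hE, rfl, rfl, h1⟩
  by_cases h2 : η < volume (E ∩ {p | p.2 < 0})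
  · obtain ⟨hn, hv, ht, hA⟩ := hE.preimage (a := 0) (b := 1) (c := 1) (d := 0) (v := 0)
      (by norm_num) (by
        rintro ⟨x, y⟩ ⟨h1, h2, h3⟩
        simp only at h1 h2 h3
        refine ⟨?_, ?_, ?_⟩ <;> simp [planarAff] <;> linarith)
    refine ⟨_, hn, hv, ht, ?_⟩
    rw [← hA] at h2
    convert h2 using 2
    ext p; simp [planarAff]
  by_cases h3 : η < volume (E ∩ {p | 1 < p.1 + p.2})
  · obtain ⟨hn, hv, ht, hA⟩ := hE.preimage (a := -1) (b := -1) (c := 0) (d := 1) (v := (1, 0))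
      (by norm_num) (by
        rintro ⟨x, y⟩ ⟨h1, h2, h3⟩
        simp only at h1 h2 h3
        refine ⟨?_, ?_, ?_⟩ <;> simp [planarAff] <;> linarith)
    refine ⟨_, hn, hv, ht, ?_⟩
    rw [← hA] at h3
    convert h3 using 2
    ext p
    simp only [Set.mem_inter_iff, Set.mem_preimage, Set.mem_ofPred_eq, planarAff, and_congr_right_iff]
    intro _
    constructor <;> intro h <;> linarith
  · refine absurd h (not_lt.2 ((measure_mono hsub).trans ((measure_union_le _ _).trans ?_)))
    rw [volume_stdTriangle]
    gcongr
    refine (measure_union_le _ _).trans ?_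
    calc _ ≤ (η + η) + η := add_le_add ((measure_union_le _ _).trans
            (add_le_add (not_lt.1 h1) (not_lt.1 h2))) (not_lt.1 h3)
      _ = 3 * η := by ring

lemma TriangleNormalized.exists_fst_lt {E : Set (ℝ × ℝ)} (hE : TriangleNormalized E)
    {η : ℝ} (h : ENNReal.ofReal η < volume (E ∩ {p | p.1 < 0})) : ∃ p ∈ E, p.1 < -η := by
  by_contra! hcon
  refine absurd h (not_lt.2 ?_)
  obtain ⟨m, r, hmr⟩ := exists_sections hE.isCompact hE.convex
  have hD : ∀ x y, (x, y) ∈ E ↔ m x - r x ≤ y ∧ y ≤ m x + r x := fun x y => by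
    rw [← Set.mem_Icc, ← hmr]; rfl
  have hms : MeasurableSet (E ∩ {p : ℝ × ℝ | p.1 < 0}) :=
    hE.isCompact.measurableSet.inter (measurableSet_lt (by fun_prop) (by fun_prop))
  rw [Measure.volume_eq_prod, Measure.prod_apply hms]
  calc ∫⁻ x, volume (Prod.mk x ⁻¹' (E ∩ {p | p.1 < 0}))
      ≤ ∫⁻ x in Set.Icc (-η) 0, 1 := by
        refine lintegral_le_setLIntegral measurableSet_Icc (fun x hx => ?_) fun x hx => ?_
        · have : Prod.mk x ⁻¹' (E ∩ {p | p.1 < 0}) = ∅ := by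
            ext y
            simp only [Set.mem_preimage, Set.mem_inter_iff, Set.mem_ofPred_eq,
              Set.mem_empty_iff_false, iff_false]
            rintro ⟨h1, h2⟩
            exact hx ⟨hcon _ h1, h2.le⟩
          rw [this, measure_empty]
        · refine (measure_mono (fun y hy => hy.1 : _ ⊆ Prod.mk x ⁻¹' E)).trans ?_
          rw [hmr, Real.volume_Icc, ENNReal.ofReal_le_one]
          by_contra! hlt
          have hr : 0 < r x := by linarith
          have hp := hE.abs_triDet_le ![(1, 0), (x, m x - r x), (x, m x + r x)] (by
            intro i; fin_cases i
            · exact hE.subset ⟨by norm_num, by norm_num, by norm_num⟩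
            · exact (hD _ _).2 ⟨le_rfl, by linarith⟩
            · exact (hD _ _).2 ⟨by linarith, le_rfl⟩)
          have := (abs_le.1 hp).1
          simp [triDet] at this
          nlinarith [hx.2]
    _ ≤ ENNReal.ofReal η := by simp

lemma TriangleNormalized.exists_smaller {E : Set (ℝ × ℝ)} (hE : TriangleNormalized E)
    {η : ℝ} (hη : 0 < η) (h : ENNReal.ofReal (1 / 2) + 3 * ENNReal.ofReal η < volume E) :
    ∃ E', TriangleNormalized E' ∧ ENNReal.ofReal (1 + η) * volume E' ≤ volume E ∧
      triInt E * volume E' ^ 4 ≤ triInt E' * volume E ^ 4 := by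
  obtain ⟨E₁, hE₁, hv₁, ht₁, hcap⟩ := hE.exists_cap h
  obtain ⟨⟨x, y⟩, hp, hx⟩ := hE₁.exists_fst_lt hcap
  simp only at hx
  obtain ⟨m, r, hmr⟩ := exists_sections hE₁.isCompact hE₁.convex
  have hD : ∀ x y, (x, y) ∈ E₁ ↔ m x - r x ≤ y ∧ y ≤ m x + r x := fun x y => by
    rw [← Set.mem_Icc, ← hmr]; rfl
  have hD' : ∀ x y, (x, y) ∈ shake E₁ ↔ r x - r x ≤ y ∧ y ≤ r x + r x := fun x y => by
    rw [← Set.mem_Icc, ← section_shake hmr]; rfl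
  have h1 := (hD _ _).1 (hE₁.subset (show ((0 : ℝ), (0 : ℝ)) ∈ stdTriangle by
    simp [stdTriangle]))
  have h2 := (hD _ _).1 (hE₁.subset (show ((0 : ℝ), (1 : ℝ)) ∈ stdTriangle by
    simp [stdTriangle]))
  have h3 := (hD _ _).1 (hE₁.subset (show ((1 : ℝ), (0 : ℝ)) ∈ stdTriangle by
    simp [stdTriangle]))
  have h4 := (hD _ _).1 hp
  obtain ⟨E₂, hE₂, hv₂, ht₂⟩ := exists_triangleNormalized (isCompact_shake hE₁.isCompact)
    (convex_shake hE₁.convex) (p := ![(x, 0), (1, 0), (0, 1)]) (t := 1 + η) (by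
      intro i; fin_cases i
      · exact (hD' _ _).2 ⟨by linarith, by linarith⟩
      · exact (hD' _ _).2 ⟨by linarith, by linarith⟩
      · exact (hD' _ _).2 ⟨by linarith, by linarith⟩) (by linarith) (by
      refine le_trans ?_ (le_abs_self _)
      simp [triDet]; linarith)
  rw [volume_shake hE₁.isCompact hE₁.convex, hv₁] at hv₂ ht₂
  refine ⟨E₂, hE₂, hv₂, ?_⟩
  rw [← ht₂, ← ht₁]
  gcongr
  exact triInt_le_shake hE₁.isCompact hE₁.convex

lemma TriangleNormalized.triInt_le {E : Set (ℝ × ℝ)} (hE : TriangleNormalized E) :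
    triInt E ≤ ENNReal.ofReal (1 / 96) + (volume E ^ 3 - ENNReal.ofReal (1 / 8)) := by
  let P : Set (ℝ × ℝ) → Set (Fin 3 → ℝ × ℝ) := fun D => Set.univ.pi fun _ => D
  have hsub : P stdTriangle ⊆ P E := Set.pi_mono fun _ _ => hE.subset
  have hPE : MeasurableSet (P E) := MeasurableSet.univ_pi fun _ => hE.isCompact.measurableSet
  have hPS : MeasurableSet (P stdTriangle) :=
    MeasurableSet.univ_pi fun _ => measurableSet_stdTriangle
  have hvol : ∀ D, volume (P D) = volume D ^ 3 := fun D => by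
    simp [P, volume_pi, Measure.pi_pi]
  calc triInt E = ∫⁻ p in P stdTriangle ∪ (P E \ P stdTriangle), ‖triDet p‖ₑ := by
        rw [Set.union_sdiff_cancel hsub]; rfl
    _ ≤ triInt stdTriangle + ∫⁻ p in P E \ P stdTriangle, ‖triDet p‖ₑ :=
        lintegral_union_le _ _ _
    _ ≤ ENNReal.ofReal (1 / 96) + ∫⁻ p in P E \ P stdTriangle, 1 := by
        refine add_le_add triInt_stdTriangle_le
          (setLIntegral_mono' (hPE.diff hPS) fun p hp => ?_)
        rw [Real.enorm_eq_ofReal_abs, ENNReal.ofReal_le_one]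
        exact hE.abs_triDet_le p fun i => hp.1 i trivial
    _ = _ := by
        rw [setLIntegral_one, measure_sdiff hsub hPS.nullMeasurableSet, hvol, hvol,
          volume_stdTriangle, ← ENNReal.ofReal_pow (by norm_num)]
        · norm_num
        · rw [hvol, volume_stdTriangle]; exact ENNReal.pow_ne_top ENNReal.ofReal_ne_top

/-- Among compact convex planar sets of given area, triangles maximize the expected area of a
random triangle. -/
theorem six_mul_triInt_le {D : Set (ℝ × ℝ)} (hc : IsCompact D) (hconv : Convex ℝ D) :
    6 * triInt D ≤ volume D ^ 4 := by
  by_cases h0 : ∀ p : Fin 3 → ℝ × ℝ, (∀ i, p i ∈ D) → triDet p = 0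
  · have : triInt D = 0 := by
      rw [triInt, setLIntegral_congr_fun (g := fun _ => 0)
        (MeasurableSet.univ_pi fun _ => hc.measurableSet)]
      · simp
      · intro p hp
        simp [h0 p fun i => hp i trivial]
    simp [this]
  push Not at h0
  obtain ⟨p, hp, hp0⟩ := h0
  obtain ⟨E₀, hE₀, -, ht₀⟩ := exists_triangleNormalized hc hconv hp (abs_pos.2 hp0) le_rfl
  have hfin : ∀ {E}, TriangleNormalized E → volume E ≠ ⊤ :=
    fun hE => hE.isCompact.measure_lt_top.ne
  have hhalf : ∀ {E}, TriangleNormalized E → 1 / 2 ≤ (volume E).toReal := fun hE => by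
    have := measure_mono (μ := volume) hE.subset
    rw [volume_stdTriangle] at this
    exact (ENNReal.ofReal_le_iff_le_toReal (hfin hE)).1 this
  let Q : Set ℝ := {q | ∃ E, TriangleNormalized E ∧ (volume E).toReal = q ∧
    triInt D * volume E ^ 4 ≤ triInt E * volume D ^ 4}
  have hQne : Q.Nonempty := ⟨_, E₀, hE₀, rfl, ht₀.le⟩
  have hQbdd : BddBelow Q := ⟨1 / 2, by rintro _ ⟨E, hE, rfl, -⟩; exact hhalf hE⟩
  have hinf : sInf Q ≤ 1 / 2 := by
    by_contra! hlt
    set η := (sInf Q - 1 / 2) / 6 with hη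
    have hη0 : 0 < η := by rw [hη]; linarith
    obtain ⟨q, hq, hqlt⟩ := exists_lt_of_csInf_lt hQne
      (show sInf Q < sInf Q * (1 + η) by nlinarith)
    have hqge := csInf_le hQbdd hq
    obtain ⟨E, hE, rfl, hED⟩ := hq
    obtain ⟨E', hE', hv, ht⟩ := hE.exists_smaller hη0 (by
      rw [← ENNReal.ofReal_toReal (hfin hE), show (3 : ℝ≥0∞) = ENNReal.ofReal 3 by norm_num,
        ← ENNReal.ofReal_mul (by norm_num), ← ENNReal.ofReal_add (by norm_num) (by positivity)]
      refine (ENNReal.ofReal_lt_ofReal_iff (by linarith)).2 (by linarith))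
    have hE'Q : (volume E').toReal ∈ Q := by
      refine ⟨E', hE', rfl, ?_⟩
      have hv0 : volume E ^ 4 ≠ 0 := by
        refine pow_ne_zero _ fun h => ?_
        have := hhalf hE
        rw [h] at this
        norm_num at this
      refine (ENNReal.mul_le_mul_iff_left hv0 (ENNReal.pow_ne_top (hfin hE))).1 ?_
      calc triInt D * volume E' ^ 4 * volume E ^ 4
          = triInt D * volume E ^ 4 * volume E' ^ 4 := by ring
        _ ≤ triInt E * volume D ^ 4 * volume E' ^ 4 := by gcongr
        _ = triInt E * volume E' ^ 4 * volume D ^ 4 := by ring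
        _ ≤ triInt E' * volume E ^ 4 * volume D ^ 4 := by gcongr
        _ = triInt E' * volume D ^ 4 * volume E ^ 4 := by ring
    have h1 := csInf_le hQbdd hE'Q
    have h2 := ENNReal.toReal_mono (hfin hE) hv
    rw [ENNReal.toReal_mul, ENNReal.toReal_ofReal (by linarith)] at h2
    nlinarith
  set T := (triInt D).toReal
  set v := (volume D).toReal
  have hineq : ∀ q ∈ Q, T * q ^ 4 ≤ (1 / 96 + (q ^ 3 - 1 / 8)) * v ^ 4 := by
    rintro _ ⟨E, hE, rfl, hED⟩
    have hh := hhalf hE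
    have h8 : 1 / 8 ≤ (volume E).toReal ^ 3 := by
      calc (1 / 8 : ℝ) = (1 / 2) ^ 3 := by norm_num
        _ ≤ _ := by gcongr
    have h1 : triInt D * volume E ^ 4 ≤ ENNReal.ofReal (1 / 96 + ((volume E).toReal ^ 3 - 1 / 8)) *
        volume D ^ 4 := by
      refine hED.trans ?_
      gcongr
      refine hE.triInt_le.trans (le_of_eq ?_)
      rw [ENNReal.ofReal_add (by norm_num) (by linarith), ENNReal.ofReal_sub _ (by norm_num),
        ENNReal.ofReal_pow ENNReal.toReal_nonneg, ENNReal.ofReal_toReal (hfin hE)]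
    have h2 := ENNReal.toReal_mono (ENNReal.mul_ne_top ENNReal.ofReal_ne_top
      (ENNReal.pow_ne_top hc.measure_lt_top.ne)) h1
    rwa [ENNReal.toReal_mul, ENNReal.toReal_mul, ENNReal.toReal_ofReal (by linarith),
      ENNReal.toReal_pow, ENNReal.toReal_pow] at h2
  have hlim : T * (1 / 2) ^ 4 ≤ (1 / 96 + ((1 / 2) ^ 3 - 1 / 8)) * v ^ 4 := by
    have hinf' : sInf Q = 1 / 2 := le_antisymm hinf (le_csInf hQne (by
      rintro _ ⟨E, hE, rfl, -⟩; exact hhalf hE))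
    have hcl : (1 / 2 : ℝ) ∈ closure Q := hinf' ▸ csInf_mem_closure hQne hQbdd
    have hset : IsClosed {q : ℝ | T * q ^ 4 ≤ (1 / 96 + (q ^ 3 - 1 / 8)) * v ^ 4} :=
      isClosed_le (by fun_prop) (by fun_prop)
    exact closure_minimal (fun q hq => hineq q hq) hset hcl
  rw [← ENNReal.ofReal_toReal (triInt_lt_top hc).ne,
    ← ENNReal.ofReal_toReal hc.measure_lt_top.ne, ← ENNReal.ofReal_pow ENNReal.toReal_nonneg,
    show (6 : ℝ≥0∞) = ENNReal.ofReal 6 by norm_num, ← ENNReal.ofReal_mul (by norm_num)]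
  refine ENNReal.ofReal_le_ofReal ?_
  change 6 * T ≤ v ^ 4
  linarith

lemma ae_triDet_ne_zero : ∀ᵐ p : Fin 3 → ℝ × ℝ, triDet p ≠ 0 := by
  have hmp := volume_measurePreserving_arrowProdEquivProdArrow ℝ ℝ (Fin 3)
  have hms : MeasurableSet {z : (Fin 3 → ℝ) × (Fin 3 → ℝ) | triLin z.1 z.2 ≠ 0} :=
    (isOpen_ne_fun continuous_triLin continuous_const).measurableSet
  have h1 : ∀ᵐ z : (Fin 3 → ℝ) × (Fin 3 → ℝ), triLin z.1 z.2 ≠ 0 := by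
    rw [Measure.volume_eq_prod, Measure.ae_prod_iff_ae_ae hms]
    have hne : ∀ᵐ x : Fin 3 → ℝ, x 1 - x 0 ≠ 0 := by
      let f : (Fin 3 → ℝ) →ₗ[ℝ] ℝ := (LinearMap.proj 1 : (Fin 3 → ℝ) →ₗ[ℝ] ℝ) - LinearMap.proj 0
      have := Measure.addHaar_submodule (volume : Measure (Fin 3 → ℝ)) (LinearMap.ker f) (by
        intro h
        have : Pi.single 1 1 ∈ LinearMap.ker f := h ▸ Submodule.mem_top
        simp [f] at this)
      rw [ae_iff]
      convert this using 2
      ext x; simp [f]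
    filter_upwards [hne] with x hx
    let f : (Fin 3 → ℝ) →ₗ[ℝ] ℝ :=
      { toFun := triLin x
        map_add' := triLin_add x
        map_smul' := fun c y => by simp [triLin_eq]; ring }
    have := Measure.addHaar_submodule (volume : Measure (Fin 3 → ℝ)) (LinearMap.ker f) (by
      intro h
      have : Pi.single 2 1 ∈ LinearMap.ker f := h ▸ Submodule.mem_top
      simp [f, triLin_eq] at this
      exact hx this)
    rw [ae_iff]
    convert this using 2
    ext y; simp [f]
  exact hmp.quasiMeasurePreserving.ae h1

lemma lintegral_eq_enorm_triDet_mul {p : Fin 3 → ℝ × ℝ} (hp : triDet p ≠ 0)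
    {G : (Fin 3 → ℝ) → ℝ≥0∞} (hG : Measurable G) :
    ∫⁻ z, G z = ‖triDet p‖ₑ *
      ∫⁻ h : Fin 3 → ℝ, G fun i => h 0 * (p i).1 + h 1 * (p i).2 + h 2 := by
  let M : Matrix (Fin 3) (Fin 3) ℝ := Matrix.of fun i => ![(p i).1, (p i).2, 1]
  have hM : M.det = triDet p := by
    simp [M, triDet, Matrix.det_fin_three]; ring
  have hmap := Real.map_matrix_volume_pi_eq_smul_volume_pi (M := M) (hM ▸ hp)
  have hmeas : Measurable (Matrix.toLin' M) := (LinearMap.continuous_of_finiteDimensional _).measurable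
  have h1 : ∫⁻ h : Fin 3 → ℝ, G (Matrix.toLin' M h) = ENNReal.ofReal |M.det⁻¹| * ∫⁻ z, G z := by
    rw [← lintegral_map hG hmeas, hmap, lintegral_smul_measure, smul_eq_mul]
  have h2 : ∀ h : Fin 3 → ℝ, Matrix.toLin' M h =
      fun i => h 0 * (p i).1 + h 1 * (p i).2 + h 2 := by
    intro h; ext i
    simp [M, Matrix.mulVec, dotProduct, Fin.sum_univ_three]; ring
  simp only [h2] at h1
  rw [h1, hM, Real.enorm_eq_ofReal_abs, ← mul_assoc, ← ENNReal.ofReal_mul (abs_nonneg _),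
    ← abs_mul, mul_inv_cancel₀ hp]
  simp

/-- The affine Blaschke–Petkantschin formula for triples of points in space, the plane through
the triple being parametrized as the graph of `(x, y) ↦ h 0 * x + h 1 * y + h 2`. -/
lemma lintegral_triple_eq {g : (Fin 3 → (ℝ × ℝ) × ℝ) → ℝ≥0∞} (hg : Measurable g) :
    ∫⁻ x, g x = ∫⁻ h : Fin 3 → ℝ, ∫⁻ p : Fin 3 → ℝ × ℝ,
      ‖triDet p‖ₑ * g fun i => (p i, h 0 * (p i).1 + h 1 * (p i).2 + h 2) := by
  have hmp := (volume_measurePreserving_arrowProdEquivProdArrow (ℝ × ℝ) ℝ (Fin 3)).symm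
  have hG : Measurable fun z : (Fin 3 → ℝ × ℝ) × (Fin 3 → ℝ) => g fun i => (z.1 i, z.2 i) :=
    hg.comp (by fun_prop)
  have hF : Measurable fun z : (Fin 3 → ℝ × ℝ) × (Fin 3 → ℝ) => ‖triDet z.1‖ₑ *
      g fun i => (z.1 i, z.2 0 * (z.1 i).1 + z.2 1 * (z.1 i).2 + z.2 2) :=
    (measurable_triDet.comp measurable_fst).enorm.mul (hg.comp (by fun_prop))
  rw [← lintegral_lintegral_swap (f := fun (p : Fin 3 → ℝ × ℝ) (h : Fin 3 → ℝ) => ‖triDet p‖ₑ *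
      g fun i => (p i, h 0 * (p i).1 + h 1 * (p i).2 + h 2)) hF.aemeasurable,
    ← hmp.lintegral_comp hg, Measure.volume_eq_prod]
  change ∫⁻ z : (Fin 3 → ℝ × ℝ) × (Fin 3 → ℝ), g (fun i => (z.1 i, z.2 i)) ∂_ = _
  rw [lintegral_prod _ hG.aemeasurable]
  refine lintegral_congr_ae ?_
  filter_upwards [ae_triDet_ne_zero] with p hp
  have hg' : Measurable fun h : Fin 3 → ℝ =>
      g fun i => (p i, h 0 * (p i).1 + h 1 * (p i).2 + h 2) := hg.comp (by fun_prop)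
  rw [lintegral_const_mul _ hg']
  exact lintegral_eq_enorm_triDet_mul hp (hG.comp measurable_prodMk_left)

/-- The closed Euclidean disc of radius `ρ` around the origin. -/
def disc (ρ : ℝ) : Set (ℝ × ℝ) := {p | p.1 ^ 2 + p.2 ^ 2 ≤ ρ ^ 2}

lemma isClosed_disc (ρ : ℝ) : IsClosed (disc ρ) :=
  isClosed_le (by fun_prop) (by fun_prop)

lemma isCompact_disc (ρ : ℝ) : IsCompact (disc ρ) := by
  refine (isCompact_Icc (a := ((-|ρ|, -|ρ|) : ℝ × ℝ)) (b := (|ρ|, |ρ|))).of_isClosed_subset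
    (isClosed_disc ρ) ?_
  rintro ⟨x, y⟩ h
  simp only [disc, Set.mem_ofPred_eq] at h
  have h1 := abs_le.1 (sq_le_sq.1 (show x ^ 2 ≤ ρ ^ 2 by nlinarith [sq_nonneg y]))
  have h2 := abs_le.1 (sq_le_sq.1 (show y ^ 2 ≤ ρ ^ 2 by nlinarith [sq_nonneg x]))
  exact ⟨⟨h1.1, h2.1⟩, ⟨h1.2, h2.2⟩⟩

lemma exists_sections_disc (ρ : ℝ) :
    ∃ s : ℝ → ℝ, ∀ x, Prod.mk x ⁻¹' disc ρ = Set.Icc (-s x) (s x) := by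
  refine ⟨fun x => if 0 ≤ ρ ^ 2 - x ^ 2 then √(ρ ^ 2 - x ^ 2) else -1, fun x => ?_⟩
  ext y
  simp only [disc, Set.mem_preimage, Set.mem_ofPred_eq, Set.mem_Icc]
  split_ifs with h
  · rw [← abs_le, Real.le_sqrt (abs_nonneg y) h, sq_abs]
    constructor <;> intro h <;> linarith
  · constructor
    · intro h'; nlinarith [sq_nonneg y]
    · rintro ⟨h1, h2⟩; linarith

lemma steiner_subset_disc {D : Set (ℝ × ℝ)} {R : ℝ} (h : D ⊆ disc R) : steiner D ⊆ disc R := by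
  rintro _ ⟨⟨⟨x, y⟩, ⟨x', y'⟩⟩, ⟨⟨h1, h2⟩, h3⟩, rfl⟩
  have h1' := h h1
  have h2' := h h2
  simp only [disc, Set.mem_ofPred_eq] at h1' h2' h3 ⊢
  subst h3
  nlinarith [sq_nonneg (y + y')]

/-- Symmetrizing an interval about `0` decreases its excess over a symmetric interval. -/
lemma volume_sdiff_symm_add_min_le (m r s : ℝ) :
    volume (Set.Icc (0 - r) (0 + r) \ Set.Icc (-s) s) +
      min (volume (Set.Icc (m - r) (m + r) \ Set.Icc (-s) s))
        (volume (Set.Icc (-s) s \ Set.Icc (m - r) (m + r))) ≤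
      volume (Set.Icc (m - r) (m + r) \ Set.Icc (-s) s) := by
  rcases le_total r s with h | h
  · have : Set.Icc (0 - r) (0 + r) \ Set.Icc (-s) s = ∅ :=
      Set.sdiff_eq_empty.2 (Set.Icc_subset_Icc (by linarith) (by linarith))
    rw [this, measure_empty, zero_add]
    exact min_le_left _ _
  · refine (add_le_add_right (min_le_right _ _) _).trans ?_
    have hsub : Set.Icc (-s) s ⊆ Set.Icc (0 - r) (0 + r) :=
      Set.Icc_subset_Icc (by linarith) (by linarith)
    set A := Set.Icc (m - r) (m + r)
    set B := Set.Icc (-s) s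
    have hA : MeasurableSet A := measurableSet_Icc
    have hB : MeasurableSet B := measurableSet_Icc
    have h1 : volume (Set.Icc (0 - r) (0 + r) \ B) + volume B = volume A := by
      rw [← measure_union Set.disjoint_sdiff_left hB, Set.sdiff_union_of_subset hsub]
      simp only [A, Real.volume_Icc]; congr 1; ring
    have h2 : volume (A ∩ B) + volume (A \ B) = volume A := measure_inter_add_sdiff A hB
    have h3 : volume (B ∩ A) + volume (B \ A) = volume B := measure_inter_add_sdiff B hA
    have hfin : volume (A ∩ B) ≠ ⊤ :=
      ((measure_mono Set.inter_subset_left).trans_lt measure_Icc_lt_top).ne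
    rw [← ENNReal.add_le_add_iff_left hfin, h2, ← h1, ← h3, Set.inter_comm B A]
    apply le_of_eq; ring

/-- Product of the lengths of the vertical sections of `F` and `G`, integrated. -/
noncomputable def chordCorr (F G : Set (ℝ × ℝ)) : ℝ≥0∞ :=
  ∫⁻ x, volume (Prod.mk x ⁻¹' F) * volume (Prod.mk x ⁻¹' G)

lemma volume_steiner_sdiff_disc_add_le {E : Set (ℝ × ℝ)} (hc : IsCompact E) (hconv : Convex ℝ E)
    {ρ R : ℝ} (hR : 0 < R) (hρ : ρ ^ 2 ≤ R ^ 2) (hER : E ⊆ disc R) :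
    ENNReal.ofReal (2 * R) * volume (steiner E \ disc ρ) + chordCorr (E \ disc ρ) (disc ρ \ E) ≤
      ENNReal.ofReal (2 * R) * volume (E \ disc ρ) := by
  obtain ⟨m, r, hmr⟩ := exists_sections hc hconv
  obtain ⟨s, hs⟩ := exists_sections_disc ρ
  have hB := (isCompact_disc ρ).measurableSet
  have hE := hc.measurableSet
  have hS := (isCompact_steiner hc).measurableSet
  have hms : ∀ {A : Set (ℝ × ℝ)}, MeasurableSet A → Measurable fun x => volume (Prod.mk x ⁻¹' A) :=
    fun h => measurable_measure_prodMk_left h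
  have hlen : ∀ {A : Set (ℝ × ℝ)}, A ⊆ disc R → ∀ x, volume (Prod.mk x ⁻¹' A) ≤
      ENNReal.ofReal (2 * R) := by
    intro A hA x
    refine (measure_mono (t := Set.Icc (-R) R) fun y hy => ?_).trans ?_
    · have := hA hy
      simp only [disc, Set.mem_ofPred_eq] at this
      exact abs_le.1 (abs_le_of_sq_le_sq (by nlinarith [sq_nonneg x]) hR.le)
    · rw [Real.volume_Icc]; apply le_of_eq; congr 1; ring
  have hBR : disc ρ ⊆ disc R := fun p hp => le_trans hp hρ
  rw [Measure.volume_eq_prod, Measure.prod_apply (hS.diff hB), Measure.prod_apply (hE.diff hB),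
    ← lintegral_const_mul _ (hms (hS.diff hB)), ← lintegral_const_mul _ (hms (hE.diff hB)),
    chordCorr, ← lintegral_add_left ((hms (hS.diff hB)).const_mul _)]
  refine lintegral_mono fun x => ?_
  have key := volume_sdiff_symm_add_min_le (m x) (r x) (s x)
  rw [← hs, ← hmr, ← section_steiner hmr, ← Set.preimage_sdiff, ← Set.preimage_sdiff,
    ← Set.preimage_sdiff] at key
  have h1 := hlen (A := E \ disc ρ) (Set.sdiff_subset.trans hER) x
  have h2 := hlen (A := disc ρ \ E) (Set.sdiff_subset.trans hBR) x
  set α := volume (Prod.mk x ⁻¹' (E \ disc ρ))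
  set β := volume (Prod.mk x ⁻¹' (disc ρ \ E))
  calc _ ≤ ENNReal.ofReal (2 * R) * volume (Prod.mk x ⁻¹' (steiner E \ disc ρ)) +
        ENNReal.ofReal (2 * R) * min α β := by
        refine add_le_add le_rfl ?_
        rcases le_total α β with h | h
        · rw [min_eq_left h, mul_comm]; gcongr
        · rw [min_eq_right h]; gcongr
    _ = ENNReal.ofReal (2 * R) * (volume (Prod.mk x ⁻¹' (steiner E \ disc ρ)) + min α β) := by
        ring
    _ ≤ _ := by gcongr

/-- The rotation taking the vertical direction to the direction `(cos θ, sin θ)`. -/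
noncomputable def rot (θ : ℝ) : ℝ × ℝ → ℝ × ℝ :=
  planarAff (Real.sin θ) (Real.cos θ) (-Real.cos θ) (Real.sin θ) 0

lemma det_rot (θ : ℝ) :
    Real.sin θ * Real.sin θ - Real.cos θ * (-Real.cos θ) = 1 := by
  nlinarith [Real.sin_sq_add_cos_sq θ]

lemma rot_preimage_disc (θ ρ : ℝ) : rot θ ⁻¹' disc ρ = disc ρ := by
  ext ⟨x, y⟩
  have : (Real.sin θ * x + Real.cos θ * y) ^ 2 + (-Real.cos θ * x + Real.sin θ * y) ^ 2 =
      x ^ 2 + y ^ 2 := by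
    calc _ = (Real.sin θ ^ 2 + Real.cos θ ^ 2) * (x ^ 2 + y ^ 2) := by ring
      _ = _ := by rw [Real.sin_sq_add_cos_sq, one_mul]
  simp [disc, rot, planarAff, ← this]

lemma measurePreserving_rot (θ : ℝ) : MeasurePreserving (rot θ) volume volume := by
  have hm : Measurable (rot θ) := (continuous_planarAff _ _ _ _ _).measurable
  refine ⟨hm, Measure.ext fun A hA => ?_⟩
  rw [Measure.map_apply hm hA, volume_preimage_planarAff
    (ne_of_eq_of_ne (det_rot θ) one_ne_zero) 0 A,
    det_rot, enorm_one, one_mul]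
  rfl

lemma chordCorr_rot {F G : Set (ℝ × ℝ)} (hF : MeasurableSet F) (hG : MeasurableSet G) (θ : ℝ) :
    chordCorr (rot θ ⁻¹' F) (rot θ ⁻¹' G) = ∫⁻ p : ℝ × ℝ, ∫⁻ t : ℝ,
      F.indicator 1 p * G.indicator 1 (p.1 + t * Real.cos θ, p.2 + t * Real.sin θ) := by
  have hFm : Measurable (F.indicator (1 : ℝ × ℝ → ℝ≥0∞)) := measurable_one.indicator hF
  have hGm : Measurable (G.indicator (1 : ℝ × ℝ → ℝ≥0∞)) := measurable_one.indicator hG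
  have hrot := (measurePreserving_rot θ).measurable
  have hjoint : Measurable fun z : (ℝ × ℝ) × ℝ => F.indicator (1 : ℝ × ℝ → ℝ≥0∞) z.1 *
      G.indicator (1 : ℝ × ℝ → ℝ≥0∞) (z.1.1 + z.2 * Real.cos θ, z.1.2 + z.2 * Real.sin θ) :=
    (hFm.comp measurable_fst).mul (hGm.comp (by fun_prop))
  have h2 : Measurable fun p : ℝ × ℝ => ∫⁻ t : ℝ, F.indicator (1 : ℝ × ℝ → ℝ≥0∞) p *
      G.indicator (1 : ℝ × ℝ → ℝ≥0∞) (p.1 + t * Real.cos θ, p.2 + t * Real.sin θ) :=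
    hjoint.lintegral_prod_right'
  have h3 := h2.comp hrot
  simp only [Function.comp_def] at h3
  rw [← (measurePreserving_rot θ).lintegral_comp h2, Measure.volume_eq_prod,
    lintegral_prod _ h3.aemeasurable, chordCorr]
  refine lintegral_congr fun x => ?_
  have hv : ∀ A : Set (ℝ × ℝ), MeasurableSet A → volume (Prod.mk x ⁻¹' (rot θ ⁻¹' A)) =
      ∫⁻ y, A.indicator (1 : ℝ × ℝ → ℝ≥0∞) (rot θ (x, y)) := by
    intro A hA
    rw [← lintegral_indicator_one (measurable_prodMk_left (hrot hA))]
    rfl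
  have hFx : Measurable fun y => F.indicator (1 : ℝ × ℝ → ℝ≥0∞) (rot θ (x, y)) :=
    hFm.comp (hrot.comp measurable_prodMk_left)
  rw [hv F hF, hv G hG, ← lintegral_mul_const _ hFx]
  refine lintegral_congr fun y => ?_
  have hGx : Measurable fun y => G.indicator (1 : ℝ × ℝ → ℝ≥0∞) (rot θ (x, y)) :=
    hGm.comp (hrot.comp measurable_prodMk_left)
  rw [lintegral_const_mul]
  · congr 1
    rw [← lintegral_add_left_eq_self _ y]
    refine lintegral_congr fun t => ?_
    congr 1
    ext <;> simp [rot, planarAff] <;> ring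
  · exact hGm.comp (by fun_prop)

lemma volume_mul_volume_le_lintegral_chordCorr {F G : Set (ℝ × ℝ)} (hF : MeasurableSet F)
    (hG : MeasurableSet G) {R : ℝ} (hR : 0 < R) (hFR : F ⊆ disc R) (hGR : G ⊆ disc R) :
    volume F * volume G ≤ ENNReal.ofReal (2 * R) *
      ∫⁻ θ in Set.Ioo (-Real.pi) Real.pi, chordCorr (rot θ ⁻¹' F) (rot θ ⁻¹' G) := by
  have hFm : Measurable (F.indicator (1 : ℝ × ℝ → ℝ≥0∞)) := measurable_one.indicator hF
  have hGm : Measurable (G.indicator (1 : ℝ × ℝ → ℝ≥0∞)) := measurable_one.indicator hG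
  let f : ℝ × ℝ → ℝ → ℝ → ℝ≥0∞ := fun p r θ => F.indicator 1 p *
    G.indicator 1 (p.1 + r * Real.cos θ, p.2 + r * Real.sin θ)
  have hf : Measurable fun z : (ℝ × ℝ) × ℝ × ℝ => f z.1 z.2.1 z.2.2 :=
    (hFm.comp measurable_fst).mul (hGm.comp (by fun_prop))
  have hpolar : ∀ p, F.indicator 1 p * volume G =
      ∫⁻ q in polarCoord.target, ENNReal.ofReal q.1 * f p q.1 q.2 := by
    intro p
    have hGp : Measurable fun x => G.indicator (1 : ℝ × ℝ → ℝ≥0∞) (p + x) :=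
      hGm.comp (measurable_const_add p)
    rw [← lintegral_indicator_one hG, ← lintegral_add_left_eq_self _ p,
      ← lintegral_const_mul _ hGp,
      ← lintegral_comp_polarCoord_symm]
    rfl
  calc volume F * volume G = ∫⁻ p, F.indicator 1 p * volume G := by
        rw [lintegral_mul_const _ hFm, lintegral_indicator_one hF]
    _ = ∫⁻ p, ∫⁻ q in polarCoord.target, ENNReal.ofReal q.1 * f p q.1 q.2 :=
        lintegral_congr hpolar
    _ ≤ ∫⁻ p, ∫⁻ q in polarCoord.target, ENNReal.ofReal (2 * R) * f p q.1 q.2 := by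
        refine lintegral_mono fun p => setLIntegral_mono' polarCoord.open_target.measurableSet
          fun q hq => ?_
        by_cases h0 : f p q.1 q.2 = 0
        · simp [h0]
        gcongr
        have h1 := hFR (Set.mem_of_indicator_ne_zero (left_ne_zero_of_mul h0))
        have h2 := hGR (Set.mem_of_indicator_ne_zero (right_ne_zero_of_mul h0))
        simp only [disc, Set.mem_ofPred_eq] at h1 h2
        have h3 := Real.sin_sq_add_cos_sq q.2
        refine le_of_sq_le_sq (a := q.1) ?_ (by positivity)
        have h4 : (q.1 * Real.cos q.2) ^ 2 + (q.1 * Real.sin q.2) ^ 2 = q.1 ^ 2 := by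
          linear_combination q.1 ^ 2 * h3
        nlinarith [sq_nonneg (2 * p.1 + q.1 * Real.cos q.2), sq_nonneg (2 * p.2 + q.1 * Real.sin q.2)]
    _ = ENNReal.ofReal (2 * R) * ∫⁻ p, ∫⁻ q in polarCoord.target, f p q.1 q.2 := by
        rw [← lintegral_const_mul]
        · refine lintegral_congr fun p => ?_
          rw [lintegral_const_mul]
          exact hf.comp measurable_prodMk_left
        · exact hf.lintegral_prod_right'
    _ ≤ _ := by
        gcongr
        calc ∫⁻ p, ∫⁻ q in polarCoord.target, f p q.1 q.2
            = ∫⁻ p, ∫⁻ θ in Set.Ioo (-Real.pi) Real.pi, ∫⁻ r in Set.Ioi 0, f p r θ := by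
              refine lintegral_congr fun p => ?_
              rw [polarCoord_target, Measure.volume_eq_prod, ← Measure.prod_restrict,
                lintegral_prod_symm]
              exact (hf.comp measurable_prodMk_left).aemeasurable
          _ = ∫⁻ θ in Set.Ioo (-Real.pi) Real.pi, ∫⁻ p, ∫⁻ r in Set.Ioi 0, f p r θ := by
              refine lintegral_lintegral_swap (Measurable.aemeasurable ?_)
              have : Measurable fun z : ((ℝ × ℝ) × ℝ) × ℝ => f z.1.1 z.2 z.1.2 :=
                hf.comp (by fun_prop : Measurable fun z : ((ℝ × ℝ) × ℝ) × ℝ => (z.1.1, z.2, z.1.2))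
              exact this.lintegral_prod_right'
          _ ≤ _ := by
              refine lintegral_mono fun θ => ?_
              rw [chordCorr_rot hF hG]
              exact lintegral_mono fun p => setLIntegral_le_lintegral _ _

lemma volume_rot_preimage (θ : ℝ) (A : Set (ℝ × ℝ)) : volume (rot θ ⁻¹' A) = volume A := by
  rw [volume_preimage_planarAff (ne_of_eq_of_ne (det_rot θ) one_ne_zero) 0 A, det_rot, enorm_one,
    one_mul]
  rfl

lemma triInt_rot_preimage (θ : ℝ) {A : Set (ℝ × ℝ)} (hA : MeasurableSet A) :
    triInt (rot θ ⁻¹' A) = triInt A := by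
  rw [triInt_preimage_planarAff (ne_of_eq_of_ne (det_rot θ) one_ne_zero) 0 hA, det_rot, enorm_one,
    one_pow, one_mul]
  rfl

/-- Some direction of symmetrization brings a convex set quantitatively closer to a disc of the
same area. -/
lemma exists_closer_to_disc {E : Set (ℝ × ℝ)} (hc : IsCompact E) (hconv : Convex ℝ E)
    {ρ R : ℝ} (hR : 0 < R) (hρ : ρ ^ 2 ≤ R ^ 2) (hER : E ⊆ disc R)
    (hvol : volume E = volume (disc ρ)) :
    ∃ E', IsCompact E' ∧ Convex ℝ E' ∧ E' ⊆ disc R ∧ volume E' = volume (disc ρ) ∧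
      triInt E' ≤ triInt E ∧
      7 * ENNReal.ofReal (2 * R) ^ 2 * volume (E' \ disc ρ) + volume (E \ disc ρ) ^ 2 ≤
        7 * ENNReal.ofReal (2 * R) ^ 2 * volume (E \ disc ρ) := by
  set F := E \ disc ρ with hFdef
  set G := disc ρ \ E with hGdef
  have hB := (isCompact_disc ρ).measurableSet
  have hFm : MeasurableSet F := hc.measurableSet.diff hB
  have hGm : MeasurableSet G := hB.diff hc.measurableSet
  have hFG : volume G = volume F := by
    have hfin : volume (E ∩ disc ρ) ≠ ⊤ :=
      ((measure_mono Set.inter_subset_left).trans_lt hc.measure_lt_top).ne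
    refine (ENNReal.add_right_inj hfin).1 ?_
    rw [measure_inter_add_sdiff E hB, hvol, Set.inter_comm, measure_inter_add_sdiff _
      hc.measurableSet]
  have hFfin : volume F ≠ ⊤ := ((measure_mono Set.sdiff_subset).trans_lt hc.measure_lt_top).ne
  obtain ⟨θ, hθ⟩ : ∃ θ, volume F ^ 2 ≤
      7 * ENNReal.ofReal (2 * R) * chordCorr (rot θ ⁻¹' F) (rot θ ⁻¹' G) := by
    by_contra! hcon
    have h1 := volume_mul_volume_le_lintegral_chordCorr hFm hGm hR
      (Set.sdiff_subset.trans hER) (Set.sdiff_subset.trans fun p hp => le_trans hp hρ)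
    have hX : 7 * volume F ^ 2 ≤ ENNReal.ofReal (2 * Real.pi) * volume F ^ 2 := by
      calc 7 * volume F ^ 2 ≤ 7 * (ENNReal.ofReal (2 * R) *
            ∫⁻ θ in Set.Ioo (-Real.pi) Real.pi, chordCorr (rot θ ⁻¹' F) (rot θ ⁻¹' G)) := by
            rw [sq]; nth_rewrite 2 [← hFG]; gcongr
        _ = ∫⁻ θ in Set.Ioo (-Real.pi) Real.pi,
              7 * ENNReal.ofReal (2 * R) * chordCorr (rot θ ⁻¹' F) (rot θ ⁻¹' G) := by
            rw [lintegral_const_mul' _ _ (by finiteness), mul_assoc]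
        _ ≤ ∫⁻ θ in Set.Ioo (-Real.pi) Real.pi, volume F ^ 2 :=
            lintegral_mono fun θ => (hcon θ).le
        _ = ENNReal.ofReal (2 * Real.pi) * volume F ^ 2 := by
            rw [setLIntegral_const, Real.volume_Ioo, mul_comm]; congr 2; ring
    have hpos : volume F ^ 2 ≠ 0 := (zero_le.trans_lt (hcon 0)).ne'
    have h7 := (ENNReal.mul_le_mul_iff_left hpos (ENNReal.pow_ne_top hFfin)).1 hX
    rw [show (7 : ℝ≥0∞) = ENNReal.ofReal 7 by norm_num,
      ENNReal.ofReal_le_ofReal_iff (by positivity)] at h7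
    linarith [Real.pi_lt_d2]
  have hdet : Real.sin θ * Real.sin θ - Real.cos θ * (-Real.cos θ) ≠ 0 :=
    ne_of_eq_of_ne (det_rot θ) one_ne_zero
  have hc' : IsCompact (rot θ ⁻¹' E) := isCompact_preimage_planarAff hdet _ hc
  have hconv' : Convex ℝ (rot θ ⁻¹' E) := convex_preimage_planarAff _ _ _ _ _ hconv
  have hER' : rot θ ⁻¹' E ⊆ disc R := by
    rw [← rot_preimage_disc θ R]; exact Set.preimage_mono hER
  have hkey := volume_steiner_sdiff_disc_add_le hc' hconv' hR hρ hER'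
  have hF' : rot θ ⁻¹' E \ disc ρ = rot θ ⁻¹' F := by
    rw [hFdef, Set.preimage_sdiff, rot_preimage_disc]
  have hG' : disc ρ \ rot θ ⁻¹' E = rot θ ⁻¹' G := by
    rw [hGdef, Set.preimage_sdiff, rot_preimage_disc]
  rw [hF', hG', volume_rot_preimage] at hkey
  refine ⟨steiner (rot θ ⁻¹' E), isCompact_steiner hc', convex_steiner hconv',
    steiner_subset_disc hER', ?_, ?_, ?_⟩
  · rw [volume_steiner hc' hconv', volume_rot_preimage, hvol]
  · exact (triInt_steiner_le hc' hconv').trans (triInt_rot_preimage θ hc.measurableSet).le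
  · calc _ ≤ 7 * ENNReal.ofReal (2 * R) ^ 2 * volume (steiner (rot θ ⁻¹' E) \ disc ρ) +
          7 * ENNReal.ofReal (2 * R) * chordCorr (rot θ ⁻¹' F) (rot θ ⁻¹' G) := by gcongr
      _ = 7 * ENNReal.ofReal (2 * R) * (ENNReal.ofReal (2 * R) *
          volume (steiner (rot θ ⁻¹' E) \ disc ρ) + chordCorr (rot θ ⁻¹' F) (rot θ ⁻¹' G)) := by
          ring
      _ ≤ 7 * ENNReal.ofReal (2 * R) * (ENNReal.ofReal (2 * R) * volume F) := by gcongr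
      _ = _ := by ring

lemma triInt_le_add_sdiff {B E : Set (ℝ × ℝ)} (hB : MeasurableSet B) (hE : MeasurableSet E)
    {C : ℝ≥0∞} (hC : ∀ p : Fin 3 → ℝ × ℝ, (∀ i, p i ∈ B) → ‖triDet p‖ₑ ≤ C) :
    triInt B ≤ triInt E + C * (3 * (volume (B \ E) * volume B ^ 2)) := by
  let A : Fin 3 → Set (Fin 3 → ℝ × ℝ) := fun i =>
    Set.univ.pi (Function.update (fun _ => B) i (B \ E))
  have hAm : ∀ i, MeasurableSet (A i) := fun i => MeasurableSet.univ_pi fun j => by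
    by_cases h : j = i
    · subst h; simpa using hB.diff hE
    · simpa [h] using hB
  have hAB : ∀ i, ∀ p ∈ A i, ∀ j, p j ∈ B := by
    intro i p hp j
    have := hp j trivial
    by_cases h : j = i
    · subst h; simp at this; exact this.1
    · simpa [h] using this
  have hvA : ∀ i, volume (A i) = volume (B \ E) * volume B ^ 2 := by
    intro i
    simp only [A, volume_pi, Measure.pi_pi, Fin.prod_univ_three]
    fin_cases i <;> simp [Function.update] <;> ring
  have hsub : Set.univ.pi (fun _ : Fin 3 => B) ⊆ Set.univ.pi (fun _ => E) ∪ ⋃ i, A i := by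
    intro p hp
    by_cases h : ∀ i, p i ∈ E
    · exact Or.inl fun i _ => h i
    · push Not at h
      obtain ⟨i, hi⟩ := h
      refine Or.inr (Set.mem_iUnion.2 ⟨i, fun j _ => ?_⟩)
      by_cases hj : j = i
      · subst hj; simpa using ⟨hp j trivial, hi⟩
      · simpa [hj] using hp j trivial
  calc triInt B ≤ ∫⁻ p in Set.univ.pi (fun _ => E) ∪ ⋃ i, A i, ‖triDet p‖ₑ :=
        lintegral_mono_set hsub
    _ ≤ triInt E + ∫⁻ p in ⋃ i, A i, ‖triDet p‖ₑ := lintegral_union_le _ _ _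
    _ ≤ triInt E + ∫⁻ p in ⋃ i, A i, C := by
        refine add_le_add le_rfl (setLIntegral_mono' (MeasurableSet.iUnion hAm) fun p hp => ?_)
        obtain ⟨i, hi⟩ := Set.mem_iUnion.1 hp
        exact hC p (hAB i p hi)
    _ ≤ _ := by
        rw [setLIntegral_const]
        gcongr
        refine (measure_iUnion_le _).trans ?_
        rw [tsum_fintype, Finset.sum_congr rfl fun i _ => hvA i]
        simp

/-- Among compact convex planar sets of given area, discs minimize the expected area of a
random triangle. -/
theorem triInt_disc_le {D : Set (ℝ × ℝ)} (hc : IsCompact D) (hconv : Convex ℝ D) {ρ : ℝ}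
    (hvol : volume D = volume (disc ρ)) : triInt (disc ρ) ≤ triInt D := by
  obtain ⟨R, hR, hρ, hDR⟩ : ∃ R : ℝ, 0 < R ∧ ρ ^ 2 ≤ R ^ 2 ∧ D ⊆ disc R := by
    obtain ⟨M, hM⟩ := hc.bddAbove_image (f := fun p : ℝ × ℝ => p.1 ^ 2 + p.2 ^ 2) (by fun_prop)
    have hnn : 0 ≤ |M| + |ρ| := by positivity
    refine ⟨|M| + |ρ| + 1, by positivity, ?_, fun p hp => ?_⟩
    · rw [← sq_abs ρ]; gcongr; linarith [abs_nonneg M]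
    · have h1 : p.1 ^ 2 + p.2 ^ 2 ≤ M := hM ⟨p, hp, rfl⟩
      have h2 := le_abs_self M
      simp only [disc, Set.mem_ofPred_eq]
      nlinarith [abs_nonneg M, abs_nonneg ρ]
  have hB := (isCompact_disc ρ).measurableSet
  let Q : Set ℝ := {q | ∃ E, IsCompact E ∧ Convex ℝ E ∧ E ⊆ disc R ∧ volume E = volume (disc ρ) ∧
    triInt E ≤ triInt D ∧ (volume (E \ disc ρ)).toReal = q}
  have hQne : Q.Nonempty := ⟨_, D, hc, hconv, hDR, hvol, le_rfl, rfl⟩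
  have hQbdd : BddBelow Q := ⟨0, by rintro _ ⟨E, -, -, -, -, -, rfl⟩; exact ENNReal.toReal_nonneg⟩
  have hinf : sInf Q = 0 := by
    refine le_antisymm ?_ (le_csInf hQne (by
      rintro _ ⟨E, -, -, -, -, -, rfl⟩; exact ENNReal.toReal_nonneg))
    by_contra! hlt
    have hk : (0 : ℝ) < 7 * (2 * R) ^ 2 := by positivity
    obtain ⟨q, hq, hqlt⟩ := exists_lt_of_csInf_lt hQne
      (show sInf Q < sInf Q + sInf Q ^ 2 / (7 * (2 * R) ^ 2) by
        have : 0 < sInf Q ^ 2 / (7 * (2 * R) ^ 2) := by positivity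
        linarith)
    have hqge := csInf_le hQbdd hq
    obtain ⟨E, hEc, hEv, hER, hvE, htE, rfl⟩ := hq
    obtain ⟨E', hEc', hEv', hER', hvE', htE', hineq⟩ :=
      exists_closer_to_disc hEc hEv hR hρ hER hvE
    have hfin : ∀ {A : Set (ℝ × ℝ)}, IsCompact A → volume (A \ disc ρ) ≠ ⊤ := fun hA =>
      ((measure_mono Set.sdiff_subset).trans_lt hA.measure_lt_top).ne
    have h1 := csInf_le hQbdd (show (volume (E' \ disc ρ)).toReal ∈ Q from
      ⟨E', hEc', hEv', hER', hvE', htE'.trans htE, rfl⟩)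
    have hf1 := hfin hEc
    have hf2 := hfin hEc'
    have h2 := ENNReal.toReal_mono (by finiteness) hineq
    rw [ENNReal.toReal_add (by finiteness) (by finiteness)] at h2
    simp only [ENNReal.toReal_mul, ENNReal.toReal_pow, ENNReal.toReal_ofNat,
      ENNReal.toReal_ofReal (show 0 ≤ 2 * R by positivity)] at h2
    have h3 : 7 * (2 * R) ^ 2 * (volume (E \ disc ρ)).toReal <
        7 * (2 * R) ^ 2 * sInf Q + sInf Q ^ 2 := by
      calc _ < 7 * (2 * R) ^ 2 * (sInf Q + sInf Q ^ 2 / (7 * (2 * R) ^ 2)) := by gcongr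
        _ = _ := by rw [mul_add, mul_div_cancel₀ _ hk.ne']
    nlinarith
  obtain ⟨C, hC⟩ := (isCompact_univ_pi fun _ : Fin 3 => isCompact_disc ρ).bddAbove_image
    continuous_triDet.abs.continuousOn
  have hC' : ∀ p : Fin 3 → ℝ × ℝ, (∀ i, p i ∈ disc ρ) → ‖triDet p‖ₑ ≤ ENNReal.ofReal C := by
    intro p hp
    rw [Real.enorm_eq_ofReal_abs]
    exact ENNReal.ofReal_le_ofReal (hC ⟨p, fun i _ => hp i, rfl⟩)
  set k := ENNReal.ofReal C * (3 * volume (disc ρ) ^ 2) with hkdef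
  have hvfin := (isCompact_disc ρ).measure_lt_top (μ := volume)
  have hkfin : k ≠ ⊤ := by finiteness
  have hineq : ∀ q ∈ Q, triInt (disc ρ) ≤ triInt D + k * ENNReal.ofReal q := by
    rintro _ ⟨E, hEc, hEv, hER, hvE, htE, rfl⟩
    have hfin : volume (E ∩ disc ρ) ≠ ⊤ :=
      ((measure_mono Set.inter_subset_left).trans_lt hEc.measure_lt_top).ne
    have hEfin : volume (E \ disc ρ) ≠ ⊤ :=
      ((measure_mono Set.sdiff_subset).trans_lt hEc.measure_lt_top).ne
    have hFG : volume (disc ρ \ E) = volume (E \ disc ρ) := by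
      refine (ENNReal.add_right_inj hfin).1 ?_
      rw [measure_inter_add_sdiff E hB, hvE, Set.inter_comm, measure_inter_add_sdiff _
        hEc.measurableSet]
    refine (triInt_le_add_sdiff hB hEc.measurableSet hC').trans (add_le_add htE (le_of_eq ?_))
    rw [hFG, ENNReal.ofReal_toReal hEfin, hkdef]; ring
  have hcl : (0 : ℝ) ∈ closure Q := hinf ▸ csInf_mem_closure hQne hQbdd
  have hset : IsClosed {q : ℝ | triInt (disc ρ) ≤ triInt D + k * ENNReal.ofReal q} :=
    isClosed_le continuous_const (continuous_const.add
      ((ENNReal.continuous_const_mul hkfin).comp ENNReal.continuous_ofReal))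
  have h0 : triInt (disc ρ) ≤ triInt D + k * ENNReal.ofReal 0 :=
    closure_minimal (fun q hq => hineq q hq) hset hcl
  simpa using h0

lemma volume_disc {ρ : ℝ} (hρ : 0 ≤ ρ) : volume (disc ρ) = ENNReal.ofReal (Real.pi * ρ ^ 2) := by
  have h := Complex.volume_preserving_equiv_real_prod.measure_preimage
    (isCompact_disc ρ).measurableSet.nullMeasurableSet
  have h2 : Complex.measurableEquivRealProd ⁻¹' disc ρ = Metric.closedBall 0 ρ := by
    ext z
    simp only [disc, Set.mem_preimage, Complex.measurableEquivRealProd_apply, Set.mem_ofPred_eq,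
      Metric.mem_closedBall, dist_zero_right]
    rw [← abs_of_nonneg (norm_nonneg z), ← abs_of_nonneg hρ, ← sq_le_sq, abs_of_nonneg hρ,
      Complex.sq_norm, Complex.normSq_apply, sq, sq]
  rw [← h, h2, Complex.volume_closedBall, mul_comm, ENNReal.ofReal_mul Real.pi_pos.le,
    ENNReal.ofReal_pow hρ, ← NNReal.coe_real_pi, ENNReal.ofReal_coe_nnreal]

lemma triInt_disc {ρ : ℝ} (hρ : 0 ≤ ρ) :
    triInt (disc ρ) = ENNReal.ofReal (ρ ^ 8) * triInt (disc 1) := by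
  rcases hρ.eq_or_lt with rfl | hρ
  · have h0 : volume (disc 0) = 0 := by rw [volume_disc le_rfl]; simp
    have : volume (Set.univ.pi fun _ : Fin 3 => disc 0) = 0 := by
      simp [volume_pi, Measure.pi_pi, h0]
    rw [triInt, setLIntegral_measure_zero _ _ this]
    simp
  · have hdet : ρ * ρ - 0 * 0 ≠ 0 := by nlinarith
    rw [triInt_preimage_planarAff hdet 0 (isCompact_disc ρ).measurableSet]
    congr 1
    · rw [Real.enorm_eq_ofReal_abs, ← ENNReal.ofReal_pow (abs_nonneg _)]
      congr 1
      rw [abs_of_nonneg (by nlinarith)]; ring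
    · congr 1
      ext p
      simp only [disc, planarAff, Set.mem_preimage, Set.mem_ofPred_eq]
      have hρ2 : 0 < ρ ^ 2 := by positivity
      simp only [zero_mul, add_zero, Prod.fst_zero, Prod.snd_zero, zero_add, mul_pow, one_pow]
      rw [← mul_add]
      exact mul_le_iff_le_one_right hρ2

lemma triInt_ball_section (a b c : ℝ) :
    triInt {p : ℝ × ℝ | p.1 ^ 2 + p.2 ^ 2 + (a * p.1 + b * p.2 + c) ^ 2 ≤ 1} ≤
      (Set.Icc (-√(1 + a ^ 2 + b ^ 2)) √(1 + a ^ 2 + b ^ 2)).indicator (fun c =>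
        ENNReal.ofReal ((1 + a ^ 2 + b ^ 2)⁻¹ ^ 2 * (1 - c ^ 2 / (1 + a ^ 2 + b ^ 2)) ^ 4)) c *
        triInt (disc 1) := by
  have ha : 0 < 1 + a ^ 2 := by positivity
  have hS : 0 < 1 + a ^ 2 + b ^ 2 := by positivity
  set S := 1 + a ^ 2 + b ^ 2 with hSdef
  set α := √(1 + a ^ 2) with hα
  set s := √S with hs
  have hα0 : 0 < α := Real.sqrt_pos.2 ha
  have hs0 : 0 < s := Real.sqrt_pos.2 hS
  have hα2 : α ^ 2 = 1 + a ^ 2 := Real.sq_sqrt ha.le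
  have hs2 : s ^ 2 = S := Real.sq_sqrt hS.le
  have hform : ∀ p : ℝ × ℝ, (α * p.1 + a * b / α * p.2 + a * c / α) ^ 2 +
      (0 * p.1 + s / α * p.2 + b * c / (s * α)) ^ 2 =
      p.1 ^ 2 + p.2 ^ 2 + (a * p.1 + b * p.2 + c) ^ 2 - c ^ 2 / S := by
    intro p
    have h1 : (α * p.1 + a * b / α * p.2 + a * c / α) ^ 2 =
        α ^ 2 * p.1 ^ 2 + 2 * a * p.1 * (b * p.2 + c) + a ^ 2 * (b * p.2 + c) ^ 2 / α ^ 2 := by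
      field_simp; ring
    have h2 : (0 * p.1 + s / α * p.2 + b * c / (s * α)) ^ 2 =
        (s ^ 2 * p.2 ^ 2 + 2 * b * c * p.2 + b ^ 2 * c ^ 2 / s ^ 2) / α ^ 2 := by
      field_simp; ring
    rw [h1, h2, hs2, hα2]
    field_simp
    rw [hSdef]; ring
  by_cases hc : c ∈ Set.Icc (-s) s
  · rw [Set.indicator_of_mem hc]
    have hcS : 0 ≤ 1 - c ^ 2 / S := by
      rw [sub_nonneg, div_le_one hS, ← hs2, ← sq_abs c]
      have := abs_le.2 hc
      gcongr
    set r := √(1 - c ^ 2 / S)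
    have hr2 : r ^ 2 = 1 - c ^ 2 / S := Real.sq_sqrt hcS
    have hdet : α * (s / α) - a * b / α * 0 = s := by field_simp; ring
    have hpre : {p : ℝ × ℝ | p.1 ^ 2 + p.2 ^ 2 + (a * p.1 + b * p.2 + c) ^ 2 ≤ 1} =
        planarAff α (a * b / α) 0 (s / α) (a * c / α, b * c / (s * α)) ⁻¹' disc r := by
      ext p
      simp only [disc, planarAff, Set.mem_preimage, Set.mem_ofPred_eq]
      rw [hform, hr2]
      constructor <;> intro h <;> linarith
    have h1 := triInt_preimage_planarAff (ne_of_eq_of_ne hdet hs0.ne')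
      (a * c / α, b * c / (s * α)) (isCompact_disc r).measurableSet
    rw [← hpre, hdet, triInt_disc (Real.sqrt_nonneg _)] at h1
    have h4 : ‖s‖ₑ ^ 4 = ENNReal.ofReal (S ^ 2) := by
      rw [Real.enorm_eq_ofReal_abs, ← ENNReal.ofReal_pow (abs_nonneg _), abs_of_pos hs0]
      congr 1
      calc s ^ 4 = (s ^ 2) ^ 2 := by ring
        _ = _ := by rw [hs2]
    have h8 : r ^ 8 = (1 - c ^ 2 / S) ^ 4 := by rw [← hr2]; ring
    rw [h4, h8] at h1
    rw [ENNReal.ofReal_mul (by positivity), mul_assoc, h1, ← mul_assoc,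
      ← ENNReal.ofReal_mul (by positivity)]
    have : S⁻¹ ^ 2 * S ^ 2 = 1 := by field_simp
    rw [this]; simp
  · have : {p : ℝ × ℝ | p.1 ^ 2 + p.2 ^ 2 + (a * p.1 + b * p.2 + c) ^ 2 ≤ 1} = ∅ := by
      ext p
      simp only [Set.mem_ofPred_eq, Set.mem_empty_iff_false, iff_false]
      intro h
      apply hc
      have h1 := hform p
      have h2 : c ^ 2 / S ≤ 1 := by
        nlinarith [sq_nonneg (α * p.1 + a * b / α * p.2 + a * c / α),
          sq_nonneg (0 * p.1 + s / α * p.2 + b * c / (s * α))]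
      rw [div_le_one hS, ← hs2] at h2
      exact abs_le.1 (abs_le_of_sq_le_sq h2 hs0.le)
    rw [this]
    simp [triInt, Set.univ_pi_empty]

lemma lintegral_Icc_section_weight {s : ℝ} (hs : 0 < s) :
    ∫⁻ c in Set.Icc (-s) s, ENNReal.ofReal ((s ^ 2)⁻¹ ^ 2 * (1 - c ^ 2 / s ^ 2) ^ 4) =
      ENNReal.ofReal (256 / 315 * (s⁻¹) ^ 3) := by
  rw [lintegral_Icc_ofReal_eq (by linarith) (F := fun c => (s ^ 2)⁻¹ ^ 2 * (c - 4 / 3 * c ^ 3 / s ^ 2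
    + 6 / 5 * c ^ 5 / s ^ 4 - 4 / 7 * c ^ 7 / s ^ 6 + 1 / 9 * c ^ 9 / s ^ 8)) (by fun_prop)]
  · congr 1; field_simp; ring
  · intro t
    have hp : ∀ (n : ℕ) (q r : ℝ), HasDerivAt (fun t : ℝ => q * t ^ n / r)
        (q * (n * t ^ (n - 1)) / r) t := fun n q r =>
      ((hasDerivAt_pow n t).const_mul q).div_const r
    refine ((((((hasDerivAt_id t).sub (hp 3 _ _)).add (hp 5 _ _)).sub (hp 7 _ _)).add
      (hp 9 _ _)).const_mul _).congr_deriv ?_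
    push_cast
    field_simp
    ring
  · intro t _; positivity

lemma lintegral_Ioi_radial :
    ∫⁻ r in Set.Ioi (0 : ℝ), ENNReal.ofReal (r * (√(1 + r ^ 2))⁻¹ ^ 3) = 1 := by
  have hd : ∀ r ∈ Set.Ici (0 : ℝ), HasDerivAt (fun r : ℝ => -(√(1 + r ^ 2))⁻¹)
      (r * (√(1 + r ^ 2))⁻¹ ^ 3) r := by
    intro r _
    have h0 : 0 < 1 + r ^ 2 := by positivity
    have h1 : HasDerivAt (fun r : ℝ => 1 + r ^ 2) (2 * r) r := by
      simpa using (hasDerivAt_pow 2 r).const_add 1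
    refine ((h1.sqrt h0.ne').inv (Real.sqrt_pos.2 h0).ne').neg.congr_deriv ?_
    have := Real.sqrt_pos.2 h0
    field_simp
  have hlim : Tendsto (fun r : ℝ => -(√(1 + r ^ 2))⁻¹) atTop (nhds 0) := by
    rw [← neg_zero]
    refine (tendsto_inv_atTop_zero.comp (Real.tendsto_sqrt_atTop.comp ?_)).neg
    exact tendsto_atTop_add_const_left _ _ (tendsto_pow_atTop two_ne_zero)
  have hnn : ∀ r ∈ Set.Ioi (0 : ℝ), 0 ≤ r * (√(1 + r ^ 2))⁻¹ ^ 3 := fun r hr =>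
    mul_nonneg (le_of_lt hr) (by positivity)
  rw [← ofReal_integral_eq_lintegral_ofReal (integrableOn_Ioi_deriv_of_nonneg' hd hnn hlim)
    ((ae_restrict_iff' measurableSet_Ioi).2 (Eventually.of_forall hnn)),
    integral_Ioi_of_hasDerivAt_of_nonneg' hd hnn hlim]
  norm_num

lemma lintegral_normal_weight :
    ∫⁻ p : ℝ × ℝ, ENNReal.ofReal ((√(1 + p.1 ^ 2 + p.2 ^ 2))⁻¹ ^ 3) =
      ENNReal.ofReal (2 * Real.pi) := by
  rw [← lintegral_comp_polarCoord_symm]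
  have hm : Measurable fun q : ℝ × ℝ => ENNReal.ofReal (q.1 * (√(1 + q.1 ^ 2))⁻¹ ^ 3) := by
    fun_prop
  have h : ∀ q ∈ polarCoord.target, ENNReal.ofReal q.1 • ENNReal.ofReal
      ((√(1 + (polarCoord.symm q).1 ^ 2 + (polarCoord.symm q).2 ^ 2))⁻¹ ^ 3) =
      ENNReal.ofReal (q.1 * (√(1 + q.1 ^ 2))⁻¹ ^ 3) := by
    intro q hq
    rw [smul_eq_mul, ← ENNReal.ofReal_mul (le_of_lt (polarCoord_target ▸ hq).1)]
    simp only [polarCoord_symm_apply]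
    congr 5
    linear_combination q.1 ^ 2 * Real.sin_sq_add_cos_sq q.2
  rw [setLIntegral_congr_fun polarCoord.open_target.measurableSet h, polarCoord_target,
    Measure.volume_eq_prod, ← Measure.prod_restrict, lintegral_prod_symm _
    hm.aemeasurable]
  simp only [lintegral_Ioi_radial, lintegral_const, one_mul, Measure.restrict_apply_univ,
    Real.volume_Ioo]
  congr 1; ring

lemma volume_unit_ball_prod :
    volume {q : (ℝ × ℝ) × ℝ | q.1.1 ^ 2 + q.1.2 ^ 2 + q.2 ^ 2 ≤ 1} =
      ENNReal.ofReal (4 * Real.pi / 3) := by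
  have hm : MeasurableSet {q : (ℝ × ℝ) × ℝ | q.1.1 ^ 2 + q.1.2 ^ 2 + q.2 ^ 2 ≤ 1} :=
    measurableSet_le (by fun_prop) (by fun_prop)
  rw [Measure.volume_eq_prod, Measure.prod_apply_symm hm]
  have h : ∀ z : ℝ, volume ((fun p : ℝ × ℝ => (p, z)) ⁻¹'
      {q : (ℝ × ℝ) × ℝ | q.1.1 ^ 2 + q.1.2 ^ 2 + q.2 ^ 2 ≤ 1}) =
      (Set.Icc (-1 : ℝ) 1).indicator (fun z => ENNReal.ofReal (Real.pi * (1 - z ^ 2))) z := by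
    intro z
    by_cases hz : z ∈ Set.Icc (-1 : ℝ) 1
    · have hz2 : 0 ≤ 1 - z ^ 2 := by nlinarith [hz.1, hz.2]
      rw [Set.indicator_of_mem hz, ← Real.sq_sqrt hz2, ← volume_disc (Real.sqrt_nonneg _)]
      congr 1
      ext p
      simp only [disc, Set.mem_preimage, Set.mem_ofPred_eq, Real.sq_sqrt hz2]
      constructor <;> intro h <;> linarith
    · rw [Set.indicator_of_notMem hz]
      convert measure_empty (μ := (volume : Measure (ℝ × ℝ)))
      ext p
      simp only [Set.mem_preimage, Set.mem_ofPred_eq, Set.mem_empty_iff_false, iff_false]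
      intro h
      exact hz (abs_le.1 ((sq_le_one_iff_abs_le_one z).1
        (by nlinarith [sq_nonneg p.1, sq_nonneg p.2])))
  rw [lintegral_congr h, lintegral_indicator measurableSet_Icc,
    lintegral_Icc_poly (by norm_num) Real.pi 0 (-Real.pi) 0 0 0 (fun t => by ring) fun t ht =>
      mul_nonneg Real.pi_pos.le (by nlinarith [ht.1, ht.2])]
  congr 1; ring

/-- The points of the plane above which the graph of `p ↦ h 0 * p.1 + h 1 * p.2 + h 2` meets `K`. -/
def planeSec (K : Set ((ℝ × ℝ) × ℝ)) (h : Fin 3 → ℝ) : Set (ℝ × ℝ) :=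
  {p | (p, h 0 * p.1 + h 1 * p.2 + h 2) ∈ K}

lemma measurableSet_planeSec {K : Set ((ℝ × ℝ) × ℝ)} (hK : MeasurableSet K) (h : Fin 3 → ℝ) :
    MeasurableSet (planeSec K h) :=
  (by fun_prop : Measurable fun p : ℝ × ℝ => (p, h 0 * p.1 + h 1 * p.2 + h 2)) hK

lemma setLIntegral_triple_eq {K : Set ((ℝ × ℝ) × ℝ)} (hK : MeasurableSet K)
    {g : (Fin 3 → (ℝ × ℝ) × ℝ) → ℝ≥0∞} (hg : Measurable g) :
    ∫⁻ x in Set.univ.pi (fun _ => K), g x =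
      ∫⁻ h : Fin 3 → ℝ, ∫⁻ p in Set.univ.pi (fun _ => planeSec K h),
        ‖triDet p‖ₑ * g fun i => (p i, h 0 * (p i).1 + h 1 * (p i).2 + h 2) := by
  have hpi : MeasurableSet (Set.univ.pi fun _ : Fin 3 => K) := MeasurableSet.univ_pi fun _ => hK
  rw [← lintegral_indicator hpi, lintegral_triple_eq (hg.indicator hpi)]
  refine lintegral_congr fun h => ?_
  rw [← lintegral_indicator (MeasurableSet.univ_pi fun _ => measurableSet_planeSec hK h)]
  refine lintegral_congr fun p => ?_
  by_cases hp : p ∈ Set.univ.pi fun _ => planeSec K h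
  · rw [Set.indicator_of_mem hp, Set.indicator_of_mem]
    exact hp
  · rw [Set.indicator_of_notMem hp, Set.indicator_of_notMem, mul_zero]
    exact hp

/-- An upper bound for the normalised moment of the section of the unit ball by a plane. -/
noncomputable def sectionWeight (a b c : ℝ) : ℝ≥0∞ :=
  (Set.Icc (-√(1 + a ^ 2 + b ^ 2)) √(1 + a ^ 2 + b ^ 2)).indicator (fun c =>
    ENNReal.ofReal ((1 + a ^ 2 + b ^ 2)⁻¹ ^ 2 * (1 - c ^ 2 / (1 + a ^ 2 + b ^ 2)) ^ 4)) c

lemma measurable_sectionWeight {α : Type*} [MeasurableSpace α] {a b c : α → ℝ} (ha : Measurable a)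
    (hb : Measurable b) (hc : Measurable c) :
    Measurable fun z => sectionWeight (a z) (b z) (c z) := by
  have h1 : Measurable fun z => -√(1 + a z ^ 2 + b z ^ 2) := by fun_prop
  have h2 : Measurable fun z => √(1 + a z ^ 2 + b z ^ 2) := by fun_prop
  have h3 : Measurable fun z => ENNReal.ofReal ((1 + a z ^ 2 + b z ^ 2)⁻¹ ^ 2 *
      (1 - c z ^ 2 / (1 + a z ^ 2 + b z ^ 2)) ^ 4) := by fun_prop
  exact h3.indicator ((measurableSet_le h1 hc).inter (measurableSet_le hc h2))

lemma lintegral_sectionWeight :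
    ∫⁻ h : Fin 3 → ℝ, sectionWeight (h 0) (h 1) (h 2) =
      ENNReal.ofReal (256 / 315) * ENNReal.ofReal (2 * Real.pi) := by
  have hsw : ∀ a : ℝ, ∫⁻ c, ∫⁻ b, sectionWeight a b c =
      ∫⁻ b, ENNReal.ofReal (256 / 315) * ENNReal.ofReal ((√(1 + a ^ 2 + b ^ 2))⁻¹ ^ 3) := by
    intro a
    have hm : Measurable fun z : ℝ × ℝ => sectionWeight a z.2 z.1 :=
      measurable_sectionWeight measurable_const measurable_snd measurable_fst
    rw [lintegral_lintegral_swap (f := fun c b : ℝ => sectionWeight a b c) hm.aemeasurable]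
    refine lintegral_congr fun b => ?_
    have hS : 0 < 1 + a ^ 2 + b ^ 2 := by positivity
    have h1 := lintegral_Icc_section_weight (Real.sqrt_pos.2 hS)
    rw [Real.sq_sqrt hS.le, ENNReal.ofReal_mul (by norm_num)] at h1
    rw [← h1, ← lintegral_indicator measurableSet_Icc]
    rfl
  have hm : Measurable fun p : ℝ × ℝ => ENNReal.ofReal ((√(1 + p.1 ^ 2 + p.2 ^ 2))⁻¹ ^ 3) := by
    fun_prop
  have hw : Measurable fun h : Fin 3 → ℝ => sectionWeight (h 0) (h 1) (h 2) :=
    measurable_sectionWeight (measurable_pi_apply 0) (measurable_pi_apply 1)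
      (measurable_pi_apply 2)
  rw [lintegral_fin_three hw]
  simp only [Matrix.cons_val]
  rw [lintegral_congr hsw, ← lintegral_normal_weight, ← lintegral_const_mul _ hm,
    Measure.volume_eq_prod, lintegral_prod _ (hm.const_mul _).aemeasurable]

lemma le_triInt_disc_one : ENNReal.ofReal (35 * Real.pi ^ 2 / 24) ≤ triInt (disc 1) := by
  set B := {q : (ℝ × ℝ) × ℝ | q.1.1 ^ 2 + q.1.2 ^ 2 + q.2 ^ 2 ≤ 1} with hBdef
  have hB : MeasurableSet B := measurableSet_le (by fun_prop) (by fun_prop)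
  have hw : Measurable fun h : Fin 3 → ℝ => sectionWeight (h 0) (h 1) (h 2) :=
    measurable_sectionWeight (measurable_pi_apply 0) (measurable_pi_apply 1)
      (measurable_pi_apply 2)
  have hvol : volume (Set.univ.pi fun _ : Fin 3 => B) = ENNReal.ofReal ((4 * Real.pi / 3) ^ 3) := by
    rw [volume_pi_pi, Finset.prod_const, Finset.card_univ, Fintype.card_fin, hBdef,
      volume_unit_ball_prod, ENNReal.ofReal_pow (by positivity)]
  have hmain : ENNReal.ofReal ((4 * Real.pi / 3) ^ 3) ≤
      ENNReal.ofReal (256 / 315 * (2 * Real.pi)) * triInt (disc 1) := by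
    rw [← hvol, ← setLIntegral_one, setLIntegral_triple_eq hB measurable_const,
      ENNReal.ofReal_mul (by norm_num), ← lintegral_sectionWeight, ← lintegral_mul_const _ hw]
    refine lintegral_mono fun h => ?_
    simp only [mul_one]
    exact triInt_ball_section (h 0) (h 1) (h 2)
  have hpi := Real.pi_pos
  have hc0 : ENNReal.ofReal (256 / 315 * (2 * Real.pi)) ≠ 0 := by
    simp only [ne_eq, ENNReal.ofReal_eq_zero, not_le]; positivity
  rw [← ENNReal.mul_le_mul_iff_right hc0 ENNReal.ofReal_ne_top,
    ← ENNReal.ofReal_mul (by positivity)]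
  refine le_trans (le_of_eq ?_) hmain
  congr 1; ring

theorem le_triInt {D : Set (ℝ × ℝ)} (hc : IsCompact D) (hconv : Convex ℝ D) :
    ENNReal.ofReal (35 / (24 * Real.pi ^ 2)) * volume D ^ 4 ≤ triInt D := by
  set v := (volume D).toReal with hv
  have hv0 : 0 ≤ v := ENNReal.toReal_nonneg
  have hpi := Real.pi_pos
  have hvD : volume D = ENNReal.ofReal v := (ENNReal.ofReal_toReal hc.measure_lt_top.ne).symm
  have hρ2 : √(v / Real.pi) ^ 2 = v / Real.pi := Real.sq_sqrt (by positivity)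
  have hvol : volume D = volume (disc √(v / Real.pi)) := by
    rw [volume_disc (Real.sqrt_nonneg _), hρ2, hvD]
    congr 1; field_simp
  refine le_trans ?_ (triInt_disc_le hc hconv hvol)
  rw [triInt_disc (Real.sqrt_nonneg _), hvD]
  refine le_trans (le_of_eq ?_) (mul_le_mul_right le_triInt_disc_one _)
  have h8 : √(v / Real.pi) ^ 8 = v ^ 4 / Real.pi ^ 4 := by
    rw [← div_pow, show √(v / Real.pi) ^ 8 = (√(v / Real.pi) ^ 2) ^ 4 by ring, hρ2]
  rw [← ENNReal.ofReal_pow hv0, ← ENNReal.ofReal_mul (by positivity), h8,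
    ← ENNReal.ofReal_mul (by positivity)]
  congr 1; field_simp

lemma lintegral_comp_add_mul {f : ℝ → ℝ≥0∞} (hf : Measurable f) (u : ℝ) {a : ℝ} (ha : a ≠ 0) :
    ‖a‖ₑ * ∫⁻ r, f (u + a * r) = ∫⁻ t, f t := by
  have hm : Measurable fun t => f (u + t) := hf.comp (measurable_const_add u)
  rw [← lintegral_add_left_eq_self f u]
  conv_rhs => rw [← Real.smul_map_volume_mul_left ha]
  rw [lintegral_smul_measure, lintegral_map hm (measurable_const_mul a),
    Real.enorm_eq_ofReal_abs, smul_eq_mul]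

lemma lintegral_exp_neg_abs :
    ∫⁻ r : ℝ, ENNReal.ofReal (Real.exp (-(|r| / 6))) = 12 := by
  have h : ∫ r : ℝ, Real.exp (-(|r| / 6)) = 12 := by
    rw [integral_comp_abs (f := fun r => Real.exp (-(r / 6)))]
    have h1 := integral_exp_mul_Ioi (a := -(1 / 6)) (by norm_num) 0
    have h2 : ∀ r : ℝ, Real.exp (-(r / 6)) = Real.exp (-(1 / 6) * r) := fun r => by
      congr 1; ring
    rw [integral_congr_ae (Eventually.of_forall h2), h1]
    norm_num
  have hi : Integrable fun r : ℝ => Real.exp (-(|r| / 6)) :=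
    Integrable.of_integral_ne_zero (by rw [h]; norm_num)
  rw [← ofReal_integral_eq_lintegral_ofReal hi (Eventually.of_forall fun r => (Real.exp_pos _).le), h]
  norm_num

lemma enorm_mul_lintegral_exp {t : ℝ} (ht : t ≠ 0) :
    ‖t‖ₑ * ∫⁻ r : ℝ, ENNReal.ofReal (Real.exp (-(|t * r| / 6))) = 12 := by
  have hm : Measurable fun r : ℝ => ENNReal.ofReal (Real.exp (-(|r| / 6))) := by fun_prop
  rw [← lintegral_exp_neg_abs, ← lintegral_comp_add_mul hm 0 ht]
  simp only [zero_add]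

lemma tendsto_ofReal_one_sub_pow (t r : ℝ) :
    Tendsto (fun m : ℕ => ENNReal.ofReal (1 - |t * ((m : ℝ)⁻¹ * r)| / 6) ^ m) atTop
      (nhds (ENNReal.ofReal (Real.exp (-(|t * r| / 6))))) := by
  have h := (ENNReal.continuous_ofReal.tendsto _).comp
    (Real.tendsto_one_add_div_pow_exp (-(|t * r| / 6)))
  refine h.congr' ?_
  obtain ⟨N, hN⟩ := exists_nat_gt (|t * r| / 6)
  filter_upwards [eventually_ge_atTop (N + 1)] with m hm
  have hm' : (N : ℝ) + 1 ≤ m := by exact_mod_cast hm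
  have hm0 : (0 : ℝ) < m := lt_of_lt_of_le (by positivity) hm'
  have h1 : 1 - |t * ((m : ℝ)⁻¹ * r)| / 6 = 1 + -(|t * r| / 6) / m := by
    rw [show t * ((m : ℝ)⁻¹ * r) = (m : ℝ)⁻¹ * (t * r) by ring, abs_mul,
      abs_of_pos (inv_pos.2 hm0)]
    field_simp
    ring
  rw [Function.comp_apply, h1, ← ENNReal.ofReal_pow]
  have : |t * r| / 6 / m ≤ 1 := by rw [div_le_one hm0]; linarith
  rw [neg_div]; linarith

lemma ofReal_one_sub_pow_le (t r : ℝ) {m : ℕ} (hm : m ≠ 0) :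
    ENNReal.ofReal (1 - |t * ((m : ℝ)⁻¹ * r)| / 6) ^ m ≤
      ENNReal.ofReal (Real.exp (-(|t * r| / 6))) := by
  have hm0 : (0 : ℝ) < m := by positivity
  have h1 : Real.exp (-(|t * r| / 6)) = Real.exp (-(|t * ((m : ℝ)⁻¹ * r)| / 6)) ^ m := by
    rw [← Real.exp_nat_mul, show t * ((m : ℝ)⁻¹ * r) = (m : ℝ)⁻¹ * (t * r) by ring,
      abs_mul (m : ℝ)⁻¹, abs_of_pos (inv_pos.2 hm0)]
    congr 1
    field_simp
  rw [h1, ENNReal.ofReal_pow (Real.exp_pos _).le]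
  gcongr
  linarith [Real.add_one_le_exp (-(|t * ((m : ℝ)⁻¹ * r)| / 6))]

/-- Six times the signed volume of the tetrahedron with vertices `x 0`, `x 1`, `x 2`, `z`. -/
def tetDet (x : Fin 3 → (ℝ × ℝ) × ℝ) (z : (ℝ × ℝ) × ℝ) : ℝ :=
  (triDet fun i => (x i).1) * (z.2 - (x 0).2)
    - ((x 1).1.1 - (x 0).1.1) * ((x 2).2 - (x 0).2) * (z.1.2 - (x 0).1.2)
    + ((x 2).1.1 - (x 0).1.1) * ((x 1).2 - (x 0).2) * (z.1.2 - (x 0).1.2)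
    + ((x 1).1.2 - (x 0).1.2) * ((x 2).2 - (x 0).2) * (z.1.1 - (x 0).1.1)
    - ((x 2).1.2 - (x 0).1.2) * ((x 1).2 - (x 0).2) * (z.1.1 - (x 0).1.1)

/-- The point above `p` of the plane with coefficients `h`. -/
def planePt (h : Fin 3 → ℝ) (p : ℝ × ℝ) : (ℝ × ℝ) × ℝ :=
  (p, h 0 * p.1 + h 1 * p.2 + h 2)

lemma tetDet_planePt (h : Fin 3 → ℝ) (p : Fin 3 → ℝ × ℝ) (q : ℝ × ℝ) (s : ℝ) :
    tetDet (fun i => planePt h (p i)) (q, (planePt h q).2 + s) = triDet p * s := by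
  simp only [tetDet, planePt, triDet]; ring

lemma measurable_planePt : Measurable fun z : (Fin 3 → ℝ) × (ℝ × ℝ) => planePt z.1 z.2 := by
  unfold planePt; fun_prop

lemma measurable_tetDet :
    Measurable fun z : (Fin 3 → (ℝ × ℝ) × ℝ) × ((ℝ × ℝ) × ℝ) => tetDet z.1 z.2 := by
  unfold tetDet triDet; fun_prop

lemma ae_planePt_notMem {F : Set ((ℝ × ℝ) × ℝ)} (hFm : MeasurableSet F) (hF : volume F = 0) :
    ∀ᵐ h : Fin 3 → ℝ, ∀ᵐ q : ℝ × ℝ, planePt h q ∉ F := by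
  have hS : MeasurableSet {x : Fin 3 → (ℝ × ℝ) × ℝ | x 0 ∈ F} := measurable_pi_apply 0 hFm
  have h0 : volume {x : Fin 3 → (ℝ × ℝ) × ℝ | x 0 ∈ F} = 0 :=
    Measure.pi_eval_preimage_null _ hF
  have hg : Measurable ({x : Fin 3 → (ℝ × ℝ) × ℝ | x 0 ∈ F}.indicator (1 : (Fin 3 → (ℝ × ℝ) × ℝ) → ℝ≥0∞)) :=
    measurable_one.indicator hS
  have h1 := lintegral_triple_eq hg
  rw [lintegral_indicator_one hS, h0] at h1
  have hm : Measurable fun z : (Fin 3 → ℝ) × (Fin 3 → ℝ × ℝ) => ‖triDet z.2‖ₑ *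
      {x : Fin 3 → (ℝ × ℝ) × ℝ | x 0 ∈ F}.indicator 1 fun i => planePt z.1 (z.2 i) := by
    refine (measurable_triDet.comp measurable_snd).enorm.mul (hg.comp ?_)
    unfold planePt; fun_prop
  have h2 := (lintegral_eq_zero_iff hm.lintegral_prod_right').1 h1.symm
  filter_upwards [h2] with h hh
  have h3 := (lintegral_eq_zero_iff (hm.comp measurable_prodMk_left)).1 hh
  have h4 : volume {p : Fin 3 → ℝ × ℝ | planePt h (p 0) ∈ F} = 0 := by
    rw [← compl_compl {p : Fin 3 → ℝ × ℝ | planePt h (p 0) ∈ F}]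
    change ∀ᵐ p, p ∈ {p : Fin 3 → ℝ × ℝ | planePt h (p 0) ∈ F}ᶜ
    filter_upwards [h3, ae_triDet_ne_zero] with p hp hp0 hpF
    simp only [Pi.zero_apply, mul_eq_zero, enorm_eq_zero, Function.comp_apply, hp0, false_or] at hp
    rw [Set.indicator_of_mem (show (fun i => planePt h (p i)) ∈ {x | x 0 ∈ F} from hpF)] at hp
    exact one_ne_zero hp
  have h5 : {p : Fin 3 → ℝ × ℝ | planePt h (p 0) ∈ F} =
      Set.univ.pi (![{q : ℝ × ℝ | planePt h q ∈ F}, Set.univ, Set.univ]) := by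
    ext p
    simp [Fin.forall_fin_succ]
  rw [h5, volume_pi_pi, Fin.prod_univ_three] at h4
  change volume {q : ℝ × ℝ | ¬ planePt h q ∉ F} = 0
  simp only [not_not]
  simpa using h4

lemma lintegral_prod_volume {α β : Type*} [MeasureSpace α] [MeasureSpace β]
    [SFinite (volume : Measure α)] [SFinite (volume : Measure β)] {f : α × β → ℝ≥0∞}
    (hf : Measurable f) : ∫⁻ z, f z = ∫⁻ x, ∫⁻ y, f (x, y) :=
  lintegral_prod _ hf.aemeasurable

/-- The `m`-th power of one minus the volume of a tetrahedron, in terms of its determinant. -/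
noncomputable def missPow (m : ℕ) (v : ℝ) : ℝ≥0∞ := ENNReal.ofReal (1 - |v| / 6) ^ m

lemma measurable_missPow (m : ℕ) : Measurable (missPow m) := by
  unfold missPow; fun_prop

lemma measurable_tetDet_right (x : Fin 3 → (ℝ × ℝ) × ℝ) : Measurable (tetDet x) := by
  unfold tetDet; fun_prop

/-- The product over three points of a plane of the indicator function of `K`. -/
noncomputable def planeInd (K : Set ((ℝ × ℝ) × ℝ)) (h : Fin 3 → ℝ) (p : Fin 3 → ℝ × ℝ) : ℝ≥0∞ :=
  (Set.univ.pi fun _ : Fin 3 => planeSec K h).indicator 1 p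

lemma measurable_planeInd {K : Set ((ℝ × ℝ) × ℝ)} (hK : MeasurableSet K) :
    Measurable fun z : (Fin 3 → ℝ) × (Fin 3 → ℝ × ℝ) => planeInd K z.1 z.2 := by
  have h : Measurable fun z : (Fin 3 → ℝ) × (Fin 3 → ℝ × ℝ) => fun i => planePt z.1 (z.2 i) := by
    unfold planePt; fun_prop
  exact measurable_one.indicator (h (MeasurableSet.univ_pi fun _ : Fin 3 => hK))

/-- The integrand describing, after rescaling the height of the fourth point by `m`, the
contribution of a plane `h`, three points of it, and a fourth point. -/
noncomputable def chartFun (K : Set ((ℝ × ℝ) × ℝ)) (w : (Fin 3 → ℝ) → ℝ≥0∞) (φ : ℝ → ℝ → ℝ≥0∞)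
    (a : ℝ) (ω : (Fin 3 → ℝ) × (Fin 3 → ℝ × ℝ) × (ℝ × ℝ) × ℝ) : ℝ≥0∞ :=
  w ω.1 * (planeInd K ω.1 ω.2.1 * (‖triDet ω.2.1‖ₑ *
    (K.indicator 1 (ω.2.2.1, (planePt ω.1 ω.2.2.1).2 + a * ω.2.2.2) *
      φ (triDet ω.2.1) ω.2.2.2)))

lemma measurable_chartFun {K : Set ((ℝ × ℝ) × ℝ)} (hK : MeasurableSet K)
    {w : (Fin 3 → ℝ) → ℝ≥0∞} (hw : Measurable w) {φ : ℝ → ℝ → ℝ≥0∞}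
    (hφ : Measurable fun z : ℝ × ℝ => φ z.1 z.2) (a : ℝ) : Measurable (chartFun K w φ a) := by
  have h1 : Measurable fun ω : (Fin 3 → ℝ) × (Fin 3 → ℝ × ℝ) × (ℝ × ℝ) × ℝ =>
      (ω.1, ω.2.1) := by fun_prop
  have h2 : Measurable fun ω : (Fin 3 → ℝ) × (Fin 3 → ℝ × ℝ) × (ℝ × ℝ) × ℝ =>
      (ω.2.2.1, (planePt ω.1 ω.2.2.1).2 + a * ω.2.2.2) := by unfold planePt; fun_prop
  have h3 : Measurable fun ω : (Fin 3 → ℝ) × (Fin 3 → ℝ × ℝ) × (ℝ × ℝ) × ℝ => triDet ω.2.1 :=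
    measurable_triDet.comp (by fun_prop)
  have h4 : Measurable fun ω : (Fin 3 → ℝ) × (Fin 3 → ℝ × ℝ) × (ℝ × ℝ) × ℝ =>
      (triDet ω.2.1, ω.2.2.2) := h3.prodMk (by fun_prop)
  have h5 : Measurable (K.indicator (1 : (ℝ × ℝ) × ℝ → ℝ≥0∞)) := measurable_one.indicator hK
  exact (hw.comp measurable_fst).mul (((measurable_planeInd hK).comp h1).mul
    (h3.enorm.mul ((h5.comp h2).mul (hφ.comp h4))))

lemma lintegral_chartFun {K : Set ((ℝ × ℝ) × ℝ)} (hK : MeasurableSet K)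
    {w : (Fin 3 → ℝ) → ℝ≥0∞} (hw : Measurable w) {φ : ℝ → ℝ → ℝ≥0∞}
    (hφ : Measurable fun z : ℝ × ℝ => φ z.1 z.2) (a : ℝ) :
    ∫⁻ ω, chartFun K w φ a ω = ∫⁻ h, ∫⁻ p in Set.univ.pi fun _ : Fin 3 => planeSec K h,
      ‖triDet p‖ₑ * (w h * ∫⁻ q, ∫⁻ r,
        K.indicator 1 (q, (planePt h q).2 + a * r) * φ (triDet p) r) := by
  have hF := measurable_chartFun hK hw hφ a
  have h5 : Measurable (K.indicator (1 : (ℝ × ℝ) × ℝ → ℝ≥0∞)) := measurable_one.indicator hK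
  rw [lintegral_prod_volume hF]
  refine lintegral_congr fun h => ?_
  have hF1 : Measurable fun ω => chartFun K w φ a (h, ω) := hF.comp measurable_prodMk_left
  rw [lintegral_prod_volume hF1,
    ← lintegral_indicator (MeasurableSet.univ_pi fun _ => measurableSet_planeSec hK h)]
  refine lintegral_congr fun p => ?_
  have hm : Measurable fun z : (ℝ × ℝ) × ℝ =>
      K.indicator 1 (z.1, (planePt h z.1).2 + a * z.2) * φ (triDet p) z.2 := by
    refine (h5.comp ?_).mul (hφ.comp (by fun_prop : Measurable fun z : (ℝ × ℝ) × ℝ =>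
      (triDet p, z.2)))
    unfold planePt; fun_prop
  have hm2 := lintegral_prod_volume hm
  by_cases hp : p ∈ Set.univ.pi fun _ : Fin 3 => planeSec K h
  · rw [Set.indicator_of_mem hp, ← hm2]
    simp only [chartFun, planeInd, Set.indicator_of_mem hp, Pi.one_apply, one_mul]
    rw [lintegral_const_mul _ (hm.const_mul _), lintegral_const_mul _ hm, mul_left_comm]
  · rw [Set.indicator_of_notMem hp]
    simp only [chartFun, planeInd, Set.indicator_of_notMem hp, zero_mul, mul_zero, lintegral_zero]

lemma lintegral_chartFun_pow {K : Set ((ℝ × ℝ) × ℝ)} (hK : MeasurableSet K)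
    {W : (Fin 3 → (ℝ × ℝ) × ℝ) → ℝ≥0∞} (hW : Measurable W) {w : (Fin 3 → ℝ) → ℝ≥0∞}
    (hw : Measurable w)
    (hWw : ∀ h p, triDet p ≠ 0 → W (fun i => planePt h (p i)) = w h) {m : ℕ} (hm : m ≠ 0) :
    m * ∫⁻ x in Set.univ.pi (fun _ : Fin 3 => K),
      W x * ∫⁻ z in K, missPow m (tetDet x z) =
    ∫⁻ ω, chartFun K w
      (fun t r => missPow m (t * ((m : ℝ)⁻¹ * r))) (m : ℝ)⁻¹ ω := by
  have hm0 : (m : ℝ)⁻¹ ≠ 0 := by positivity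
  have hmm : (m : ℝ≥0∞) * ‖(m : ℝ)⁻¹‖ₑ = 1 := by
    rw [Real.enorm_eq_ofReal_abs, abs_of_nonneg (by positivity), ← ENNReal.ofReal_natCast,
      ← ENNReal.ofReal_mul (by positivity), mul_inv_cancel₀ (by positivity), ENNReal.ofReal_one]
  have hφ : Measurable fun z : ℝ × ℝ =>
    missPow m (z.1 * ((m : ℝ)⁻¹ * z.2)) :=
    (measurable_missPow m).comp (by fun_prop)
  have hT : Measurable fun z : (Fin 3 → (ℝ × ℝ) × ℝ) × ((ℝ × ℝ) × ℝ) =>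
      missPow m (tetDet z.1 z.2) :=
    (measurable_missPow m).comp measurable_tetDet
  have h5 : Measurable (K.indicator (1 : (ℝ × ℝ) × ℝ → ℝ≥0∞)) := measurable_one.indicator hK
  have hg : Measurable fun x => W x * ∫⁻ z in K, missPow m (tetDet x z) :=
    hW.mul hT.lintegral_prod_right'
  have hz : ∀ h p, (m : ℝ≥0∞) * ∫⁻ z in K,
      missPow m (tetDet (fun i => planePt h (p i)) z) =
      ∫⁻ q, ∫⁻ r, K.indicator 1 (q, (planePt h q).2 + (m : ℝ)⁻¹ * r) *
        missPow m (triDet p * ((m : ℝ)⁻¹ * r)) := by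
    intro h p
    have hT1 : Measurable fun z =>
        missPow m (tetDet (fun i => planePt h (p i)) z) :=
      (measurable_missPow m).comp (measurable_tetDet_right _)
    have hind := hT1.indicator hK
    rw [← lintegral_indicator hK, lintegral_prod_volume hind,
      ← lintegral_const_mul _ hind.lintegral_prod_right']
    refine lintegral_congr fun q => ?_
    have hq : Measurable fun t : ℝ => K.indicator (fun z =>
        missPow m (tetDet (fun i => planePt h (p i)) z)) (q, t) :=
      hind.comp measurable_prodMk_left
    rw [← lintegral_comp_add_mul hq (planePt h q).2 hm0, ← mul_assoc, hmm, one_mul]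
    refine lintegral_congr fun r => ?_
    by_cases hr : (q, (planePt h q).2 + (m : ℝ)⁻¹ * r) ∈ K
    · rw [Set.indicator_of_mem hr, Set.indicator_of_mem hr, tetDet_planePt, Pi.one_apply, one_mul]
    · rw [Set.indicator_of_notMem hr, Set.indicator_of_notMem hr, zero_mul]
  rw [lintegral_chartFun hK hw hφ, setLIntegral_triple_eq hK hg]
  have hout : Measurable fun z : (Fin 3 → ℝ) × (Fin 3 → ℝ × ℝ) => planeInd K z.1 z.2 *
      (‖triDet z.2‖ₑ * (W (fun i => planePt z.1 (z.2 i)) * ∫⁻ z' in K,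
        missPow m (tetDet (fun i => planePt z.1 (z.2 i)) z'))) := by
    have h6 : Measurable fun z : (Fin 3 → ℝ) × (Fin 3 → ℝ × ℝ) =>
        fun i => planePt z.1 (z.2 i) := by
      unfold planePt; fun_prop
    exact (measurable_planeInd hK).mul ((measurable_triDet.comp measurable_snd).enorm.mul
      (hg.comp h6))
  have hpi : ∀ h, MeasurableSet (Set.univ.pi fun _ : Fin 3 => planeSec K h) := fun h =>
    MeasurableSet.univ_pi fun _ => measurableSet_planeSec hK h
  have hset : ∀ h, ∫⁻ p in Set.univ.pi (fun _ : Fin 3 => planeSec K h), ‖triDet p‖ₑ *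
      (W (fun i => planePt h (p i)) * ∫⁻ z' in K,
        missPow m (tetDet (fun i => planePt h (p i)) z')) =
      ∫⁻ p, planeInd K h p * (‖triDet p‖ₑ * (W (fun i => planePt h (p i)) * ∫⁻ z' in K,
        missPow m (tetDet (fun i => planePt h (p i)) z'))) := by
    intro h
    rw [← lintegral_indicator (hpi h)]
    refine lintegral_congr fun p => ?_
    by_cases hp : p ∈ Set.univ.pi fun _ : Fin 3 => planeSec K h
    · simp only [planeInd, Set.indicator_of_mem hp, Pi.one_apply, one_mul]
    · simp only [planeInd, Set.indicator_of_notMem hp, zero_mul]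
  have hmeas : Measurable fun h => ∫⁻ p in Set.univ.pi (fun _ : Fin 3 => planeSec K h),
      ‖triDet p‖ₑ * (W (fun i => planePt h (p i)) * ∫⁻ z' in K,
        missPow m (tetDet (fun i => planePt h (p i)) z')) := by
    rw [funext hset]
    exact hout.lintegral_prod_right'
  refine (lintegral_const_mul _ hmeas).symm.trans (lintegral_congr fun h => ?_)
  have h6 : Measurable fun p : Fin 3 → ℝ × ℝ => fun i => planePt h (p i) := by
    unfold planePt; fun_prop
  refine (lintegral_const_mul _ (measurable_triDet.enorm.mul (hg.comp h6))).symm.trans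
    (setLIntegral_congr_fun_ae (hpi h) ?_)
  filter_upwards [ae_triDet_ne_zero] with p hp _
  simp only [Pi.mul_apply, Function.comp_apply]
  rw [← hz h p, hWw h p hp]
  ring

/-- The limit of the rescaled hitting weight. -/
noncomputable def missExp (t r : ℝ) : ℝ≥0∞ := ENNReal.ofReal (Real.exp (-(|t * r| / 6)))

lemma measurable_missExp : Measurable fun z : ℝ × ℝ => missExp z.1 z.2 := by
  unfold missExp; fun_prop

lemma lintegral_chartFun_exp {K : Set ((ℝ × ℝ) × ℝ)} (hK : MeasurableSet K)
    {w : (Fin 3 → ℝ) → ℝ≥0∞} (hw : Measurable w) :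
    ∫⁻ ω, chartFun K w missExp 0 ω = ∫⁻ h, w h * (12 * volume (planeSec K h) ^ 4) := by
  rw [lintegral_chartFun hK hw measurable_missExp]
  refine lintegral_congr fun h => ?_
  have hD := measurableSet_planeSec hK h
  have hin : ∀ t : ℝ, ∫⁻ q, ∫⁻ r, K.indicator 1 (q, (planePt h q).2 + 0 * r) * missExp t r =
      volume (planeSec K h) * ∫⁻ r, missExp t r := by
    intro t
    have hm : Measurable fun r => missExp t r := by unfold missExp; fun_prop
    rw [← lintegral_indicator_one hD, ← lintegral_mul_const _ (measurable_one.indicator hD)]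
    refine lintegral_congr fun q => ?_
    simp only [zero_mul, add_zero]
    exact lintegral_const_mul _ hm
  have hpi : MeasurableSet (Set.univ.pi fun _ : Fin 3 => planeSec K h) :=
    MeasurableSet.univ_pi fun _ => hD
  have hcongr : ∫⁻ p in Set.univ.pi (fun _ : Fin 3 => planeSec K h), ‖triDet p‖ₑ * (w h *
      ∫⁻ q, ∫⁻ r, K.indicator 1 (q, (planePt h q).2 + 0 * r) * missExp (triDet p) r) =
      ∫⁻ _ in Set.univ.pi (fun _ : Fin 3 => planeSec K h), w h * (12 * volume (planeSec K h)) := by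
    refine setLIntegral_congr_fun_ae hpi ?_
    filter_upwards [ae_triDet_ne_zero] with p hp _
    rw [hin, ← enorm_mul_lintegral_exp hp]
    simp only [missExp]
    ring
  rw [hcongr, setLIntegral_const, volume_pi_pi, Finset.prod_const, Finset.card_univ,
    Fintype.card_fin]
  ring

lemma chartFun_le {K : Set ((ℝ × ℝ) × ℝ)} {R : ℝ} (hR : ∀ z ∈ K, ‖z‖ ≤ R)
    {w : (Fin 3 → ℝ) → ℝ≥0∞} (hw1 : ∀ h, w h ≤ 1) (hw0 : ∀ h, w h ≠ 0 → |h 0| ≤ 1 ∧ |h 1| ≤ 1)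
    {φ : ℝ → ℝ → ℝ≥0∞} (hφ : ∀ t r, φ t r ≤ missExp t r) (a : ℝ)
    (ω : (Fin 3 → ℝ) × (Fin 3 → ℝ × ℝ) × (ℝ × ℝ) × ℝ) :
    chartFun K w φ a ω ≤ chartFun (Metric.closedBall 0 R ×ˢ Set.univ)
      ((Metric.closedBall 0 (3 * R + 1)).indicator 1) missExp 0 ω := by
  obtain ⟨h, p, q, r⟩ := ω
  simp only [chartFun]
  by_cases hwh : w h = 0
  · simp [hwh]
  by_cases hp : p ∈ Set.univ.pi fun _ : Fin 3 => planeSec K h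
  swap
  · simp [planeInd, Set.indicator_of_notMem hp]
  by_cases hq : (q, (planePt h q).2 + a * r) ∈ K
  swap
  · simp [Set.indicator_of_notMem hq]
  have hK1 : ∀ z ∈ K, z.1 ∈ Metric.closedBall (0 : ℝ × ℝ) R := fun z hz =>
    mem_closedBall_zero_iff.2 ((norm_fst_le z).trans (hR z hz))
  have hp0 := hR _ (hp 0 (Set.mem_univ _))
  have h1 : |(p 0).1| ≤ R := (norm_fst_le (p 0)).trans ((norm_fst_le _).trans hp0)
  have h2 : |(p 0).2| ≤ R := (norm_snd_le (p 0)).trans ((norm_fst_le _).trans hp0)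
  have h3 : |h 0 * (p 0).1 + h 1 * (p 0).2 + h 2| ≤ R := (norm_snd_le _).trans hp0
  obtain ⟨ha, hb⟩ := hw0 h hwh
  have hR0 : 0 ≤ R := (abs_nonneg _).trans h1
  have h4 : |h 0 * (p 0).1| ≤ R := by
    rw [abs_mul]; exact (mul_le_of_le_one_left (abs_nonneg _) ha).trans h1
  have h5 : |h 1 * (p 0).2| ≤ R := by
    rw [abs_mul]; exact (mul_le_of_le_one_left (abs_nonneg _) hb).trans h2
  have hh : h ∈ Metric.closedBall (0 : Fin 3 → ℝ) (3 * R + 1) := by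
    rw [mem_closedBall_zero_iff, pi_norm_le_iff_of_nonneg (by linarith)]
    have h6 : |h 2| ≤ 3 * R + 1 := by
      rw [abs_le] at *
      constructor <;> linarith
    simp only [Fin.forall_fin_succ, Real.norm_eq_abs]
    exact ⟨by linarith, by simpa using by linarith, by simpa using h6, fun i => i.elim0⟩
  have hp' : p ∈ Set.univ.pi fun _ : Fin 3 =>
      planeSec (Metric.closedBall 0 R ×ˢ Set.univ) h := fun i hi =>
    ⟨hK1 _ (hp i hi), Set.mem_univ _⟩
  have hq' : (q, (planePt h q).2 + 0 * r) ∈ Metric.closedBall (0 : ℝ × ℝ) R ×ˢ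
      (Set.univ : Set ℝ) := ⟨hK1 (q, (planePt h q).2 + a * r) hq, Set.mem_univ _⟩
  simp only [planeInd, Set.indicator_of_mem hh, Set.indicator_of_mem hp,
    Set.indicator_of_mem hp', Set.indicator_of_mem hq, Set.indicator_of_mem hq', Pi.one_apply,
    one_mul]
  calc w h * (‖triDet p‖ₑ * φ (triDet p) r) ≤ 1 * (‖triDet p‖ₑ * missExp (triDet p) r) := by
        gcongr
        · exact hw1 h
        · exact hφ _ _
    _ = _ := one_mul _

theorem tendsto_chart {K : Set ((ℝ × ℝ) × ℝ)} (hc : IsCompact K) (hconv : Convex ℝ K)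
    {W : (Fin 3 → (ℝ × ℝ) × ℝ) → ℝ≥0∞} (hW : Measurable W) {w : (Fin 3 → ℝ) → ℝ≥0∞}
    (hw : Measurable w) (hw1 : ∀ h, w h ≤ 1) (hw0 : ∀ h, w h ≠ 0 → |h 0| ≤ 1 ∧ |h 1| ≤ 1)
    (hWw : ∀ h p, triDet p ≠ 0 → W (fun i => planePt h (p i)) = w h) :
    Tendsto (fun m : ℕ => m * ∫⁻ x in Set.univ.pi (fun _ : Fin 3 => K),
      W x * ∫⁻ z in K, missPow m (tetDet x z)) atTop
      (nhds (∫⁻ h, w h * (12 * volume (planeSec K h) ^ 4))) := by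
  have hK := hc.measurableSet
  have hφ : ∀ m : ℕ, Measurable fun z : ℝ × ℝ => missPow m (z.1 * ((m : ℝ)⁻¹ * z.2)) := fun m =>
    (measurable_missPow m).comp (by fun_prop)
  have key : Tendsto (fun m : ℕ => ∫⁻ ω, chartFun K w
      (fun t r => missPow m (t * ((m : ℝ)⁻¹ * r))) (m : ℝ)⁻¹ ω) atTop
      (nhds (∫⁻ ω, chartFun K w missExp 0 ω)) := by
    obtain ⟨R, hR⟩ := hc.isBounded.exists_norm_le
    refine tendsto_lintegral_filter_of_dominated_convergence
      (chartFun (Metric.closedBall 0 R ×ˢ Set.univ)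
      ((Metric.closedBall 0 (3 * R + 1)).indicator 1) missExp 0) ?_ ?_ ?_ ?_
    · exact Eventually.of_forall fun m => measurable_chartFun hK hw (hφ m) _
    · filter_upwards [eventually_ne_atTop 0] with m hm
      exact Eventually.of_forall fun ω =>
        chartFun_le hR hw1 hw0 (fun t r => ofReal_one_sub_pow_le t r hm) _ ω
    · rw [lintegral_chartFun_exp (Metric.isClosed_closedBall.measurableSet.prod MeasurableSet.univ)
        (measurable_one.indicator Metric.isClosed_closedBall.measurableSet)]
      have h1 : ∀ h, planeSec (Metric.closedBall 0 R ×ˢ Set.univ) h =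
          Metric.closedBall (0 : ℝ × ℝ) R := fun h => by ext q; simp [planeSec]
      simp only [h1]
      rw [lintegral_mul_const _ (measurable_one.indicator
        Metric.isClosed_closedBall.measurableSet),
        lintegral_indicator_one Metric.isClosed_closedBall.measurableSet]
      exact ENNReal.mul_ne_top measure_closedBall_lt_top.ne
        (ENNReal.mul_ne_top (by norm_num) (ENNReal.pow_ne_top measure_closedBall_lt_top.ne))
    · have hH2 : (volume : Measure (ℝ × ℝ)).IsAddHaarMeasure :=
        Measure.prod.instIsAddHaarMeasure volume volume
      have hH3 : (volume : Measure ((ℝ × ℝ) × ℝ)).IsAddHaarMeasure :=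
        Measure.prod.instIsAddHaarMeasure volume volume
      have hF := ae_planePt_notMem (isClosed_frontier (s := K)).measurableSet
        (hconv.addHaar_frontier volume)
      have hset : MeasurableSet {z : (Fin 3 → ℝ) × (ℝ × ℝ) | planePt z.1 z.2 ∉ frontier K} :=
        (measurable_planePt isClosed_frontier.measurableSet).compl
      have hF2 : ∀ᵐ ω : (Fin 3 → ℝ) × (Fin 3 → ℝ × ℝ) × (ℝ × ℝ) × ℝ,
          planePt ω.1 ω.2.2.1 ∉ frontier K := by
        have hmeas : Measurable fun ω : (Fin 3 → ℝ) × (Fin 3 → ℝ × ℝ) × (ℝ × ℝ) × ℝ =>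
          (ω.1, ω.2.2.1) := by fun_prop
        refine (Measure.ae_prod_iff_ae_ae (hmeas hset)).2 ?_
        filter_upwards [hF] with h hh
        have e1 : ∀ᵐ z : (ℝ × ℝ) × ℝ, planePt h z.1 ∉ frontier K :=
          Measure.quasiMeasurePreserving_fst.ae hh
        exact Measure.quasiMeasurePreserving_snd.ae e1
      filter_upwards [hF2] with ω hω
      obtain ⟨h, p, q, r⟩ := ω
      have hind : ∀ᶠ m : ℕ in atTop, K.indicator (1 : (ℝ × ℝ) × ℝ → ℝ≥0∞)
          (q, (planePt h q).2 + (m : ℝ)⁻¹ * r) = K.indicator 1 (q, (planePt h q).2 + 0 * r) := by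
        have hlim : Tendsto (fun m : ℕ => (q, (planePt h q).2 + (m : ℝ)⁻¹ * r)) atTop
            (nhds (planePt h q)) := by
          have : Tendsto (fun m : ℕ => (planePt h q).2 + (m : ℝ)⁻¹ * r) atTop
              (nhds ((planePt h q).2 + 0 * r)) :=
            ((tendsto_natCast_atTop_atTop.inv_tendsto_atTop).mul_const r).const_add _
          rw [zero_mul, add_zero] at this
          exact tendsto_const_nhds.prodMk_nhds this
        rw [zero_mul, add_zero]
        by_cases hin : planePt h q ∈ K
        · have hi : planePt h q ∈ interior K := by
            by_contra hni
            exact hω ⟨subset_closure hin, hni⟩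
          filter_upwards [hlim.eventually (isOpen_interior.mem_nhds hi)] with m hm
          rw [Set.indicator_of_mem (interior_subset hm)]
          exact (Set.indicator_of_mem hin (1 : (ℝ × ℝ) × ℝ → ℝ≥0∞)).symm
        · filter_upwards [hlim.eventually (hc.isClosed.isOpen_compl.mem_nhds hin)] with m hm
          rw [Set.indicator_of_notMem hm]
          exact (Set.indicator_of_notMem hin _).symm
      have hlim := tendsto_ofReal_one_sub_pow (triDet p) r
      have hfin1 : w h ≠ ∞ := ne_top_of_le_ne_top ENNReal.one_ne_top (hw1 h)
      have hfin2 : planeInd K h p ≠ ∞ := ne_top_of_le_ne_top ENNReal.one_ne_top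
        (Set.indicator_le_self _ _ _)
      have hfin3 : K.indicator (1 : (ℝ × ℝ) × ℝ → ℝ≥0∞) (q, (planePt h q).2 + 0 * r) ≠ ∞ :=
        ne_top_of_le_ne_top ENNReal.one_ne_top (Set.indicator_le_self _ _ _)
      have := ENNReal.Tendsto.const_mul (ENNReal.Tendsto.const_mul (ENNReal.Tendsto.const_mul
        (ENNReal.Tendsto.const_mul hlim (Or.inr hfin3)) (Or.inr (enorm_ne_top (x := triDet p))))
        (Or.inr hfin2)) (Or.inr hfin1)
      refine this.congr' ?_
      filter_upwards [hind] with m hm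
      simp only [chartFun, hm, missPow]
  rw [lintegral_chartFun_exp hK hw] at key
  refine key.congr' ?_
  filter_upwards [eventually_ne_atTop 0] with m hm
  exact (lintegral_chartFun_pow hK hW hw hWw hm).symm

lemma isCompact_planeSec {K : Set ((ℝ × ℝ) × ℝ)} (hc : IsCompact K) (h : Fin 3 → ℝ) :
    IsCompact (planeSec K h) := by
  refine (hc.image continuous_fst).of_isClosed_subset ?_ fun p hp => ⟨_, hp, rfl⟩
  exact hc.isClosed.preimage
    (by fun_prop : Continuous fun p : ℝ × ℝ => (p, h 0 * p.1 + h 1 * p.2 + h 2))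

lemma convex_planeSec {K : Set ((ℝ × ℝ) × ℝ)} (hconv : Convex ℝ K) (h : Fin 3 → ℝ) :
    Convex ℝ (planeSec K h) := by
  intro p hp q hq a b ha hb hab
  have := hconv hp hq ha hb hab
  simp only [planeSec, Set.mem_ofPred_eq]
  convert this using 1
  refine Prod.ext rfl ?_
  simp only [Prod.snd_add, Prod.smul_snd, Prod.fst_add, Prod.smul_fst, smul_eq_mul]
  linear_combination (-h 2) * hab

/-- The cross product of the edge vectors of the triangle `x 0`, `x 1`, `x 2`. -/
def triNormal (x : Fin 3 → (ℝ × ℝ) × ℝ) : (ℝ × ℝ) × ℝ :=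
  ((((x 1).1.2 - (x 0).1.2) * ((x 2).2 - (x 0).2) - ((x 2).1.2 - (x 0).1.2) * ((x 1).2 - (x 0).2),
    ((x 1).2 - (x 0).2) * ((x 2).1.1 - (x 0).1.1) - ((x 2).2 - (x 0).2) * ((x 1).1.1 - (x 0).1.1)),
    triDet fun i => (x i).1)

lemma measurable_triNormal : Measurable triNormal := by
  unfold triNormal triDet; fun_prop

lemma triNormal_planePt (h : Fin 3 → ℝ) (p : Fin 3 → ℝ × ℝ) :
    triNormal (fun i => planePt h (p i)) = triDet p • ((-h 0, -h 1), 1) := by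
  simp only [triNormal, planePt, triDet, Prod.smul_mk, smul_eq_mul]
  refine Prod.ext (Prod.ext ?_ ?_) ?_ <;> simp only <;> ring

/-- A cone of normal directions close to the third coordinate axis. -/
structure IsNormalCone (S : Set ((ℝ × ℝ) × ℝ)) : Prop where
  measurableSet : MeasurableSet S
  smul_mem_iff : ∀ (t : ℝ) (v : (ℝ × ℝ) × ℝ), t ≠ 0 → (t • v ∈ S ↔ v ∈ S)
  abs_le : ∀ v ∈ S, |v.1.1| ≤ |v.2| ∧ |v.1.2| ≤ |v.2|

theorem exists_tendsto_chart {K : Set ((ℝ × ℝ) × ℝ)} (hc : IsCompact K) (hconv : Convex ℝ K)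
    {S : Set ((ℝ × ℝ) × ℝ)} (hS : IsNormalCone S) :
    ∃ L : ℝ≥0∞, Tendsto (fun m : ℕ => m * ∫⁻ x in Set.univ.pi (fun _ : Fin 3 => K),
      S.indicator 1 (triNormal x) * ∫⁻ z in K, missPow m (tetDet x z)) atTop (nhds L) ∧
      72 * (∫⁻ x in Set.univ.pi (fun _ : Fin 3 => K), S.indicator 1 (triNormal x)) ≤ L ∧
      L ≤ ENNReal.ofReal (288 * Real.pi ^ 2 / 35) *
        ∫⁻ x in Set.univ.pi (fun _ : Fin 3 => K), S.indicator 1 (triNormal x) := by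
  have h1 : Measurable (S.indicator (1 : (ℝ × ℝ) × ℝ → ℝ≥0∞)) :=
    measurable_one.indicator hS.measurableSet
  have hW : Measurable fun x => S.indicator (1 : (ℝ × ℝ) × ℝ → ℝ≥0∞) (triNormal x) :=
    h1.comp measurable_triNormal
  set w : (Fin 3 → ℝ) → ℝ≥0∞ := fun h => S.indicator 1 ((-h 0, -h 1), 1) with hwdef
  have hw : Measurable w :=
    h1.comp (by fun_prop : Measurable fun h : Fin 3 → ℝ => ((-h 0, -h 1), (1 : ℝ)))
  have hw1 : ∀ h, w h ≤ 1 := fun h => Set.indicator_le_self _ _ _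
  have hw0 : ∀ h, w h ≠ 0 → |h 0| ≤ 1 ∧ |h 1| ≤ 1 := fun h hh => by
    simpa using hS.abs_le _ (Set.mem_of_indicator_ne_zero hh)
  have hWw : ∀ h p, triDet p ≠ 0 →
      S.indicator (1 : (ℝ × ℝ) × ℝ → ℝ≥0∞) (triNormal fun i => planePt h (p i)) = w h := by
    intro h p hp
    rw [triNormal_planePt, hwdef]
    by_cases hm : ((-h 0, -h 1), (1 : ℝ)) ∈ S
    · simp only [Set.indicator_of_mem hm, Set.indicator_of_mem ((hS.smul_mem_iff _ _ hp).2 hm)]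
      rfl
    · simp only [Set.indicator_of_notMem hm,
        Set.indicator_of_notMem (mt (hS.smul_mem_iff _ _ hp).1 hm)]
  have hinter : ∫⁻ x in Set.univ.pi (fun _ : Fin 3 => K), S.indicator 1 (triNormal x) =
      ∫⁻ h, w h * triInt (planeSec K h) := by
    rw [setLIntegral_triple_eq hc.measurableSet hW]
    refine lintegral_congr fun h => ?_
    rw [triInt, ← lintegral_const_mul _ measurable_triDet.enorm]
    refine setLIntegral_congr_fun_ae
      (MeasurableSet.univ_pi fun _ => measurableSet_planeSec hc.measurableSet h) ?_
    filter_upwards [ae_triDet_ne_zero] with p hp _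
    rw [mul_comm]
    exact congrArg (· * _) (hWw h p hp)
  refine ⟨_, tendsto_chart hc hconv hW hw hw1 hw0 hWw, ?_, ?_⟩
  · rw [hinter, ← lintegral_const_mul' _ _ (by norm_num)]
    refine lintegral_mono fun h => ?_
    rw [mul_left_comm]
    refine mul_le_mul' le_rfl ?_
    calc 72 * triInt (planeSec K h) = 12 * (6 * triInt (planeSec K h)) := by
          rw [← mul_assoc]; norm_num
      _ ≤ _ := mul_le_mul_right
        (six_mul_triInt_le (isCompact_planeSec hc h) (convex_planeSec hconv h)) _
  · rw [hinter, ← lintegral_const_mul' _ _ ENNReal.ofReal_ne_top]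
    refine lintegral_mono fun h => ?_
    rw [mul_left_comm (ENNReal.ofReal _)]
    refine mul_le_mul' le_rfl ?_
    refine le_trans ?_ (mul_le_mul' le_rfl
      (le_triInt (isCompact_planeSec hc h) (convex_planeSec hconv h)))
    have hpi := Real.pi_pos
    rw [← mul_assoc, ← ENNReal.ofReal_mul (by positivity)]
    gcongr
    have : 288 * Real.pi ^ 2 / 35 * (35 / (24 * Real.pi ^ 2)) = 12 := by field_simp; norm_num
    rw [this]
    norm_num

/-- The coordinates of a point of space, the `i`-th one being listed last. -/
def coordChart (i : Fin 3) : Euc 3 →ₗ[ℝ] (ℝ × ℝ) × ℝ where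
  toFun v := ((v (i.succAbove 0), v (i.succAbove 1)), v i)
  map_add' _ _ := rfl
  map_smul' _ _ := rfl

lemma coordChart_apply (i : Fin 3) (v : Euc 3) :
    coordChart i v = ((v (i.succAbove 0), v (i.succAbove 1)), v i) := rfl

lemma continuous_coordChart (i : Fin 3) : Continuous (coordChart i) := by
  have : ⇑(coordChart i) = fun v => ((v (i.succAbove 0), v (i.succAbove 1)), v i) := rfl
  rw [this]
  fun_prop

lemma injective_coordChart (i : Fin 3) : Function.Injective (coordChart i) := by
  intro v v' h
  simp only [coordChart_apply, Prod.mk.injEq] at h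
  ext j
  refine Fin.succAboveCases i h.2 (fun k => ?_) j
  fin_cases k
  exacts [h.1.1, h.1.2]

lemma measurePreserving_coordChart (i : Fin 3) : MeasurePreserving (coordChart i) volume volume := by
  have h1 := volume_preserving_piFinSuccAbove (fun _ : Fin 3 => ℝ) i
  have h2 := (MeasurePreserving.id (volume : Measure ℝ)).prod (volume_preserving_finTwoArrow ℝ)
  have h3 := Measure.measurePreserving_swap (μ := (volume : Measure ℝ))
    (ν := (volume : Measure (ℝ × ℝ)))
  exact h3.comp (h2.comp (h1.comp (PiLp.volume_preserving_ofLp (Fin 3))))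

/-- Six times the volume of the tetrahedron with vertices `x 0`, `x 1`, `x 2`, `z`. -/
def eucDet (x : Fin 3 → Euc 3) (z : Euc 3) : ℝ :=
  tetDet (fun j => coordChart 0 (x j)) (coordChart 0 z)

lemma abs_tetDet_coordChart (i : Fin 3) (x : Fin 3 → Euc 3) (z : Euc 3) :
    |tetDet (fun j => coordChart i (x j)) (coordChart i z)| = |eucDet x z| := by
  unfold eucDet
  fin_cases i
  · rfl
  · rw [← abs_neg]
    congr 1
    simp [tetDet, triDet, coordChart_apply, Fin.succAbove]
    ring
  · congr 1
    simp [tetDet, triDet, coordChart_apply, Fin.succAbove]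
    ring

lemma missPow_abs (m : ℕ) (v : ℝ) : missPow m |v| = missPow m v := by
  simp [missPow]

lemma exists_tendsto_coordChart {K : Set (Euc 3)} (hc : IsCompact K) (hconv : Convex ℝ K)
    (i : Fin 3) {S : Set ((ℝ × ℝ) × ℝ)} (hS : IsNormalCone S) :
    ∃ L : ℝ≥0∞, Tendsto (fun m : ℕ => m * ∫⁻ x in Set.univ.pi (fun _ : Fin 3 => K),
      S.indicator 1 (triNormal fun j => coordChart i (x j)) *
        ∫⁻ z in K, missPow m (eucDet x z)) atTop (nhds L) ∧
      72 * (∫⁻ x in Set.univ.pi (fun _ : Fin 3 => K),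
        S.indicator 1 (triNormal fun j => coordChart i (x j))) ≤ L ∧
      L ≤ ENNReal.ofReal (288 * Real.pi ^ 2 / 35) *
        ∫⁻ x in Set.univ.pi (fun _ : Fin 3 => K),
          S.indicator 1 (triNormal fun j => coordChart i (x j)) := by
  set K' := coordChart i '' K
  have hc' : IsCompact K' := hc.image (continuous_coordChart i)
  have hpre : coordChart i ⁻¹' K' = K := (injective_coordChart i).preimage_image K
  have hmp := measurePreserving_coordChart i
  have hmp3 := volume_preserving_pi fun _ : Fin 3 => hmp
  have hpi : (fun (x : Fin 3 → Euc 3) (j : Fin 3) => coordChart i (x j)) ⁻¹'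
      (Set.univ.pi fun _ => K') = Set.univ.pi fun _ => K := by
    ext x
    simp only [Set.mem_preimage, Set.mem_univ_pi]
    exact forall_congr' fun j => by rw [← Set.mem_preimage, hpre]
  have hms : MeasurableSet (Set.univ.pi fun _ : Fin 3 => K') :=
    MeasurableSet.univ_pi fun _ => hc'.measurableSet
  have h1 : Measurable (S.indicator (1 : (ℝ × ℝ) × ℝ → ℝ≥0∞)) :=
    measurable_one.indicator hS.measurableSet
  have hW : Measurable fun x => S.indicator (1 : (ℝ × ℝ) × ℝ → ℝ≥0∞) (triNormal x) :=
    h1.comp measurable_triNormal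
  have hT : ∀ m, Measurable fun z : (Fin 3 → (ℝ × ℝ) × ℝ) × ((ℝ × ℝ) × ℝ) =>
      missPow m (tetDet z.1 z.2) := fun m => (measurable_missPow m).comp measurable_tetDet
  have e1 : ∫⁻ x in Set.univ.pi (fun _ : Fin 3 => K'), S.indicator 1 (triNormal x) =
      ∫⁻ x in Set.univ.pi (fun _ : Fin 3 => K),
        S.indicator 1 (triNormal fun j => coordChart i (x j)) := by
    rw [← hmp3.setLIntegral_comp_preimage hms hW, hpi]
  have e2 : ∀ (m : ℕ) (x : Fin 3 → Euc 3),
      ∫⁻ z in K', missPow m (tetDet (fun j => coordChart i (x j)) z) =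
      ∫⁻ z in K, missPow m (eucDet x z) := by
    intro m x
    have hm : Measurable fun z => missPow m (tetDet (fun j => coordChart i (x j)) z) :=
      (measurable_missPow m).comp (measurable_tetDet_right _)
    rw [← hmp.setLIntegral_comp_preimage hc'.measurableSet hm, hpre]
    refine lintegral_congr fun z => ?_
    rw [← missPow_abs, abs_tetDet_coordChart, missPow_abs]
  have e3 : ∀ m : ℕ, ∫⁻ x in Set.univ.pi (fun _ : Fin 3 => K'), S.indicator 1 (triNormal x) *
      ∫⁻ z in K', missPow m (tetDet x z) = ∫⁻ x in Set.univ.pi (fun _ : Fin 3 => K),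
      S.indicator 1 (triNormal fun j => coordChart i (x j)) *
        ∫⁻ z in K, missPow m (eucDet x z) := by
    intro m
    have hm : Measurable fun x => S.indicator 1 (triNormal x) *
      ∫⁻ z in K', missPow m (tetDet x z) := hW.mul (hT m).lintegral_prod_right'
    rw [← hmp3.setLIntegral_comp_preimage hms hm, hpi]
    simp only [e2]
  have := exists_tendsto_chart hc' (hconv.linear_image (coordChart i)) hS
  simpa only [e1, e3] using this

/-- Normals whose last coordinate dominates, with ties resolved according to `r` and `s`. -/
def domCone (r s : ℝ → ℝ → Prop) : Set ((ℝ × ℝ) × ℝ) :=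
  {v | r |v.1.1| |v.2| ∧ s |v.1.2| |v.2|}

lemma isNormalCone_domCone {r s : ℝ → ℝ → Prop}
    (hr : r = (· ≤ ·) ∨ r = (· < ·)) (hs : s = (· ≤ ·) ∨ s = (· < ·)) :
    IsNormalCone (domCone r s) where
  measurableSet := by
    have h1 : Measurable fun v : (ℝ × ℝ) × ℝ => |v.1.1| := by fun_prop
    have h2 : Measurable fun v : (ℝ × ℝ) × ℝ => |v.1.2| := by fun_prop
    have h3 : Measurable fun v : (ℝ × ℝ) × ℝ => |v.2| := by fun_prop
    rcases hr with rfl | rfl <;> rcases hs with rfl | rfl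
    · exact (measurableSet_le h1 h3).inter (measurableSet_le h2 h3)
    · exact (measurableSet_le h1 h3).inter (measurableSet_lt h2 h3)
    · exact (measurableSet_lt h1 h3).inter (measurableSet_le h2 h3)
    · exact (measurableSet_lt h1 h3).inter (measurableSet_lt h2 h3)
  smul_mem_iff t v ht := by
    have ht' := abs_pos.2 ht
    rcases hr with rfl | rfl <;> rcases hs with rfl | rfl <;>
    simp [domCone, abs_mul, ht']
  abs_le v hv := by
    rcases hr with rfl | rfl <;> rcases hs with rfl | rfl <;>
    simp only [domCone, Set.mem_ofPred_eq] at hv <;> exact ⟨by linarith, by linarith⟩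

lemma sum_domCone (x : Fin 3 → Euc 3) :
    (domCone (· ≤ ·) (· ≤ ·)).indicator (1 : (ℝ × ℝ) × ℝ → ℝ≥0∞)
        (triNormal fun j => coordChart 0 (x j)) +
      (domCone (· < ·) (· ≤ ·)).indicator 1 (triNormal fun j => coordChart 1 (x j)) +
      (domCone (· < ·) (· < ·)).indicator 1 (triNormal fun j => coordChart 2 (x j)) = 1 := by
  classical
  obtain ⟨a, b, c, h0, h1, h2⟩ : ∃ a b c : ℝ,
      triNormal (fun j => coordChart 0 (x j)) = ((b, c), a) ∧
      triNormal (fun j => coordChart 1 (x j)) = ((-a, -c), -b) ∧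
      triNormal (fun j => coordChart 2 (x j)) = ((a, b), c) := by
    refine ⟨_, _, _, rfl, ?_, ?_⟩ <;> refine Prod.ext (Prod.ext ?_ ?_) ?_ <;>
    simp [triNormal, triDet, coordChart_apply, Fin.succAbove] <;> ring
  rw [h0, h1, h2]
  simp only [Set.indicator_apply, domCone, Set.mem_ofPred_eq, abs_neg, Pi.one_apply]
  split_ifs <;> first | (exfalso; grind) | simp

lemma measurable_eucDet : Measurable fun z : (Fin 3 → Euc 3) × Euc 3 => eucDet z.1 z.2 := by
  simp only [eucDet, tetDet, triDet, coordChart_apply]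
  fun_prop

lemma lintegral_add_weights {α : Type*} [MeasurableSpace α] {μ : Measure α}
    {f₀ f₁ f₂ J : α → ℝ≥0∞} (h₀ : Measurable f₀) (h₁ : Measurable f₁) (hJ : Measurable J)
    (hsum : ∀ x, f₀ x + f₁ x + f₂ x = 1) :
    ∫⁻ x, f₀ x * J x ∂μ + ∫⁻ x, f₁ x * J x ∂μ + ∫⁻ x, f₂ x * J x ∂μ = ∫⁻ x, J x ∂μ := by
  have h01 : Measurable fun x => f₀ x * J x := h₀.mul hJ
  have h02 : Measurable fun x => f₀ x * J x + f₁ x * J x := h01.add (h₁.mul hJ)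
  rw [← lintegral_add_left h01, ← lintegral_add_left h02]
  simp only [← add_mul, hsum, one_mul]

theorem exists_tendsto_eucDet {K : Set (Euc 3)} (hc : IsCompact K) (hconv : Convex ℝ K)
    (hvol : volume K = 1) :
    ∃ L : ℝ≥0∞, Tendsto (fun m : ℕ => m * ∫⁻ x in Set.univ.pi (fun _ : Fin 3 => K),
      ∫⁻ z in K, missPow m (eucDet x z)) atTop (nhds L) ∧
      72 ≤ L ∧ L ≤ ENNReal.ofReal (288 * Real.pi ^ 2 / 35) := by
  have hS0 := isNormalCone_domCone (Or.inl rfl) (Or.inl rfl)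
  have hS1 := isNormalCone_domCone (Or.inr rfl) (Or.inl rfl)
  have hS2 := isNormalCone_domCone (Or.inr rfl) (Or.inr rfl)
  obtain ⟨L0, t0, l0, u0⟩ := exists_tendsto_coordChart hc hconv 0 hS0
  obtain ⟨L1, t1, l1, u1⟩ := exists_tendsto_coordChart hc hconv 1 hS1
  obtain ⟨L2, t2, l2, u2⟩ := exists_tendsto_coordChart hc hconv 2 hS2
  have hmeas : ∀ (i : Fin 3) {S : Set ((ℝ × ℝ) × ℝ)}, IsNormalCone S →
      Measurable fun x : Fin 3 → Euc 3 =>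
        S.indicator (1 : (ℝ × ℝ) × ℝ → ℝ≥0∞) (triNormal fun j => coordChart i (x j)) := by
    intro i S hS
    have hmp3 := volume_preserving_pi fun _ : Fin 3 => measurePreserving_coordChart i
    have h1 : Measurable (S.indicator (1 : (ℝ × ℝ) × ℝ → ℝ≥0∞)) :=
      measurable_one.indicator hS.measurableSet
    exact (h1.comp measurable_triNormal).comp hmp3.measurable
  have hsum := lintegral_add_weights
    (μ := (volume : Measure (Fin 3 → Euc 3)).restrict (Set.univ.pi fun _ => K))
    (hmeas 0 hS0) (hmeas 1 hS1) measurable_one sum_domCone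
  simp only [Pi.one_apply, mul_one, lintegral_one, Measure.restrict_apply_univ,
    volume_pi_pi, hvol, Finset.prod_const_one] at hsum
  refine ⟨L0 + L1 + L2, ((t0.add t1).add t2).congr fun m => ?_, ?_, ?_⟩
  · have hm : Measurable fun z : (Fin 3 → Euc 3) × Euc 3 => missPow m (eucDet z.1 z.2) :=
      (measurable_missPow m).comp measurable_eucDet
    have hJ : Measurable fun x : Fin 3 → Euc 3 => ∫⁻ z in K, missPow m (eucDet x z) :=
      hm.lintegral_prod_right'
    rw [← mul_add, ← mul_add]
    exact congrArg _ (lintegral_add_weights (hmeas 0 hS0) (hmeas 1 hS1) hJ sum_domCone)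
  · rw [← mul_one 72, ← hsum, mul_add, mul_add]
    exact add_le_add (add_le_add l0 l1) l2
  · rw [← mul_one (ENNReal.ofReal _), ← hsum, mul_add, mul_add]
    exact add_le_add (add_le_add u0 u1) u2

lemma volume_simplex (n : ℕ) : ∀ t : ℝ, 0 ≤ t →
    volume {w : Fin n → ℝ | (∀ i, 0 ≤ w i) ∧ ∑ i, w i ≤ t} =
      ENNReal.ofReal (t ^ n / n.factorial) := by
  induction n with
  | zero =>
    intro t ht
    have : {w : Fin 0 → ℝ | (∀ i, 0 ≤ w i) ∧ ∑ i, w i ≤ t} = Set.univ := by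
      ext w; simp [ht]
    rw [this]
    simp [volume_pi]
  | succ n ih =>
    intro t ht
    set A : Set (ℝ × (Fin n → ℝ)) :=
      {z | 0 ≤ z.1 ∧ (∀ i, 0 ≤ z.2 i) ∧ z.1 + ∑ i, z.2 i ≤ t} with hA
    have hAm : MeasurableSet A := by
      have : A = {z | 0 ≤ z.1} ∩ ((⋂ i, {z | 0 ≤ z.2 i}) ∩ {z | z.1 + ∑ i, z.2 i ≤ t}) := by
        ext; simp [hA]
      rw [this]
      exact ((isClosed_le (by fun_prop) (by fun_prop)).inter
        ((isClosed_iInter fun i => isClosed_le (by fun_prop) (by fun_prop)).inter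
        (isClosed_le (by fun_prop) (by fun_prop)))).measurableSet
    have hmp := volume_preserving_piFinSuccAbove (fun _ : Fin (n + 1) => ℝ) 0
    have hpre : {w : Fin (n + 1) → ℝ | (∀ i, 0 ≤ w i) ∧ ∑ i, w i ≤ t} =
        MeasurableEquiv.piFinSuccAbove (fun _ : Fin (n + 1) => ℝ) 0 ⁻¹' A := by
      ext w
      simp [hA, Fin.forall_fin_succ, Fin.sum_univ_succ, and_assoc, Fin.tail]
    rw [hpre, hmp.measure_preimage hAm.nullMeasurableSet, Measure.volume_eq_prod,
      Measure.prod_apply hAm]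
    have hsl : ∀ a, volume (Prod.mk a ⁻¹' A) =
        (Set.Icc 0 t).indicator (fun a => ENNReal.ofReal ((t - a) ^ n / n.factorial)) a := by
      intro a
      by_cases ha : a ∈ Set.Icc 0 t
      · rw [Set.indicator_of_mem ha, ← ih (t - a) (by linarith [ha.2])]
        congr 1
        ext w
        simp [hA, ha.1, le_sub_iff_add_le, add_comm]
      · rw [Set.indicator_of_notMem ha]
        convert measure_empty (μ := (volume : Measure (Fin n → ℝ)))
        ext w
        simp only [hA, Set.mem_preimage, Set.mem_ofPred_eq, Set.mem_empty_iff_false, iff_false]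
        rintro ⟨h1, h2, h3⟩
        exact ha ⟨h1, by linarith [Finset.sum_nonneg fun i (_ : i ∈ Finset.univ) => h2 i]⟩
    simp only [hsl]
    rw [lintegral_indicator measurableSet_Icc, ← ofReal_integral_eq_lintegral_ofReal]
    · congr 1
      rw [integral_Icc_eq_integral_Ioc, ← intervalIntegral.integral_of_le ht,
        intervalIntegral.integral_div, intervalIntegral.integral_comp_sub_left (fun x => x ^ n),
        integral_pow]
      rw [Nat.factorial_succ]
      push_cast
      field_simp
      simp
    · exact (by fun_prop : Continuous fun a : ℝ => (t - a) ^ n / n.factorial).continuousOn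
        |>.integrableOn_Icc
    · filter_upwards [ae_restrict_mem measurableSet_Icc] with a ha
      have : 0 ≤ t - a := by linarith [ha.2]
      positivity

lemma convexHull_range_eq_image_stdSimplex {ι V : Type*} [Fintype ι] [AddCommGroup V] [Module ℝ V]
    (y : ι → V) :
    convexHull ℝ (Set.range y) = (fun w : ι → ℝ => ∑ i, w i • y i) '' stdSimplex ℝ ι := by
  classical
  have h : (fun w : ι → ℝ => ∑ i, w i • y i) = Fintype.linearCombination ℝ y := by
    ext w; simp [Fintype.linearCombination_apply]
  rw [h, ← convexHull_rangle_single_eq_stdSimplex, LinearMap.image_convexHull, ← Set.range_comp]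
  congr 2
  ext i
  simp [Fintype.linearCombination_apply]

lemma volume_convexHull_range_pi (y : Fin 4 → Fin 3 → ℝ) :
    volume (convexHull ℝ (Set.range y)) =
      ENNReal.ofReal (|(Matrix.of fun i j : Fin 3 => y j.castSucc i - y 3 i).det| / 6) := by
  set M : Matrix (Fin 3) (Fin 3) ℝ := Matrix.of fun i j : Fin 3 => y j.castSucc i - y 3 i
  have h : convexHull ℝ (Set.range y) = (fun v => y 3 + v) ''
      (Matrix.toLin' M '' {w : Fin 3 → ℝ | (∀ i, 0 ≤ w i) ∧ ∑ i, w i ≤ 1}) := by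
    rw [convexHull_range_eq_image_stdSimplex, Set.image_image]
    ext p
    constructor
    · rintro ⟨w, ⟨hw0, hw1⟩, rfl⟩
      refine ⟨fun i => w i.castSucc, ⟨fun i => hw0 _, ?_⟩, ?_⟩
      · rw [Fin.sum_univ_castSucc] at hw1
        linarith [hw0 (Fin.last 3)]
      · rw [Fin.sum_univ_four] at hw1
        ext k
        have : w 3 = 1 - (w 0 + w 1 + w 2) := by linarith
        simp [M, Matrix.mulVec, dotProduct, Fin.sum_univ_succ, this]
        ring
    · rintro ⟨w, ⟨hw0, hw1⟩, rfl⟩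
      rw [Fin.sum_univ_three] at hw1
      refine ⟨![w 0, w 1, w 2, 1 - (w 0 + w 1 + w 2)], ⟨fun i => ?_, ?_⟩, ?_⟩
      · fin_cases i
        exacts [hw0 0, hw0 1, hw0 2, sub_nonneg.2 hw1]
      · simp [Fin.sum_univ_four]
      · ext k
        simp [M, Matrix.mulVec, dotProduct, Fin.sum_univ_four, Fin.sum_univ_three]
        ring
  rw [h, Set.image_add_left, measure_preimage_add, Measure.addHaar_image_linearMap,
    LinearMap.det_toLin', volume_simplex 3 1 zero_le_one, ← ENNReal.ofReal_mul (abs_nonneg _)]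
  congr 1
  norm_num [Nat.factorial, div_eq_mul_inv]

lemma volume_convexHull_range (y : Fin 4 → Euc 3) :
    volume (convexHull ℝ (Set.range y)) =
      ENNReal.ofReal (|eucDet (fun j => y j.castSucc) (y 3)| / 6) := by
  have hmp := PiLp.volume_preserving_ofLp (Fin 3)
  set e : Euc 3 →ₗ[ℝ] Fin 3 → ℝ := (WithLp.linearEquiv 2 ℝ (Fin 3 → ℝ)).toLinearMap
  have h1 : convexHull ℝ (Set.range y) =
      WithLp.ofLp ⁻¹' convexHull ℝ (Set.range fun i => (y i).ofLp) := by
    have : Set.range (fun i => (y i).ofLp) = e '' Set.range y := by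
      rw [← Set.range_comp]; rfl
    rw [this, ← LinearMap.image_convexHull]
    exact (Set.preimage_image_eq _ (WithLp.linearEquiv 2 ℝ (Fin 3 → ℝ)).injective).symm
  rw [h1, hmp.measure_preimage
    ((convex_convexHull ℝ _).nullMeasurableSet _), volume_convexHull_range_pi]
  congr 2
  rw [← abs_neg]
  congr 1
  rw [Matrix.det_fin_three]
  simp [eucDet, tetDet, triDet, coordChart_apply]
  ring

lemma volume_interior_convexHull_range (y : Fin 4 → Euc 3) :
    volume (interior (convexHull ℝ (Set.range y))) =
      ENNReal.ofReal (|eucDet (fun j => y j.castSucc) (y 3)| / 6) := by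
  rw [← volume_convexHull_range]
  exact measure_congr (interior_ae_eq_of_null_frontier ((convex_convexHull ℝ _).addHaar_frontier _))

lemma ae_triDet_coordChart_ne_zero :
    ∀ᵐ x : Fin 3 → Euc 3, triDet (fun i => (coordChart 0 (x i)).1) ≠ 0 := by
  have h1 := volume_preserving_pi fun _ : Fin 3 => measurePreserving_coordChart 0
  have h2 := volume_measurePreserving_arrowProdEquivProdArrow (ℝ × ℝ) ℝ (Fin 3)
  have h3 := (Measure.quasiMeasurePreserving_fst
    (μ := (volume : Measure (Fin 3 → ℝ × ℝ))) (ν := (volume : Measure (Fin 3 → ℝ)))).comp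
      (h2.comp h1).quasiMeasurePreserving
  exact h3.ae ae_triDet_ne_zero

lemma ae_tetDet_ne_zero {x : Fin 3 → (ℝ × ℝ) × ℝ} (hx : triDet (fun i => (x i).1) ≠ 0) :
    ∀ᵐ q : (ℝ × ℝ) × ℝ, tetDet x q ≠ 0 := by
  have hm : MeasurableSet {q | tetDet x q = 0} := measurable_tetDet_right x (measurableSet_singleton 0)
  rw [ae_iff]
  simp only [ne_eq, not_not]
  rw [Measure.volume_eq_prod, Measure.measure_prod_null hm]
  refine Eventually.of_forall fun p => Set.Subsingleton.measure_zero ?_ _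
  intro s hs t ht
  simp only [Set.mem_preimage, Set.mem_ofPred_eq, tetDet] at hs ht
  exact mul_left_cancel₀ hx (by linear_combination hs - ht)

lemma ae_eucDet_ne_zero :
    ∀ᵐ y : Fin 4 → Euc 3, eucDet (fun j => y j.castSucc) (y 3) ≠ 0 := by
  have h1 := volume_preserving_piFinSuccAbove (fun _ : Fin 4 => Euc 3) (Fin.last 3)
  have h2 := Measure.measurePreserving_swap (μ := (volume : Measure (Euc 3)))
    (ν := (volume : Measure (Fin 3 → Euc 3)))
  have hm : MeasurableSet {z : (Fin 3 → Euc 3) × Euc 3 | eucDet z.1 z.2 ≠ 0} :=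
    (measurable_eucDet (measurableSet_singleton 0)).compl
  have h : ∀ᵐ z : (Fin 3 → Euc 3) × Euc 3, eucDet z.1 z.2 ≠ 0 := by
    rw [Measure.volume_eq_prod, Measure.ae_prod_iff_ae_ae hm]
    filter_upwards [ae_triDet_coordChart_ne_zero] with x hx
    exact (measurePreserving_coordChart 0).quasiMeasurePreserving.ae (ae_tetDet_ne_zero hx)
  have := (h2.comp h1).quasiMeasurePreserving.ae h
  filter_upwards [this] with y hy
  have he : (fun j => y ((Fin.last 3).succAbove j)) = fun j : Fin 3 => y j.castSucc := by
    simp only [Fin.succAbove_last]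
  exact he ▸ hy

lemma isOpen_mem_interior_convexHull {ι E : Type*} [Finite ι] [NormedAddCommGroup E]
    [InnerProductSpace ℝ E] [CompleteSpace E] :
    IsOpen {z : (ι → E) × E | z.2 ∈ interior (convexHull ℝ (Set.range z.1))} := by
  have := Fintype.ofFinite ι
  rw [Metric.isOpen_iff]
  rintro ⟨y₀, z₀⟩ hz
  obtain ⟨R, hR, hball⟩ := Metric.isOpen_iff.1 isOpen_interior z₀ hz
  have hr : 0 < R / 4 := by positivity
  refine ⟨R / 4, hr, fun ⟨y, z⟩ hyz => ?_⟩
  rw [← ball_prod_same, Set.mem_prod] at hyz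
  obtain ⟨hy, hz'⟩ := hyz
  simp only [Metric.mem_ball] at hy hz'
  change z ∈ interior (convexHull ℝ (Set.range y))
  refine interior_maximal ?_ Metric.isOpen_ball (Metric.mem_ball.2 hz')
  intro p hp
  by_contra hpc
  obtain ⟨f, u, hfu, huf⟩ := geometric_hahn_banach_closed_point (convex_convexHull ℝ (Set.range y))
    ((Set.finite_range y).isClosed_convexHull ℝ) hpc
  set v := (InnerProductSpace.toDual ℝ E).symm f
  have hfv : ∀ q, f q = inner ℝ v q := fun q => (InnerProductSpace.toDual_symm_apply).symm
  have hy0 : convexHull ℝ (Set.range y₀) ⊆ {q | f q ≤ u + ‖v‖ * (R / 4)} := by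
    refine convexHull_min ?_ (convex_halfSpace_le f.toLinearMap.isLinear _)
    rintro _ ⟨i, rfl⟩
    have h1 := hfu (y i) (subset_convexHull ℝ _ ⟨i, rfl⟩)
    have h2 : f (y₀ i) - f (y i) ≤ ‖v‖ * (R / 4) := by
      rw [← map_sub, hfv]
      refine (real_inner_le_norm _ _).trans (mul_le_mul_of_nonneg_left ?_ (norm_nonneg _))
      rw [← dist_eq_norm, dist_comm]
      exact (dist_le_pi_dist y y₀ i).trans hy.le
    simp only [Set.mem_ofPred_eq]
    linarith
  have hne : Nonempty ι := by
    by_contra h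
    have := not_nonempty_iff.1 h
    simp [Set.range_eq_empty] at hz
  have hv : 0 < ‖v‖ := by
    rw [norm_pos_iff]
    intro h0
    have h1 := hfu (y hne.some) (subset_convexHull ℝ _ ⟨_, rfl⟩)
    rw [hfv, h0, inner_zero_left] at h1
    rw [hfv, h0, inner_zero_left] at huf
    linarith
  have hq := hy0 (interior_subset (hball (a := z₀ + (R * 3 / 4 / ‖v‖) • v) (by
    rw [Metric.mem_ball, dist_eq_norm, add_sub_cancel_left, norm_smul, Real.norm_of_nonneg
      (by positivity), div_mul_cancel₀ _ hv.ne']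
    linarith)))
  simp only [Set.mem_ofPred_eq, map_add, map_smul, smul_eq_mul] at hq
  have hvv : f v = ‖v‖ * ‖v‖ := by rw [hfv, real_inner_self_eq_norm_mul_norm]
  have hpz : f p - f z₀ ≤ ‖v‖ * (R / 4) := by
    rw [← map_sub, hfv]
    refine (real_inner_le_norm _ _).trans (mul_le_mul_of_nonneg_left ?_ (norm_nonneg _))
    rw [← dist_eq_norm]
    exact (Metric.mem_ball.1 hp).le
  have : R * 3 / 4 / ‖v‖ * (‖v‖ * ‖v‖) = R * 3 / 4 * ‖v‖ := by field_simp
  rw [hvv, this] at hq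
  have : 0 < ‖v‖ * R := by positivity
  linarith

lemma volume_convexHull_of_card_le_three {H : Finset (Euc 3)} (hH : H.card ≤ 3) :
    volume (convexHull ℝ (H : Set (Euc 3))) = 0 := by
  classical
  rcases H.eq_empty_or_nonempty with rfl | hne
  · simp
  refine measure_mono_null (convexHull_subset_affineSpan _)
    (Measure.addHaar_affineSubspace _ _ fun htop => ?_)
  obtain ⟨n, hn⟩ := Nat.exists_eq_succ_of_ne_zero (Finset.card_pos.2 hne).ne'
  have h1 := finrank_vectorSpan_image_finset_le ℝ (id : Euc 3 → Euc 3) H hn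
  rw [Finset.image_id, ← direction_affineSpan, htop, AffineSubspace.direction_top, finrank_top,
    finrank_euclideanSpace_fin] at h1
  omega

lemma inConvexPosition_of_volume_ne_zero {H : Finset (Euc 3)} (hH : H.card = 4)
    (hv : volume (convexHull ℝ (H : Set (Euc 3))) ≠ 0) : InConvexPosition (H : Set (Euc 3)) := by
  classical
  intro p hp hmem
  refine hv (measure_mono_null ?_ (volume_convexHull_of_card_le_three (H := H.erase p) ?_))
  · rw [Finset.coe_erase]
    refine convexHull_min (fun q hq => ?_) (convex_convexHull ℝ _)
    by_cases hqp : q = p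
    · exact hqp ▸ hmem
    · exact subset_convexHull ℝ _ ⟨hq, hqp⟩
  · rw [Finset.card_erase_of_mem hp, hH]

lemma InConvexPosition.notMem_interior {d : ℕ} {P : Set (Euc d)} (h : InConvexPosition P)
    (hP : P.Finite) [NeZero d] {p : Euc d} (hp : p ∈ P) : p ∉ interior (convexHull ℝ P) := by
  intro hinter
  have hext : p ∉ (convexHull ℝ P).extremePoints ℝ :=
    fun hp' => Set.disjoint_left.1 (disjoint_interior_extremePoints _) hinter hp'
  refine h p hp ?_
  have hsub : (convexHull ℝ P).extremePoints ℝ ⊆ P \ {p} := fun q hq =>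
    ⟨extremePoints_convexHull_subset hq, fun hqp => hext (hqp ▸ hq)⟩
  have hcl := closure_convexHull_extremePoints (hP.isCompact_convexHull ℝ) (convex_convexHull ℝ P)
  have : p ∈ closure (convexHull ℝ ((convexHull ℝ P).extremePoints ℝ)) :=
    by rw [hcl]; exact subset_convexHull ℝ P hp
  exact closure_minimal (convexHull_mono hsub)
    ((hP.subset Set.sdiff_subset).isClosed_convexHull ℝ) this

open Classical in
lemma holeCount_eq {m : ℕ} {x : Fin (m + 4) → Euc 3}
    (hx : ∀ s : Finset (Fin (m + 4)), s.card = 4 →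
      volume (convexHull ℝ (x '' (s : Set (Fin (m + 4))))) ≠ 0) :
    holeCount 3 4 (m + 4) x = ((Finset.powersetCard 4 Finset.univ).filter fun s : Finset (Fin (m + 4)) =>
      ∀ j ∉ s, x j ∉ interior (convexHull ℝ (x '' (s : Set (Fin (m + 4)))))).card := by
  have hinj : Function.Injective x := by
    intro i j hij
    by_contra hne
    obtain ⟨s, hs, -, hs4⟩ := Finset.exists_subsuperset_card_eq
      (Finset.subset_univ ({i, j} : Finset (Fin (m + 4)))) (n := 4)
      (by rw [Finset.card_pair hne]; norm_num) (by simp)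
    refine hx s hs4 ?_
    rw [← Finset.coe_image]
    refine volume_convexHull_of_card_le_three ?_
    have hi : i ∈ s := hs (by simp)
    have hj : j ∈ s := hs (by simp)
    have hlt : (s.image x).card < s.card := by
      refine lt_of_le_of_ne Finset.card_image_le fun h => hne ?_
      exact Finset.card_image_iff.1 h hi hj hij
    omega
  rw [holeCount, ← Finset.card_image_of_injective _ (Finset.image_injective hinj)]
  congr 1
  ext H
  simp only [Finset.mem_filter, Finset.mem_powerset, Finset.mem_image, Finset.mem_powersetCard]
  constructor
  · rintro ⟨hH, -, hcard, -, hinter⟩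
    obtain ⟨s, -, rfl⟩ := Finset.subset_image_iff.1 hH
    rw [Finset.card_image_of_injective _ hinj] at hcard
    refine ⟨s, ⟨⟨Finset.subset_univ _, hcard⟩, fun j _ => ?_⟩, rfl⟩
    rw [← Finset.coe_image]
    exact hinter _ (Finset.mem_image_of_mem _ (Finset.mem_univ _))
  · rintro ⟨s, ⟨⟨-, hcard⟩, hinter⟩, rfl⟩
    have hH : s.image x ⊆ Finset.univ.image x := Finset.image_subset_image (Finset.subset_univ _)
    have hcard' : (s.image x).card = 4 := by rw [Finset.card_image_of_injective _ hinj, hcard]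
    have hv := hx s hcard
    rw [← Finset.coe_image] at hv
    have hpos := inConvexPosition_of_volume_ne_zero hcard' hv
    refine ⟨hH, hH, hcard', hpos, fun p hp => ?_⟩
    obtain ⟨j, -, rfl⟩ := Finset.mem_image.1 hp
    by_cases hj : j ∈ s
    · exact hpos.notMem_interior (Finset.finite_toSet _) (Finset.mem_image_of_mem _ hj)
    · rw [Finset.coe_image]
      exact hinter j hj

lemma measurePreserving_splitFin {n k : ℕ} {E : Type*} [MeasurableSpace E] (μ : Measure E)
    [SigmaFinite μ] {s : Finset (Fin n)} (e : Fin k ≃ s) :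
    MeasurePreserving (fun x : Fin n → E => (fun i => x (e i), fun j : {j // j ∉ s} => x j))
      (Measure.pi fun _ => μ) ((Measure.pi fun _ => μ).prod (Measure.pi fun _ => μ)) := by
  have h1 : MeasurePreserving (MeasurableEquiv.piEquivPiSubtypeProd (fun _ => E) (· ∈ s))
      (Measure.pi fun _ => μ) ((Measure.pi fun _ : s => μ).prod (Measure.pi fun _ => μ)) := by
    convert measurePreserving_piEquivPiSubtypeProd (fun _ : Fin n => μ) (· ∈ s)
  have h2 := (measurePreserving_piCongrLeft (fun _ : s => μ) e).symm
  exact (h2.prod (MeasurePreserving.id _)).comp h1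

lemma image_eq_range_comp {n k : ℕ} {E : Type*} {s : Finset (Fin n)} (e : Fin k ≃ s)
    (x : Fin n → E) : x '' (s : Set (Fin n)) = Set.range fun i => x (e i) := by
  have : (fun i => x (e i)) = (x ∘ Subtype.val) ∘ e := rfl
  rw [this, e.surjective.range_comp, Set.range_comp]
  simp

lemma measurableSet_emptySimplex {n : ℕ} (s : Finset (Fin n)) :
    MeasurableSet {x : Fin n → Euc 3 |
      ∀ j ∉ s, x j ∉ interior (convexHull ℝ (x '' (s : Set (Fin n))))} := by
  have : {x : Fin n → Euc 3 | ∀ j ∉ s, x j ∉ interior (convexHull ℝ (x '' (s : Set (Fin n))))} =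
      ⋂ j, ⋂ (_ : j ∉ s), (fun x : Fin n → Euc 3 => ((fun i : s => x i), x j)) ⁻¹'
        {z : (s → Euc 3) × Euc 3 | z.2 ∈ interior (convexHull ℝ (Set.range z.1))}ᶜ := by
    ext x
    have h : Set.range (fun i : s => x i) = x '' (s : Set (Fin n)) := by
      ext; simp
    simp only [Set.mem_ofPred_eq, Set.mem_iInter, Set.mem_preimage, Set.mem_compl_iff, h]
  rw [this]
  refine MeasurableSet.iInter fun j => MeasurableSet.iInter fun _ => ?_
  exact ((isOpen_mem_interior_convexHull.isClosed_compl).preimage (by fun_prop)).measurableSet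

lemma measure_emptySimplex {n k : ℕ} (μ : Measure (Euc 3)) [IsProbabilityMeasure μ]
    {s : Finset (Fin n)} (e : Fin k ≃ s) :
    (Measure.pi fun _ : Fin n => μ) {x | ∀ j ∉ s,
      x j ∉ interior (convexHull ℝ (x '' (s : Set (Fin n))))} =
      ∫⁻ y, μ (interior (convexHull ℝ (Set.range y)))ᶜ ^ (n - k)
        ∂Measure.pi fun _ : Fin k => μ := by
  have hmp := measurePreserving_splitFin μ e
  set B : Set ((Fin k → Euc 3) × ({j // j ∉ s} → Euc 3)) :=
    {z | ∀ j, z.2 j ∉ interior (convexHull ℝ (Set.range z.1))} with hB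
  have hBm : MeasurableSet B := by
    have : B = ⋂ j, (fun z : (Fin k → Euc 3) × ({j // j ∉ s} → Euc 3) => (z.1, z.2 j)) ⁻¹'
        {z : (Fin k → Euc 3) × Euc 3 | z.2 ∈ interior (convexHull ℝ (Set.range z.1))}ᶜ := by
      ext; simp [hB]
    rw [this]
    refine MeasurableSet.iInter fun j => ?_
    exact ((isOpen_mem_interior_convexHull.isClosed_compl).preimage (by fun_prop)).measurableSet
  have hpre : {x : Fin n → Euc 3 | ∀ j ∉ s,
      x j ∉ interior (convexHull ℝ (x '' (s : Set (Fin n))))} =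
      (fun x : Fin n → Euc 3 => (fun i => x (e i), fun j : {j // j ∉ s} => x j)) ⁻¹' B := by
    ext x
    simp [hB, image_eq_range_comp e]
  rw [hpre, hmp.measure_preimage hBm.nullMeasurableSet, Measure.prod_apply hBm]
  refine lintegral_congr fun y => ?_
  have : Prod.mk y ⁻¹' B =
      Set.univ.pi fun _ => (interior (convexHull ℝ (Set.range y)))ᶜ := by
    ext w; simp [hB]
  rw [this, Measure.pi_pi, Finset.prod_const]
  congr 1
  have hk : s.card = k := by simpa using (Fintype.card_congr e).symm
  rw [Finset.card_univ, Fintype.card_subtype_compl]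
  simp [hk]

lemma unif_eq {K : Set (Euc 3)} (hvol : volume K = 1) : unif K = volume.restrict K := by
  simp [unif, hvol]

lemma ae_volume_convexHull_ne_zero {n : ℕ} (K : Set (Euc 3)) :
    ∀ᵐ x ∂(Measure.pi fun _ : Fin n => volume.restrict K), ∀ s : Finset (Fin n), s.card = 4 →
      volume (convexHull ℝ (x '' (s : Set (Fin n)))) ≠ 0 := by
  rw [ae_all_iff]
  intro s
  by_cases hs : s.card = 4
  swap
  · exact Eventually.of_forall fun x h => absurd h hs
  have e : Fin 4 ≃ s := (s.equivFinOfCardEq hs).symm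
  have hmp := measurePreserving_splitFin (volume.restrict K) e
  have h4 : ∀ᵐ y ∂(Measure.pi fun _ : Fin 4 => volume.restrict K),
      eucDet (fun j => y j.castSucc) (y 3) ≠ 0 := by
    rw [← Measure.restrict_pi_pi]
    exact ae_restrict_of_ae ae_eucDet_ne_zero
  have := (Measure.quasiMeasurePreserving_fst.comp hmp.quasiMeasurePreserving).ae h4
  filter_upwards [this] with x hx _
  rw [image_eq_range_comp e, volume_convexHull_range]
  simpa using hx

lemma lintegral_emptySimplex {K : Set (Euc 3)} (hc : IsCompact K) (hconv : Convex ℝ K)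
    (hvol : volume K = 1) (m : ℕ) :
    ∫⁻ y, (volume.restrict K) (interior (convexHull ℝ (Set.range y)))ᶜ ^ m
      ∂(Measure.pi fun _ : Fin 4 => volume.restrict K) =
    ∫⁻ x in Set.univ.pi (fun _ : Fin 3 => K), ∫⁻ z in K, missPow m (eucDet x z) := by
  have h1 : ∀ᵐ y ∂(Measure.pi fun _ : Fin 4 => volume.restrict K),
      (volume.restrict K) (interior (convexHull ℝ (Set.range y)))ᶜ ^ m =
        missPow m (eucDet (fun j => y j.castSucc) (y 3)) := by
    rw [← Measure.restrict_pi_pi]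
    filter_upwards [ae_restrict_mem (MeasurableSet.univ_pi fun _ => hc.measurableSet)] with y hy
    have hsub : interior (convexHull ℝ (Set.range y)) ⊆ K :=
      interior_subset.trans (convexHull_min (by rintro _ ⟨i, rfl⟩; exact hy i trivial) hconv)
    rw [Measure.restrict_apply isOpen_interior.measurableSet.compl, Set.inter_comm,
      ← Set.sdiff_eq, measure_sdiff hsub isOpen_interior.measurableSet.nullMeasurableSet
        (measure_ne_top_of_subset hsub (by simp [hvol])), hvol, volume_interior_convexHull_range,
      missPow, ENNReal.ofReal_sub _ (by positivity), ENNReal.ofReal_one]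
  rw [lintegral_congr_ae h1]
  have hm : Measurable fun z : (Fin 3 → Euc 3) × Euc 3 => missPow m (eucDet z.1 z.2) :=
    (measurable_missPow m).comp measurable_eucDet
  have hmp := (Measure.measurePreserving_swap).comp
    (measurePreserving_piFinSuccAbove (fun _ : Fin 4 => (volume : Measure (Euc 3)).restrict K)
      (Fin.last 3))
  have h2 := hmp.lintegral_comp hm
  rw [lintegral_prod _ hm.aemeasurable] at h2
  rw [volume_pi, Measure.restrict_pi_pi]
  refine Eq.trans ?_ h2
  refine lintegral_congr fun y => ?_
  have he : (fun j => y ((Fin.last 3).succAbove j)) = fun j : Fin 3 => y j.castSucc := by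
    simp only [Fin.succAbove_last]
  rw [← he]
  rfl

lemma EH_add_four {K : Set (Euc 3)} (hc : IsCompact K) (hconv : Convex ℝ K)
    (hvol : volume K = 1) (m : ℕ) :
    EH 3 4 K (m + 4) = ((m + 4).choose 4 : ℝ) *
      (∫⁻ x in Set.univ.pi (fun _ : Fin 3 => K), ∫⁻ z in K, missPow m (eucDet x z)).toReal := by
  classical
  have hprob : IsProbabilityMeasure ((volume : Measure (Euc 3)).restrict K) := ⟨by simp [hvol]⟩
  rw [EH, unif_eq hvol]
  set A : Finset (Fin (m + 4)) → Set (Fin (m + 4) → Euc 3) := fun s =>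
    {x | ∀ j ∉ s, x j ∉ interior (convexHull ℝ (x '' (s : Set (Fin (m + 4)))))} with hA
  have hAm : ∀ s, MeasurableSet (A s) := measurableSet_emptySimplex
  have hcount : ∀ᵐ x ∂(Measure.pi fun _ : Fin (m + 4) => (volume : Measure (Euc 3)).restrict K),
      (holeCount 3 4 (m + 4) x : ℝ) =
        ∑ s ∈ Finset.powersetCard 4 Finset.univ, (A s).indicator 1 x := by
    filter_upwards [ae_volume_convexHull_ne_zero K] with x hx
    rw [holeCount_eq hx, Finset.card_filter]
    push_cast
    refine Finset.sum_congr rfl fun s _ => ?_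
    simp [Set.indicator_apply, hA]
  rw [integral_congr_ae hcount, integral_finsetSum]
  · rw [Finset.sum_congr rfl fun s hs => ?_, Finset.sum_const, Finset.card_powersetCard,
      Finset.card_univ, Fintype.card_fin, nsmul_eq_mul]
    rw [integral_indicator_one (hAm s), measureReal_def,
      measure_emptySimplex _ (s.equivFinOfCardEq (Finset.mem_powersetCard.1 hs).2).symm,
      Nat.add_sub_cancel, lintegral_emptySimplex hc hconv hvol]
  · intro s _
    exact (integrable_const (1 : ℝ)).indicator (hAm s)

lemma tendsto_choose_four_div :
    Tendsto (fun m : ℕ => ((m + 4).choose 4 : ℝ) / (m * ((m + 4 : ℕ) : ℝ) ^ 3)) atTop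
      (nhds (1 / 24)) := by
  have hu : Tendsto (fun m : ℕ => ((m : ℝ))⁻¹) atTop (nhds 0) := tendsto_inv_atTop_nhds_zero_nat
  have hg : ContinuousAt (fun u : ℝ => (1 + 3 * u) * (1 + 2 * u) * (1 + u) /
      (24 * (1 + 4 * u) ^ 2)) 0 := by
    refine ContinuousAt.div (by fun_prop) (by fun_prop) (by norm_num)
  have h := hg.tendsto.comp hu
  norm_num at h
  refine h.congr' ?_
  filter_upwards [eventually_ge_atTop 1] with m hm
  have hm' : (0 : ℝ) < m := by exact_mod_cast hm
  have hch : (24 : ℝ) * (m + 4).choose 4 = (m + 4) * (m + 3) * (m + 2) * (m + 1) := by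
    have := Nat.descFactorial_eq_factorial_mul_choose (m + 4) 4
    simp only [Nat.descFactorial_succ, Nat.descFactorial_zero, Nat.factorial] at this
    have h2 : ((m + 4 : ℕ) - 3) * ((m + 4 - 2) * ((m + 4 - 1) * (m + 4))) =
      (m + 1) * ((m + 2) * ((m + 3) * (m + 4))) := rfl
    have h3 : (m + 1) * ((m + 2) * ((m + 3) * (m + 4))) = 24 * (m + 4).choose 4 := by
      rw [← h2]; simpa using this
    have h4 : ((m : ℝ) + 1) * ((m + 2) * ((m + 3) * (m + 4))) = 24 * (m + 4).choose 4 := by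
      exact_mod_cast h3
    rw [← h4]; ring
  have hch' : ((m + 4).choose 4 : ℝ) = (m + 4) * (m + 3) * (m + 2) * (m + 1) / 24 := by
    rw [← hch]; ring
  simp only [Function.comp_apply]
  rw [hch']
  push_cast
  field_simp

/-- For every convex body `K ⊆ ℝ³` of unit volume,
`3 ≤ liminf n^{-3} EH^K_{3,4}(n)` and `limsup n^{-3} EH^K_{3,4}(n) ≤ 12π²/35`. -/
theorem statement3 (K : Set (Euc 3)) (hK : IsConvexBody K) (hvol : volume K = 1) :
    3 ≤ Filter.liminf (fun n : ℕ => EH 3 4 K n / (n : ℝ) ^ 3) Filter.atTop ∧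
    Filter.limsup (fun n : ℕ => EH 3 4 K n / (n : ℝ) ^ 3) Filter.atTop ≤
      12 * Real.pi ^ 2 / 35 := by
  obtain ⟨hconv, hc, -⟩ := hK
  obtain ⟨L, ht, hl, hu⟩ := exists_tendsto_eucDet hc hconv hvol
  have hL : L ≠ ∞ := ne_top_of_le_ne_top ENNReal.ofReal_ne_top hu
  have hreal := (ENNReal.tendsto_toReal hL).comp ht
  have hlim : Tendsto (fun n : ℕ => EH 3 4 K n / (n : ℝ) ^ 3) atTop
      (nhds (1 / 24 * L.toReal)) := by
    rw [← tendsto_add_atTop_iff_nat 4]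
    refine (tendsto_choose_four_div.mul hreal).congr' ?_
    filter_upwards [eventually_ge_atTop 1] with m hm
    have hm' : (m : ℝ) ≠ 0 := by positivity
    rw [EH_add_four hc hconv hvol, Function.comp_apply, ENNReal.toReal_mul, ENNReal.toReal_natCast]
    field_simp
  rw [hlim.liminf_eq, hlim.limsup_eq]
  constructor
  · have : 72 ≤ L.toReal := by
      rw [← ENNReal.ofReal_le_iff_le_toReal hL]
      simpa using hl
    linarith
  · have : L.toReal ≤ 288 * Real.pi ^ 2 / 35 := ENNReal.toReal_le_of_le_ofReal (by positivity) hu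
    linarith
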